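/- Let μ be a finite positive Borel measure on the unit circle belonging to Iso(φ) for an inner function φ, and let Φ : H(φ) → L²(T, μ) denote the associated isometric embedding. For g ∈ H(φ) let g_n denote the n-th partial sum of its Taylor series. Then for μ-a.e. ω, g_n(ω) = Φ(g)(ω) − ω^{n+1} Φ((S*)^{n+1} g)(ω), and consequently ‖Φ(g) − g_n‖_{L²(μ)} = ‖(S*)^{n+1} g‖_{H²} → 0 as n → ∞. -/

import Mathlib

open Complex MeasureTheory Metric Set Filter
open scoped Topology ComplexConjugate Real

/-- Normalized Lebesgue (Haar) measure on the unit circle, realized as a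
measure on `ℂ`. -/
noncomputable def circleHaar : Measure ℂ :=
  (ENNReal.ofReal (2 * π)⁻¹) •
    Measure.map (fun t : ℝ => Complex.exp (t * Complex.I))
      (volume.restrict (Ioc (0:ℝ) (2 * π)))

/-- An inner function. -/
def IsInner (φ : ℂ → ℂ) : Prop :=
  DifferentiableOn ℂ φ (ball (0:ℂ) 1) ∧
  MapsTo φ (ball (0:ℂ) 1) (ball (0:ℂ) 1) ∧
  ∀ᵐ ω ∂circleHaar, Tendsto (fun r : ℝ => ‖φ (r • ω)‖) (𝓝[<] 1) (𝓝 1)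

/-- Normalized boundary pairing at radius `r`:
`(2π)⁻¹ ∫₀^{2π} f(r e^{it}) conj (g(r e^{it})) dt`. -/
noncomputable def pairR (f g : ℂ → ℂ) (r : ℝ) : ℂ :=
  (2 * (π : ℂ))⁻¹ *
    ∫ t in (0:ℝ)..(2 * π),
      f (r * Complex.exp (t * Complex.I)) * conj (g (r * Complex.exp (t * Complex.I)))

/-- Membership in the Hardy space `H²` of the disc: holomorphic with uniformly
bounded quadratic integral means. -/
def MemH2 (f : ℂ → ℂ) : Prop :=
  DifferentiableOn ℂ f (ball (0:ℂ) 1) ∧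
    ∃ C : ℝ, ∀ r ∈ Ico (0:ℝ) 1, (pairR f f r).re ≤ C

/-- Membership in the model space `H(φ) = H² ⊖ φH²`: belonging to `H²` and
being orthogonal (in the boundary `L²` pairing) to every element of `φH²`. -/
def MemModel (φ f : ℂ → ℂ) : Prop :=
  MemH2 f ∧ ∀ g : ℂ → ℂ, MemH2 g →
    Tendsto (fun r => pairR f (fun w => φ w * g w) r) (𝓝[<] (1:ℝ)) (𝓝 0)




lemma c0_hasSum {S : Type*} [DecidableEq S] (v : lp (fun _ : S => ℂ) ⊤)
    (hv : ∀ ε > 0, {s | ε < ‖v s‖}.Finite) :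
    HasSum (fun s => lp.single (E := fun _ : S => ℂ) ⊤ s (v s)) v := by
  rw [HasSum, SummationFilter.unconditional_filter, Metric.tendsto_atTop]
  intro ε hε
  refine ⟨(hv (ε/2) (by positivity)).toFinset, fun A hA => ?_⟩
  refine lt_of_le_of_lt ?_ (half_lt_self hε)
  rw [dist_eq_norm]
  refine lp.norm_le_of_forall_le (by positivity) fun s => ?_
  have : ((∑ b ∈ A, lp.single (E := fun _ : S => ℂ) ⊤ b (v b) : lp (fun _ : S => ℂ) ⊤) : S → ℂ) s
      = if s ∈ A then v s else 0 := by
    rw [lp.coeFn_sum, Finset.sum_apply]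
    simp [lp.single_apply, Pi.single_apply]
  rw [lp.coeFn_sub, Pi.sub_apply, this]
  split_ifs with h
  · simp; positivity
  · simp only [zero_sub, norm_neg]
    by_contra hcon
    exact h (hA (by simpa using hcon))

lemma l1_of_dual {S : Type*} [DecidableEq S] (Λ : StrongDual ℂ (lp (fun _ : S => ℂ) ⊤)) :
    Summable (fun s => ‖Λ (lp.single (E := fun _ : S => ℂ) ⊤ s 1)‖) := by
  refine summable_of_sum_le (c := ‖Λ‖) (fun _ => norm_nonneg _) fun A => ?_
  set α : S → ℂ := fun s => Λ (lp.single (E := fun _ : S => ℂ) ⊤ s 1)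
  have hsg : ∀ w : ℂ, ∃ u : ℂ, ‖u‖ ≤ 1 ∧ u * w = ‖w‖ := by
    intro w
    by_cases h : w = 0
    · exact ⟨0, by simp, by simp [h]⟩
    · refine ⟨conj w / ‖w‖, ?_, ?_⟩
      · simp [h]
      · have : (‖w‖ : ℂ) ≠ 0 := by simpa using h
        field_simp
        rw [mul_comm, Complex.mul_conj, Complex.normSq_eq_norm_sq]; push_cast; ring
  choose u hu1 hu2 using hsg
  set y : lp (fun _ : S => ℂ) ⊤ := ∑ s ∈ A, u (α s) • lp.single (E := fun _ : S => ℂ) ⊤ s (1:ℂ)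
  have hy : ‖y‖ ≤ 1 := by
    refine lp.norm_le_of_forall_le (by positivity) fun s => ?_
    have : (y : S → ℂ) s = if s ∈ A then u (α s) else 0 := by
      simp only [y]
      rw [lp.coeFn_sum, Finset.sum_apply]
      simp [lp.single_apply, Pi.single_apply]
    rw [this]; split_ifs
    · exact hu1 _
    · simp
  have h1 : Λ y = ((∑ s ∈ A, ‖α s‖ : ℝ) : ℂ) := by
    simp only [y, map_sum, map_smul, smul_eq_mul]
    push_cast
    exact Finset.sum_congr rfl fun s _ => hu2 _
  have h2 : ‖Λ y‖ ≤ ‖Λ‖ := by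
    simpa using (Λ.le_opNorm_of_le hy)
  rw [h1, Complex.norm_real] at h2
  exact (le_abs_self _).trans h2

lemma sep_submodule {Y : Type*} [NormedAddCommGroup Y] [NormedSpace ℂ Y] (V : Submodule ℂ Y)
    (y : Y) (hy : y ∉ closure (V : Set Y)) :
    ∃ Λ : StrongDual ℂ Y, (∀ v ∈ V, Λ v = 0) ∧ Λ y ≠ 0 := by
  obtain ⟨Λ, u, h1, h2⟩ := RCLike.geometric_hahn_banach_closed_point (𝕜 := ℂ)
    (s := closure (V : Set Y)) (x := y)
    ((V.restrictScalars ℝ).convex.closure) isClosed_closure hy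
  have hu : 0 < u := by simpa using h1 0 (subset_closure V.zero_mem)
  have hz : ∀ v ∈ V, Λ v = 0 := by
    intro v hv
    by_contra hne
    have h3 := h1 (((u + 1 : ℝ) : ℂ) • ((Λ v)⁻¹ • v))
      (subset_closure (V.smul_mem _ (V.smul_mem _ hv)))
    have h4 : Λ (((u + 1 : ℝ) : ℂ) • ((Λ v)⁻¹ • v)) = ((u + 1 : ℝ) : ℂ) := by
      rw [Λ.map_smul, Λ.map_smul, smul_eq_mul, smul_eq_mul, inv_mul_cancel₀ hne, mul_one]
    rw [h4] at h3
    simp at h3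
    linarith
  refine ⟨Λ, hz, fun h => ?_⟩
  rw [h] at h2
  simp at h2
  linarith

theorem krein_smulian {X : Type*} [NormedAddCommGroup X] [NormedSpace ℂ X] [CompleteSpace X]
    (E : Submodule ℂ (StrongDual ℂ X))
    (hE : ∀ R : ℝ, IsClosed {l : WeakDual ℂ X | WeakDual.toStrongDual l ∈ E ∧
      ‖WeakDual.toStrongDual l‖ ≤ R})
    (f0 : StrongDual ℂ X) (hf : f0 ∉ E) :
    ∃ x : X, (∀ l ∈ E, l x = 0) ∧ f0 x ≠ 0 := by
  classical
  -- the affine set C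
  let C : Set (WeakDual ℂ X) := {l | WeakDual.toStrongDual l - f0 ∈ E}
  let Bl : ℝ → Set (WeakDual ℂ X) := fun R => {l | ‖WeakDual.toStrongDual l‖ ≤ R}
  have hBl : ∀ R, IsCompact (Bl R) := by
    intro R
    have := WeakDual.isCompact_closedBall (𝕜 := ℂ) (E := X) 0 R
    convert this using 1
    ext l; simp [Bl]
  have hCB : ∀ R, IsCompact (C ∩ Bl R) := by
    intro R
    refine (hBl R).of_isClosed_subset ?_ inter_subset_right
    have h1 : C ∩ Bl R = (fun l : WeakDual ℂ X => l - StrongDual.toWeakDual f0) ⁻¹'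
        {l : WeakDual ℂ X | WeakDual.toStrongDual l ∈ E ∧
          ‖WeakDual.toStrongDual l‖ ≤ R + ‖f0‖} ∩ Bl R := by
      ext l
      simp only [C, Bl, mem_inter_iff, mem_ofPred_eq, mem_preimage]
      constructor
      · rintro ⟨h1, h2⟩
        refine ⟨⟨h1, ?_⟩, h2⟩
        exact (norm_sub_le (WeakDual.toStrongDual l) f0).trans (by gcongr)
      · rintro ⟨⟨h1, -⟩, h2⟩
        exact ⟨h1, h2⟩
    rw [h1]
    exact ((hE _).preimage (by fun_prop)).inter (hBl R).isClosed
  have hstep0 : ∀ (n : ℕ) (A : Finset X) (P : X → Prop),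
      (∀ l ∈ C ∩ Bl (n + 1), (∀ x ∈ A, ‖l x‖ ≤ 1) → ∃ x, P x ∧ 1 < ‖l x‖) →
      ∃ A' : Finset X, A ⊆ A' ∧ (∀ x ∈ A', x ∉ A → P x) ∧
        ∀ l ∈ C ∩ Bl (n + 1), ∃ x ∈ A', 1 < ‖l x‖ := by
    intro n A P h
    have hopen : ∀ x : X, IsOpen {l : WeakDual ℂ X | 1 < ‖l x‖} := fun x =>
      isOpen_lt continuous_const (WeakDual.eval_continuous x).norm
    have hK : IsCompact ((C ∩ Bl (n+1)) ∩ ⋂ x ∈ A, {l : WeakDual ℂ X | ‖l x‖ ≤ 1}) := by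
      refine (hCB _).inter_right (isClosed_biInter fun x _ => ?_)
      exact isClosed_le (WeakDual.eval_continuous x).norm continuous_const
    obtain ⟨t, ht⟩ := hK.elim_finite_subcover (fun x : {x // P x} => {l : WeakDual ℂ X | 1 < ‖l x‖})
      (fun x => hopen x) (by
        rintro l ⟨hl, hl2⟩
        obtain ⟨x, hx, hx2⟩ := h l hl (by simpa using hl2)
        exact mem_iUnion.2 ⟨⟨x, hx⟩, hx2⟩)
    refine ⟨A ∪ t.image Subtype.val, Finset.subset_union_left, ?_, ?_⟩
    · intro x hx hxA
      rcases Finset.mem_union.1 hx with h | h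
      · exact absurd h hxA
      · obtain ⟨y, -, rfl⟩ := Finset.mem_image.1 h
        exact y.2
    · intro l hl
      by_cases hA : ∀ x ∈ A, ‖l x‖ ≤ 1
      · have := ht ⟨hl, by simpa using hA⟩
        simp only [mem_iUnion] at this
        obtain ⟨x, hx, hx2⟩ := this
        exact ⟨x, Finset.mem_union_right _ (Finset.mem_image_of_mem _ hx), hx2⟩
      · push Not at hA
        obtain ⟨x, hx, hx2⟩ := hA
        exact ⟨x, Finset.mem_union_left _ hx, hx2⟩
  -- base
  obtain ⟨A0, -, -, hA0⟩ := hstep0 0 ∅ (fun _ => True) (by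
    rintro l ⟨hl, -⟩ -
    have hne : WeakDual.toStrongDual l ≠ 0 := by
      intro h0
      apply hf
      simp only [C, mem_ofPred_eq, h0, zero_sub] at hl
      simpa using hl
    obtain ⟨x, hx⟩ : ∃ x, l x ≠ 0 := by
      by_contra hcon
      push Not at hcon
      exact hne (ContinuousLinearMap.ext hcon)
    refine ⟨((2 / ‖l x‖ : ℝ) : ℂ) • x, trivial, ?_⟩
    have : ‖l x‖ ≠ 0 := by simpa using hx
    rw [map_smul, norm_smul, Complex.norm_real, Real.norm_of_nonneg (by positivity)]
    rw [div_mul_cancel₀ _ this]; norm_num)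
  have hstep : ∀ (n : ℕ) (A : Finset X), (∀ l ∈ C ∩ Bl (n + 1), ∃ x ∈ A, 1 < ‖l x‖) →
      ∃ A' : Finset X, A ⊆ A' ∧ (∀ x ∈ A', x ∉ A → ‖x‖ ≤ 1 / (n + 1)) ∧
        ∀ l ∈ C ∩ Bl ((n + 1 : ℕ) + 1), ∃ x ∈ A', 1 < ‖l x‖ := by
    intro n A hA
    refine hstep0 (n+1) A (fun x => ‖x‖ ≤ 1 / (n+1)) ?_
    rintro l hl hlA
    have hn : ¬ ‖WeakDual.toStrongDual l‖ ≤ n + 1 := by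
      intro hn
      obtain ⟨x, hx, hx2⟩ := hA l ⟨hl.1, hn⟩
      exact absurd (hlA x hx) (not_le.2 hx2)
    by_contra hcon
    push Not at hcon
    apply hn
    refine ContinuousLinearMap.opNorm_le_bound _ (by positivity) fun x => ?_
    by_cases hx : x = 0
    · simp [hx]
    have hx' : 0 < ‖x‖ := norm_pos_iff.2 hx
    have hc : 0 < 1 / (((n:ℝ)+1) * ‖x‖) := by positivity
    have h1 := hcon (((1 / (((n:ℝ)+1) * ‖x‖) : ℝ) : ℂ) • x) (by
      rw [norm_smul, Complex.norm_real, Real.norm_of_nonneg hc.le]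
      apply le_of_eq; field_simp)
    rw [map_smul, norm_smul, Complex.norm_real, Real.norm_of_nonneg hc.le, one_div,
      inv_mul_le_iff₀ (by positivity), mul_one] at h1
    exact h1
  let B : ∀ n : ℕ, {A : Finset X // ∀ l ∈ C ∩ Bl (n + 1), ∃ x ∈ A, 1 < ‖l x‖} := fun n =>
    Nat.rec (motive := fun n => {A : Finset X // ∀ l ∈ C ∩ Bl (n + 1), ∃ x ∈ A, 1 < ‖l x‖})
      ⟨A0, by simpa using hA0⟩
      (fun n A => ⟨(hstep n A.1 A.2).choose, (hstep n A.1 A.2).choose_spec.2.2⟩) n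
  have hB1 : ∀ n, (B n).1 ⊆ (B (n+1)).1 := fun n => (hstep n (B n).1 (B n).2).choose_spec.1
  have hB2 : ∀ n, ∀ x ∈ (B (n+1)).1, x ∉ (B n).1 → ‖x‖ ≤ 1 / (n+1) :=
    fun n => (hstep n (B n).1 (B n).2).choose_spec.2.1
  have hmono : Monotone (fun n => (B n).1) := monotone_nat_of_le_succ hB1
  let S : Set X := ⋃ n, ((B n).1 : Set X)
  have hsmall : ∀ n : ℕ, ∀ m, ∀ x ∈ (B m).1, x ∉ (B n).1 → ‖x‖ ≤ 1 / (n+1) := by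
    intro n m
    induction m with
    | zero => intro x hx hx2; exact absurd (hmono (Nat.zero_le n) hx) hx2
    | succ m ih =>
      intro x hx hx2
      by_cases h : x ∈ (B m).1
      · exact ih x h hx2
      · refine (hB2 m x hx h).trans ?_
        have : n ≤ m := by
          by_contra hc
          exact hx2 (hmono (show m + 1 ≤ n by omega) hx)
        gcongr
  have hbd : ∃ M : ℝ, 0 ≤ M ∧ ∀ s : S, ‖(s : X)‖ ≤ M := by
    refine ⟨∑ x ∈ (B 0).1, ‖x‖ + 1, by positivity, ?_⟩
    rintro ⟨x, hx⟩
    obtain ⟨m, hm⟩ := mem_iUnion.1 hx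
    by_cases h : x ∈ (B 0).1
    · have := Finset.single_le_sum (f := fun x : X => ‖x‖) (fun i _ => norm_nonneg i) h
      simp only at this ⊢; linarith
    · have := hsmall 0 m x hm h
      have h2 : 0 ≤ ∑ x ∈ (B 0).1, ‖x‖ := by positivity
      norm_num at this; simp only; linarith
  obtain ⟨M, hM0, hM⟩ := hbd
  have hc0 : ∀ l : StrongDual ℂ X, ∀ ε > 0, {s : S | ε < ‖l s‖}.Finite := by
    intro l ε hε
    obtain ⟨n, hn⟩ := exists_nat_gt (‖l‖ / ε)
    have : {s : S | ε < ‖l s‖} ⊆ Subtype.val ⁻¹' ((B n).1 : Set X) := by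
      rintro ⟨x, hx⟩ hs
      by_contra hc
      obtain ⟨m, hm⟩ := mem_iUnion.1 hx
      have h1 := hsmall n m x hm hc
      have h2 : ‖l x‖ ≤ ‖l‖ * (1 / (n+1)) := l.le_opNorm_of_le h1
      have h3 : ‖l‖ * (1/(n+1)) ≤ ε := by
        rw [mul_one_div, div_le_iff₀ (by positivity)]
        rw [div_lt_iff₀ hε] at hn
        nlinarith
      simp only [mem_ofPred_eq] at hs
      linarith
    exact ((B n).1.finite_toSet.preimage Subtype.val_injective.injOn).subset this
  -- the map to c₀
  have hmem : ∀ l : StrongDual ℂ X, Memℓp (fun s : S => l s) ⊤ := by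
    intro l
    refine memℓp_infty ⟨‖l‖ * M, ?_⟩
    rintro _ ⟨s, rfl⟩
    exact l.le_opNorm_of_le (hM s)
  let T : StrongDual ℂ X →ₗ[ℂ] lp (fun _ : S => ℂ) ⊤ :=
    { toFun := fun l => ⟨fun s => l s, hmem l⟩
      map_add' := fun a b => by ext s; simp; rfl
      map_smul' := fun a b => by ext s; simp }
  have hTapp : ∀ l (s : S), (T l : S → ℂ) s = l s := fun l s => rfl
  have hfar : T f0 ∉ closure ((E.map T : Submodule ℂ _) : Set (lp (fun _ : S => ℂ) ⊤)) := by
    intro hcl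
    obtain ⟨b, hb, hbd⟩ := Metric.mem_closure_iff.1 hcl 1 one_pos
    obtain ⟨e, he, rfl⟩ := hb
    have hC : StrongDual.toWeakDual (f0 - e) ∈ C := by
      simp only [C, mem_ofPred_eq]
      have : WeakDual.toStrongDual (StrongDual.toWeakDual (f0 - e)) = f0 - e := rfl
      rw [this]; simpa using he
    obtain ⟨n, hn⟩ := exists_nat_ge ‖f0 - e‖
    obtain ⟨x, hx, hx2⟩ := (B n).2 (StrongDual.toWeakDual (f0 - e)) ⟨hC, by
      show ‖f0 - e‖ ≤ n + 1
      linarith⟩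
    have h3 := lp.norm_apply_le_norm (by simp) (T f0 - T e) ⟨x, mem_iUnion.2 ⟨n, hx⟩⟩
    rw [dist_eq_norm] at hbd
    rw [← map_sub, hTapp] at h3
    rw [← map_sub] at hbd
    exact absurd (h3.trans hbd.le) (not_le.2 hx2)
  obtain ⟨Λ, hΛ1, hΛ2⟩ : ∃ Λ : StrongDual ℂ (lp (fun _ : S => ℂ) ⊤),
      (∀ e ∈ E, Λ (T e) = 0) ∧ Λ (T f0) ≠ 0 := by
    obtain ⟨Λ, h1, h2⟩ := sep_submodule (E.map T) (T f0) hfar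
    exact ⟨Λ, fun e he => h1 _ ⟨e, he, rfl⟩, h2⟩
  have hα := l1_of_dual Λ
  set α : S → ℂ := fun s => Λ (lp.single (E := fun _ : S => ℂ) ⊤ s 1) with hαdef
  have hsum : Summable (fun s : S => α s • (s : X)) := by
    refine Summable.of_norm_bounded (hα.mul_right M) fun s => ?_
    rw [norm_smul]
    gcongr
    exact hM s
  have hrep : ∀ l : StrongDual ℂ X, Λ (T l) = l (∑' s, α s • (s : X)) := by
    intro l
    have h1 := (c0_hasSum (T l) (hc0 l)).mapL Λ
    have h2 := hsum.hasSum.mapL l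
    refine h1.unique ?_
    convert h2 using 2 with s
    have : lp.single (E := fun _ : S => ℂ) ⊤ s ((T l : S → ℂ) s)
        = (l s) • lp.single (E := fun _ : S => ℂ) ⊤ s (1:ℂ) := by
      rw [← lp.single_smul]; simp [hTapp]
    rw [this, map_smul, map_smul]
    simp [hαdef, mul_comm]
  exact ⟨_, fun l hl => by rw [← hrep, hΛ1 l hl], by rw [← hrep]; exact hΛ2⟩


lemma hasSum_cg {ι : Type*} {f g : ι → ℂ} {s : ℂ} (h : ∀ k, f k = g k) (hf : HasSum f s) :
    HasSum g s := by
  have : f = g := funext h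
  rwa [← this]

/-- Coefficient sequences of power series converging absolutely in the open unit disc. -/
def Gd (a : ℕ → ℂ) : Prop := ∀ r : ℝ, 0 ≤ r → r < 1 → Summable (fun k => ‖a k‖ * r ^ k)

/-- Sum of the power series. -/
noncomputable def fn (a : ℕ → ℂ) (z : ℂ) : ℂ := ∑' k, a k * z ^ k

lemma Gd.hasSum {a : ℕ → ℂ} (ha : Gd a) {z : ℂ} (hz : z ∈ ball (0:ℂ) 1) :
    HasSum (fun k => a k * z ^ k) (fn a z) := by
  refine Summable.hasSum (Summable.of_norm ?_)
  simpa using ha ‖z‖ (norm_nonneg _) (by simpa using hz)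

lemma Gd.of_bound {a : ℕ → ℂ} {C : ℝ} (h : ∀ k, ‖a k‖ ≤ C) : Gd a := by
  intro r h0 h1
  refine Summable.of_nonneg_of_le (fun k => by positivity) (fun k => ?_)
    ((summable_geometric_of_lt_one h0 h1).mul_left C)
  gcongr
  exact h k

lemma Gd.diff {a : ℕ → ℂ} (ha : Gd a) : DifferentiableOn ℂ (fn a) (ball (0:ℂ) 1) := by
  intro z hz
  have hz' : ‖z‖ < 1 := by simpa using hz
  obtain ⟨r, hr1, hr2⟩ := exists_between hz'
  have := Complex.differentiableOn_tsum_of_summable_norm (ι := ℕ)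
    (ha r ((norm_nonneg z).trans hr1.le) hr2)
    (F := fun k z => a k * z ^ k) (U := ball 0 r) (fun k => by fun_prop) isOpen_ball
    (fun k w hw => by
      rw [norm_mul, norm_pow]; gcongr; exact (by simpa using hw : ‖w‖ < r).le)
  exact (this.differentiableAt (isOpen_ball.mem_nhds (by simpa using hr1))).differentiableWithinAt

lemma gd_of_hasSum {a : ℕ → ℂ} {f : ℂ → ℂ}
    (h : ∀ z ∈ ball (0:ℂ) 1, HasSum (fun k : ℕ => a k * z ^ k) (f z)) :
    Gd a ∧ EqOn f (fn a) (ball (0:ℂ) 1) := by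
  refine ⟨fun r h0 h1 => ?_, fun z hz => ((h z hz).tsum_eq).symm⟩
  have := (h (r:ℂ) (by simpa [abs_of_nonneg h0] using h1)).summable.norm
  simpa [abs_of_nonneg h0] using this

lemma exists_coef {f : ℂ → ℂ} (hf : DifferentiableOn ℂ f (ball (0:ℂ) 1)) :
    ∃ a, Gd a ∧ EqOn f (fn a) (ball (0:ℂ) 1) := by
  refine ⟨fun n => (n.factorial : ℂ)⁻¹ * iteratedDeriv n f 0, gd_of_hasSum fun z hz => ?_⟩
  have := Complex.hasSum_taylorSeries_on_ball hf hz
  refine hasSum_cg (fun n => ?_) this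
  simp only [smul_eq_mul, sub_zero]; ring

lemma mem_circ {r : ℝ} (h0 : 0 ≤ r) (h1 : r < 1) (t : ℝ) :
    (r : ℂ) * Complex.exp (t * Complex.I) ∈ ball (0:ℂ) 1 := by
  simpa [Complex.norm_exp_ofReal_mul_I, abs_of_nonneg h0] using h1

lemma norm_circ {r : ℝ} (h0 : 0 ≤ r) (t : ℝ) :
    ‖(r : ℂ) * Complex.exp (t * Complex.I)‖ = r := by
  simp [Complex.norm_exp_ofReal_mul_I, abs_of_nonneg h0]

lemma cont_circ {f : ℂ → ℂ} (hf : ContinuousOn f (ball (0:ℂ) 1)) {r : ℝ} (h0 : 0 ≤ r) (h1 : r < 1) :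
    Continuous (fun t : ℝ => f (r * Complex.exp (t * Complex.I))) :=
  hf.comp_continuous (by fun_prop) (mem_circ h0 h1)

lemma hasSum_integral {a : ℕ → ℂ} (ha : Gd a) {r : ℝ} (h0 : 0 ≤ r) (h1 : r < 1)
    {g : ℝ → ℂ} (hg : Continuous g) :
    HasSum (fun k => a k * r ^ k * ∫ t in (0:ℝ)..(2*π), Complex.exp (k * t * Complex.I) * g t)
      (∫ t in (0:ℝ)..(2*π), fn a (r * Complex.exp (t * Complex.I)) * g t) := by
  obtain ⟨M, hM⟩ := (isCompact_Icc (a := (0:ℝ)) (b := 2*π)).exists_bound_of_continuousOn hg.continuousOn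
  have := intervalIntegral.hasSum_integral_of_dominated_convergence (μ := volume)
    (a := 0) (b := 2 * π)
    (F := fun (k:ℕ) (t:ℝ) => a k * r ^ k * (Complex.exp (k * t * Complex.I) * g t))
    (f := fun t => fn a (r * Complex.exp (t * Complex.I)) * g t)
    (fun k _ => ‖a k‖ * r ^ k * M) ?_ ?_ ?_ ?_ ?_
  · simpa only [intervalIntegral.integral_const_mul] using this
  · intro k
    exact (by fun_prop : Continuous _).aestronglyMeasurable
  · intro k
    refine Eventually.of_forall fun t ht => ?_
    rw [uIoc_of_le (by positivity)] at ht
    have := hM t ⟨ht.1.le, ht.2⟩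
    have he : ‖Complex.exp (k * t * Complex.I)‖ = 1 := by
      have := Complex.norm_exp_ofReal_mul_I (k * t); push_cast at this; exact this
    rw [norm_mul, norm_mul, norm_mul, he, one_mul, norm_pow, Complex.norm_real,
      Real.norm_of_nonneg h0]
    gcongr
  · exact Eventually.of_forall fun t _ => (ha r h0 h1).mul_right M
  · simp
  · refine Eventually.of_forall fun t _ => ?_
    have := (ha.hasSum (mem_circ h0 h1 t)).mul_right (g t)
    refine hasSum_cg (fun k => ?_) this
    rw [mul_pow, ← Complex.exp_nat_mul]
    ring_nf

lemma integral_exp_int (m : ℤ) :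
    ∫ t in (0:ℝ)..(2*π), Complex.exp (m * t * Complex.I) = if m = 0 then 2 * (π:ℂ) else 0 := by
  split_ifs with h
  · simp [h]
  · have hc : (m : ℂ) * Complex.I ≠ 0 := by simp [h]
    have h2 := integral_exp_mul_complex (a := 0) (b := 2 * π) hc
    have : ∀ t : ℝ, Complex.exp (m * t * Complex.I) = Complex.exp ((m * Complex.I) * t) := by
      intro t; ring_nf
    simp_rw [this, h2]
    have h3 : (m : ℂ) * Complex.I * ((2 * π : ℝ) : ℂ) = m * (2 * π * Complex.I) := by push_cast; ring
    rw [h3, Complex.exp_int_mul_two_pi_mul_I]; simp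

lemma coef_integral {a : ℕ → ℂ} (ha : Gd a) {r : ℝ} (h0 : 0 ≤ r) (h1 : r < 1) (j : ℕ) :
    ∫ t in (0:ℝ)..(2*π), fn a (r * Complex.exp (t * Complex.I)) * Complex.exp (-(j * t * Complex.I))
      = 2 * π * (a j * r ^ j) := by
  have h := hasSum_integral ha h0 h1 (g := fun t => Complex.exp (-(j * t * Complex.I))) (by fun_prop)
  refine h.unique ?_
  have : ∀ k : ℕ, ∫ t in (0:ℝ)..(2*π), Complex.exp (k * t * Complex.I) *
      Complex.exp (-(j * t * Complex.I)) = if k = j then 2 * (π:ℂ) else 0 := by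
    intro k
    have h2 := integral_exp_int ((k:ℤ) - j)
    have h3 : ∀ t : ℝ, Complex.exp (k * t * Complex.I) * Complex.exp (-(j * t * Complex.I))
      = Complex.exp ((((k:ℤ) - j : ℤ) : ℂ) * t * Complex.I) := by
      intro t; rw [← Complex.exp_add]; push_cast; ring_nf
    simp_rw [h3, h2, sub_eq_zero, Nat.cast_inj]
  simp_rw [this]
  convert hasSum_ite_eq j (2 * π * (a j * r ^ j)) using 2 with k
  split_ifs with hk
  · subst hk; ring
  · simp

lemma pairR_congr {f f' g g' : ℂ → ℂ} (hf : EqOn f f' (ball 0 1)) (hg : EqOn g g' (ball 0 1))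
    {r : ℝ} (h0 : 0 ≤ r) (h1 : r < 1) : pairR f g r = pairR f' g' r := by
  unfold pairR
  congr 2; ext t
  rw [hf (mem_circ h0 h1 t), hg (mem_circ h0 h1 t)]

lemma coef_eq {a b : ℕ → ℂ} (ha : Gd a) (hb : Gd b) (h : EqOn (fn a) (fn b) (ball 0 1)) : a = b := by
  ext j
  have h1 := coef_integral ha (r := 1/2) (by norm_num) (by norm_num) j
  have h2 := coef_integral hb (r := 1/2) (by norm_num) (by norm_num) j
  have h3 : ∀ t : ℝ, fn a ((1/2:ℝ) * Complex.exp (t * Complex.I))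
      = fn b ((1/2:ℝ) * Complex.exp (t * Complex.I)) :=
    fun t => h (mem_circ (by norm_num) (by norm_num) t)
  simp_rw [h3, h2] at h1
  have hp : (2 * (π:ℂ)) ≠ 0 := by simp [Real.pi_ne_zero]
  have := mul_left_cancel₀ hp h1
  exact (mul_right_cancel₀ (by simp) this).symm

lemma coef_bound {a : ℕ → ℂ} (ha : Gd a) {r M : ℝ} (h0 : 0 ≤ r) (h1 : r < 1)
    (hM : ∀ z : ℂ, ‖z‖ = r → ‖fn a z‖ ≤ M) (j : ℕ) : ‖a j‖ * r ^ j ≤ M := by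
  have h := coef_integral ha h0 h1 j
  have h2 : ‖∫ t in (0:ℝ)..(2*π), fn a (r * Complex.exp (t * Complex.I)) *
      Complex.exp (-(j * t * Complex.I))‖ ≤ M * |2 * π - 0| := by
    refine intervalIntegral.norm_integral_le_of_norm_le_const fun t _ => ?_
    have he : ‖Complex.exp (-(j * t * Complex.I))‖ = 1 := by
      have := Complex.norm_exp_ofReal_mul_I (-(j * t)); push_cast at this
      rw [← this]; ring_nf
    rw [norm_mul, he, mul_one]
    exact hM _ (norm_circ h0 t)
  rw [h] at h2
  have hp := Real.pi_pos
  rw [norm_mul, norm_mul, norm_mul, norm_pow, Complex.norm_real, Complex.norm_real,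
    Real.norm_of_nonneg h0, Real.norm_of_nonneg hp.le, sub_zero, abs_of_pos (by positivity)] at h2
  simp at h2
  nlinarith

lemma pairR_hasSum {a b : ℕ → ℂ} (ha : Gd a) (hb : Gd b) {r : ℝ} (h0 : 0 ≤ r) (h1 : r < 1) :
    HasSum (fun k => a k * conj (b k) * (r:ℂ) ^ (2 * k)) (pairR (fn a) (fn b) r) := by
  have h := hasSum_integral ha h0 h1
    (g := fun t => conj (fn b (r * Complex.exp (t * Complex.I))))
    (Complex.continuous_conj.comp (cont_circ hb.diff.continuousOn h0 h1))
  have h2 := h.mul_left (2 * (π : ℂ))⁻¹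
  refine hasSum_cg (fun k => ?_) h2
  have h3 : ∫ t in (0:ℝ)..(2*π), Complex.exp (k * t * Complex.I) *
      conj (fn b (r * Complex.exp (t * Complex.I))) = conj (2 * π * (b k * r ^ k)) := by
    rw [← coef_integral hb h0 h1 k, intervalIntegral.integral_of_le (by positivity),
      intervalIntegral.integral_of_le (by positivity), ← integral_conj]
    congr 1; ext t
    rw [map_mul, ← Complex.exp_conj]
    simp [mul_comm]
  rw [h3]
  have hp : (π:ℂ) ≠ 0 := by simp [Real.pi_ne_zero]
  simp only [map_mul, map_pow, Complex.conj_ofReal, map_ofNat]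
  field_simp
  ring

lemma pairR_self (f : ℂ → ℂ) (r : ℝ) : pairR f f r =
    (((2 * π)⁻¹ * ∫ t in (0:ℝ)..(2 * π), ‖f (r * Complex.exp (t * Complex.I))‖ ^ 2 : ℝ) : ℂ) := by
  unfold pairR
  push_cast
  rw [← intervalIntegral.integral_ofReal]
  congr 2; ext t
  rw [Complex.mul_conj, Complex.normSq_eq_norm_sq]


/-- The sequence space. -/
abbrev L2 : Type := ↥(lp (fun _ : ℕ => ℂ) 2)

lemma L2.gd (a : L2) : Gd a := Gd.of_bound (C := ‖a‖) fun k => lp.norm_apply_le_norm (by norm_num) a k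

lemma L2.hasSum_sq (a : L2) : HasSum (fun k => ‖a k‖ ^ 2) (‖a‖ ^ 2) := by
  have := lp.hasSum_norm (p := 2) (by norm_num) a
  simpa using this

lemma L2.exists_of_summable {a : ℕ → ℂ} (h : Summable fun k => ‖a k‖ ^ 2) :
    ∃ b : L2, ∀ k, b k = a k := by
  have : Memℓp a 2 := memℓp_gen (by simpa using h)
  exact ⟨⟨a, this⟩, fun k => rfl⟩

lemma L2.inner_hasSum (a b : L2) : HasSum (fun k => b k * conj (a k)) (inner ℂ a b) := by
  have := lp.hasSum_inner (𝕜 := ℂ) a b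
  simpa [RCLike.inner_apply] using this

lemma pairR_self_hasSum {a : ℕ → ℂ} (ha : Gd a) {r : ℝ} (h0 : 0 ≤ r) (h1 : r < 1) :
    HasSum (fun k => ‖a k‖ ^ 2 * r ^ (2 * k)) (pairR (fn a) (fn a) r).re := by
  have h := pairR_hasSum ha ha h0 h1
  have h2 := Complex.hasSum_re h
  refine h2.congr_fun ?_ 
  intro k
  rw [Complex.mul_conj, Complex.normSq_eq_norm_sq]
  norm_cast

lemma pairR_self_le (a : L2) {r : ℝ} (h0 : 0 ≤ r) (h1 : r < 1) :
    (pairR (fn a) (fn a) r).re ≤ ‖a‖ ^ 2 := by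
  refine hasSum_le (fun k => ?_) (pairR_self_hasSum a.gd h0 h1) a.hasSum_sq
  have : r ^ (2 * k) ≤ 1 := pow_le_one₀ h0 h1.le
  nlinarith [sq_nonneg ‖a k‖]

lemma memH2_fn (a : L2) : MemH2 (fn a) :=
  ⟨a.gd.diff, ‖a‖ ^ 2, fun _ hr => pairR_self_le a hr.1 hr.2⟩

lemma exists_L2 {f : ℂ → ℂ} (hf : DifferentiableOn ℂ f (ball (0:ℂ) 1)) {C : ℝ}
    (hC : ∀ r ∈ Ico (0:ℝ) 1, (pairR f f r).re ≤ C) :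
    ∃ a : L2, EqOn f (fn a) (ball 0 1) ∧ ‖a‖ ^ 2 ≤ C := by
  obtain ⟨a, ha, hfa⟩ := exists_coef hf
  have key : ∀ s : Finset ℕ, ∑ k ∈ s, ‖a k‖ ^ 2 ≤ C := by
    intro s
    have h1 : ∀ r ∈ Ico (0:ℝ) 1, ∑ k ∈ s, ‖a k‖ ^ 2 * r ^ (2 * k) ≤ C := by
      intro r hr
      refine le_trans ?_ (hC r hr)
      rw [pairR_congr hfa hfa hr.1 hr.2]
      exact sum_le_hasSum s (fun k _ => mul_nonneg (by positivity) (pow_nonneg hr.1 _))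
        (pairR_self_hasSum ha hr.1 hr.2)
    have h2 : Tendsto (fun r : ℝ => ∑ k ∈ s, ‖a k‖ ^ 2 * r ^ (2 * k)) (𝓝[<] 1)
        (𝓝 (∑ k ∈ s, ‖a k‖ ^ 2 * (1:ℝ) ^ (2 * k))) :=
      (by fun_prop : Continuous fun r : ℝ => ∑ k ∈ s, ‖a k‖ ^ 2 * r ^ (2 * k)).continuousAt.tendsto.mono_left
        nhdsWithin_le_nhds
    have h3 := le_of_tendsto h2 (b := C) (by
      filter_upwards [Ico_mem_nhdsLT (a := (0:ℝ)) (b := 1) (by norm_num)] with r hr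
      exact h1 r hr)
    simpa using h3
  have hs : Summable fun k => ‖a k‖ ^ 2 := summable_of_sum_le (fun k => by positivity) key
  obtain ⟨b, hb⟩ := L2.exists_of_summable hs
  have hab : (b : ℕ → ℂ) = a := funext hb
  refine ⟨b, by rwa [hab], ?_⟩
  have := b.hasSum_sq
  rw [← this.tsum_eq]
  simp_rw [hb]
  exact hs.tsum_le_of_sum_le key

lemma MemH2.exists {f : ℂ → ℂ} (h : MemH2 f) : ∃ a : L2, EqOn f (fn a) (ball 0 1) := by
  obtain ⟨hf, C, hC⟩ := h
  obtain ⟨a, ha, -⟩ := exists_L2 hf hC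
  exact ⟨a, ha⟩

lemma eventually_Ico : ∀ᶠ r : ℝ in 𝓝[<] 1, r ∈ Ico (0:ℝ) 1 := Ico_mem_nhdsLT (by norm_num)

lemma tendsto_pairR (a b : L2) :
    Tendsto (pairR (fn a) (fn b)) (𝓝[<] 1) (𝓝 (inner ℂ b a)) := by
  have h1 : Tendsto (fun r : ℝ => ∑' k, a k * conj (b k) * (r:ℂ) ^ (2 * k)) (𝓝[<] 1)
      (𝓝 (∑' k, a k * conj (b k))) := by
    refine tendsto_tsum_of_dominated_convergence (bound := fun k => ‖a k‖ ^ 2 + ‖b k‖ ^ 2)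
      (a.hasSum_sq.summable.add b.hasSum_sq.summable) ?_ ?_
    · intro k
      have : Tendsto (fun r : ℝ => a k * conj (b k) * (r:ℂ) ^ (2 * k)) (𝓝[<] 1)
        (𝓝 (a k * conj (b k) * ((1:ℝ):ℂ) ^ (2 * k))) :=
        (by fun_prop : Continuous fun r : ℝ => a k * conj (b k) * (r:ℂ) ^ (2 * k)).continuousAt.tendsto.mono_left
        nhdsWithin_le_nhds
      simpa using this
    · filter_upwards [eventually_Ico] with r hr k
      have : r ^ (2 * k) ≤ 1 := pow_le_one₀ hr.1 hr.2.le
      rw [norm_mul, norm_mul, norm_pow, Complex.norm_real, Real.norm_of_nonneg hr.1, RCLike.norm_conj]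
      have h3 : ‖a k‖ * ‖b k‖ * r ^ (2 * k) ≤ ‖a k‖ * ‖b k‖ * 1 := by gcongr
      nlinarith [sq_nonneg (‖a k‖ - ‖b k‖), sq_nonneg ‖a k‖, sq_nonneg ‖b k‖]
  rw [← (b.inner_hasSum a).tsum_eq]
  refine h1.congr' ?_
  filter_upwards [eventually_Ico] with r hr
  exact (pairR_hasSum a.gd b.gd hr.1 hr.2).tsum_eq

lemma tendsto_pairR_self (a : L2) :
    Tendsto (fun r => (pairR (fn a) (fn a) r).re) (𝓝[<] 1) (𝓝 (‖a‖ ^ 2)) := by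
  have := (Complex.continuous_re.tendsto _).comp (tendsto_pairR a a)
  rw [inner_self_eq_norm_sq_to_K] at this
  have h2 : (((‖a‖ : ℝ) : ℂ) ^ 2).re = ‖a‖ ^ 2 := by norm_cast
  rw [← h2]
  exact this

lemma tendsto_pairR_congr {f g f' g' : ℂ → ℂ} (hf : EqOn f f' (ball 0 1)) (hg : EqOn g g' (ball 0 1)) :
    pairR f g =ᶠ[𝓝[<] 1] pairR f' g' := by
  filter_upwards [eventually_Ico] with r hr
  exact pairR_congr hf hg hr.1 hr.2

lemma pairR_mono {f g : ℂ → ℂ} (hf : ContinuousOn f (ball 0 1)) (hg : ContinuousOn g (ball 0 1))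
    (h : ∀ z ∈ ball (0:ℂ) 1, ‖f z‖ ≤ ‖g z‖) {r : ℝ} (h0 : 0 ≤ r) (h1 : r < 1) :
    (pairR f f r).re ≤ (pairR g g r).re := by
  rw [pairR_self, pairR_self, Complex.ofReal_re, Complex.ofReal_re]
  have hp := Real.pi_pos
  refine mul_le_mul_of_nonneg_left ?_ (by positivity)
  refine intervalIntegral.integral_mono (by positivity) ?_ ?_ ?_
  · exact ((cont_circ hf h0 h1).norm.pow 2).intervalIntegrable _ _
  · exact ((cont_circ hg h0 h1).norm.pow 2).intervalIntegrable _ _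
  · intro t
    exact pow_le_pow_left₀ (norm_nonneg _) (h _ (mem_circ h0 h1 t)) 2

lemma exists_L2_of_le {f : ℂ → ℂ} (hf : DifferentiableOn ℂ f (ball (0:ℂ) 1)) (b : L2)
    (h : ∀ z ∈ ball (0:ℂ) 1, ‖f z‖ ≤ ‖fn b z‖) :
    ∃ a : L2, EqOn f (fn a) (ball 0 1) ∧ ‖a‖ ≤ ‖b‖ := by
  obtain ⟨a, h1, h2⟩ := exists_L2 hf (C := ‖b‖ ^ 2) fun r hr =>
    (pairR_mono hf.continuousOn b.gd.diff.continuousOn h hr.1 hr.2).trans (pairR_self_le b hr.1 hr.2)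
  exact ⟨a, h1, by nlinarith [norm_nonneg a, norm_nonneg b]⟩

lemma exists_L2_bdd {f : ℂ → ℂ} (hf : DifferentiableOn ℂ f (ball (0:ℂ) 1)) {M : ℝ}
    (h : ∀ z ∈ ball (0:ℂ) 1, ‖f z‖ ≤ M) :
    ∃ a : L2, EqOn f (fn a) (ball 0 1) ∧ ‖a‖ ≤ M := by
  have hM : 0 ≤ M := (norm_nonneg _).trans (h 0 (by simp))
  obtain ⟨a, h1, h2⟩ := exists_L2 hf (C := M ^ 2) fun r hr => by
    refine (pairR_mono (g := fun _ => (M:ℂ)) hf.continuousOn (by fun_prop) (fun z hz => ?_) hr.1 hr.2).trans ?_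
    · simpa [abs_of_nonneg hM] using h z hz
    · rw [pairR_self, Complex.ofReal_re]
      have hp := Real.pi_pos
      simp
      field_simp
      rfl
  exact ⟨a, h1, by nlinarith [norm_nonneg a]⟩

lemma L2.fn_inj {a b : L2} (h : EqOn (fn a) (fn b) (ball 0 1)) : a = b :=
  Subtype.ext (coef_eq a.gd b.gd h)

lemma Gd.fn_add {a b : ℕ → ℂ} (ha : Gd a) (hb : Gd b) {z : ℂ} (hz : z ∈ ball (0:ℂ) 1) :
    fn (a + b) z = fn a z + fn b z := by
  have := (ha.hasSum hz).add (hb.hasSum hz)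
  rw [fn, ← this.tsum_eq]
  congr 1; ext k; simp [add_mul]

lemma fn_smul {a : ℕ → ℂ} (s : ℂ) (z : ℂ) : fn (s • a) z = s * fn a z := by
  rw [fn, fn, ← tsum_mul_left]
  congr 1; ext k; simp [mul_assoc]

lemma L2.fn_add (a b : L2) {z : ℂ} (hz : z ∈ ball (0:ℂ) 1) :
    fn ((a + b : L2) : ℕ → ℂ) z = fn a z + fn b z := by
  rw [lp.coeFn_add]; exact Gd.fn_add a.gd b.gd hz

lemma L2.fn_smul (s : ℂ) (a : L2) (z : ℂ) : fn ((s • a : L2) : ℕ → ℂ) z = s * fn a z := by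
  rw [lp.coeFn_smul]; exact _root_.fn_smul s z

lemma L2.fn_sub (a b : L2) {z : ℂ} (hz : z ∈ ball (0:ℂ) 1) :
    fn ((a - b : L2) : ℕ → ℂ) z = fn a z - fn b z := by
  rw [sub_eq_add_neg, ← neg_one_smul ℂ b, L2.fn_add _ _ hz, L2.fn_smul]; ring

/-- `c` are the coefficients of `φ` times the function with coefficients `b`. -/
def IsMul (φ : ℂ → ℂ) (b c : L2) : Prop := EqOn (fn c) (fun z => φ z * fn b z) (ball 0 1)

lemma exists_isMul {φ : ℂ → ℂ} (hφ : DifferentiableOn ℂ φ (ball 0 1))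
    (h1 : ∀ z ∈ ball (0:ℂ) 1, ‖φ z‖ ≤ 1) (b : L2) : ∃ c, IsMul φ b c := by
  obtain ⟨c, hc, -⟩ := exists_L2_of_le (hφ.mul b.gd.diff) b (fun z hz => by
    simp only [Pi.mul_apply, norm_mul]
    exact mul_le_of_le_one_left (norm_nonneg _) (h1 z hz))
  exact ⟨c, fun z hz => (hc hz).symm⟩

/-- Coefficient version of the model space. -/
noncomputable def Kmod (φ : ℂ → ℂ) : Submodule ℂ L2 where
  carrier := {a | ∀ b c, IsMul φ b c → inner ℂ c a = 0}
  add_mem' := by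
    intro a b ha hb u v huv
    rw [inner_add_right, ha u v huv, hb u v huv, add_zero]
  zero_mem' := by intro u v _; simp
  smul_mem' := by
    intro s a ha u v huv
    rw [inner_smul_right, ha u v huv, mul_zero]

lemma Kmod_closed (φ : ℂ → ℂ) : IsClosed (Kmod φ : Set L2) := by
  have : (Kmod φ : Set L2) = ⋂ (b) (c) (_ : IsMul φ b c), {a | inner ℂ c a = 0} := by
    ext a; simp [Kmod]
  rw [this]
  refine isClosed_iInter fun b => isClosed_iInter fun c => isClosed_iInter fun _ => ?_
  exact isClosed_eq (by fun_prop) continuous_const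

lemma memModel_iff {φ : ℂ → ℂ} (hφ : DifferentiableOn ℂ φ (ball 0 1))
    (h1 : ∀ z ∈ ball (0:ℂ) 1, ‖φ z‖ ≤ 1) {f : ℂ → ℂ} {a : L2} (hfa : EqOn f (fn a) (ball 0 1)) :
    MemModel φ f ↔ a ∈ Kmod φ := by
  constructor
  · rintro ⟨-, h⟩ b c hbc
    have h2 := h (fn b) (memH2_fn b)
    exact tendsto_nhds_unique (tendsto_pairR a c)
      (h2.congr' (tendsto_pairR_congr hfa hbc.symm))
  · intro ha
    refine ⟨⟨a.gd.diff.congr hfa, ‖a‖ ^ 2, fun r hr => ?_⟩, fun g hg => ?_⟩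
    · rw [pairR_congr hfa hfa hr.1 hr.2]; exact pairR_self_le a hr.1 hr.2
    · obtain ⟨b, hb⟩ := hg.exists
      obtain ⟨c, hc⟩ := exists_isMul hφ h1 b
      rw [← ha b c hc]
      refine (tendsto_pairR a c).congr' (tendsto_pairR_congr hfa.symm fun z hz => ?_)
      rw [hc hz]; simp only [hb hz]

/-- Reproducing kernel bound. -/
lemma exists_kernel {l : ℂ} (hl : ‖l‖ < 1) : ∃ k : L2, (∀ j, k j = conj l ^ j) ∧
    ‖k‖ ^ 2 = (1 - ‖l‖ ^ 2)⁻¹ ∧ ∀ a : L2, inner ℂ k a = fn a l := by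
  have hg : HasSum (fun j => ‖conj l ^ j‖ ^ 2) (1 - ‖l‖ ^ 2)⁻¹ := by
    have := hasSum_geometric_of_lt_one (r := ‖l‖ ^ 2) (by positivity) (by nlinarith [norm_nonneg l])
    convert this using 2 with j
    rw [norm_pow, RCLike.norm_conj, ← pow_mul, ← pow_mul, mul_comm]
  obtain ⟨k, hk⟩ := L2.exists_of_summable hg.summable
  refine ⟨k, hk, ?_, fun a => ?_⟩
  · refine k.hasSum_sq.unique ?_
    simpa only [hk] using hg
  · refine (k.inner_hasSum a).unique ?_
    have := a.gd.hasSum (z := l) (by simpa using hl)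
    simpa [hk] using this

lemma L2.point_bound (a : L2) {l : ℂ} (hl : ‖l‖ < 1) :
    ‖fn a l‖ ^ 2 ≤ ‖a‖ ^ 2 * (1 - ‖l‖ ^ 2)⁻¹ := by
  obtain ⟨k, -, h2, h3⟩ := exists_kernel hl
  rw [← h3, ← h2, mul_comm, ← mul_pow]
  exact pow_le_pow_left₀ (norm_nonneg _) (norm_inner_le_norm _ _) 2


lemma IsInner.le_one {φ : ℂ → ℂ} (hφ : IsInner φ) : ∀ z ∈ ball (0:ℂ) 1, ‖φ z‖ ≤ 1 := fun z hz => by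
  have := hφ.2.1 hz
  simpa using (mem_ball_zero_iff.mp this).le

lemma IsInner.ae_lim {φ : ℂ → ℂ} (hφ : IsInner φ) :
    ∀ᵐ t : ℝ ∂(volume.restrict (Ioc (0:ℝ) (2 * π))),
      Tendsto (fun r : ℝ => ‖φ (r * Complex.exp ((t:ℝ) * Complex.I))‖) (𝓝[<] 1) (𝓝 1) := by
  have h := hφ.2.2
  unfold circleHaar at h
  have hp := Real.pi_pos
  rw [Measure.ae_ennreal_smul_measure_iff (by simp [ENNReal.ofReal_eq_zero]; positivity)] at h
  have h2 := ae_of_ae_map (by fun_prop) h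
  filter_upwards [h2] with t ht
  simpa using ht

lemma IsInner.tendsto_int {φ : ℂ → ℂ} (hφ : IsInner φ) :
    Tendsto (fun r : ℝ => ∫ t in (0:ℝ)..(2 * π), (1 - ‖φ (r * Complex.exp (t * Complex.I))‖ ^ 2))
      (𝓝[<] 1) (𝓝 0) := by
  have hp := Real.pi_pos
  have := intervalIntegral.tendsto_integral_filter_of_dominated_convergence (μ := volume)
    (a := 0) (b := 2 * π) (l := 𝓝[<] (1:ℝ)) (f := fun _ => (0:ℝ))
    (F := fun r t => (1 - ‖φ ((r:ℝ) * Complex.exp ((t:ℝ) * Complex.I))‖ ^ 2)) (fun _ => 1) ?_ ?_ ?_ ?_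
  · simpa using this
  · filter_upwards [eventually_Ico] with r hr
    have := cont_circ hφ.1.continuousOn hr.1 hr.2
    exact (continuous_const.sub (this.norm.pow 2)).aestronglyMeasurable
  · filter_upwards [eventually_Ico] with r hr
    refine Eventually.of_forall fun t _ => ?_
    have := hφ.le_one _ (mem_circ hr.1 hr.2 t)
    rw [Real.norm_eq_abs, abs_le]
    constructor <;> nlinarith [norm_nonneg (φ (r * Complex.exp (t * Complex.I)))]
  · simp
  · have := hφ.ae_lim
    rw [ae_restrict_iff' measurableSet_Ioc] at this
    filter_upwards [this] with t ht h2
    rw [uIoc_of_le (by positivity)] at h2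
    have := ((ht h2).pow 2).const_sub 1
    simpa using this

lemma IsInner.isometry {φ : ℂ → ℂ} (hφ : IsInner φ) {a b : L2} (hab : IsMul φ a b) {M : ℝ}
    (hM : ∀ z ∈ ball (0:ℂ) 1, ‖fn a z‖ ≤ M) : ‖b‖ = ‖a‖ := by
  have h1 := (tendsto_pairR_self a).sub (tendsto_pairR_self b)
  have hp := Real.pi_pos
  have h2 : Tendsto (fun r => (pairR (fn a) (fn a) r).re - (pairR (fn b) (fn b) r).re) (𝓝[<] 1) (𝓝 0) := by
    have h3 := hφ.tendsto_int.const_mul ((2 * π)⁻¹ * M ^ 2)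
    rw [mul_zero] at h3
    refine squeeze_zero' ?_ ?_ h3
    · filter_upwards [eventually_Ico] with r hr
      rw [sub_nonneg]
      refine pairR_mono b.gd.diff.continuousOn a.gd.diff.continuousOn (fun z hz => ?_) hr.1 hr.2
      rw [hab hz]
      simp only [norm_mul]
      exact mul_le_of_le_one_left (norm_nonneg _) (hφ.le_one z hz)
    · filter_upwards [eventually_Ico] with r hr
      rw [pairR_self, pairR_self, Complex.ofReal_re, Complex.ofReal_re, ← mul_sub, mul_assoc]
      have c1 := cont_circ a.gd.diff.continuousOn hr.1 hr.2
      have c2 := cont_circ b.gd.diff.continuousOn hr.1 hr.2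
      have c3 := cont_circ hφ.1.continuousOn hr.1 hr.2
      have d1 : Continuous (fun t : ℝ => ‖fn a (r * Complex.exp (t * Complex.I))‖ ^ 2) := c1.norm.pow 2
      have d2 : Continuous (fun t : ℝ => ‖fn b (r * Complex.exp (t * Complex.I))‖ ^ 2) := c2.norm.pow 2
      rw [← intervalIntegral.integral_sub (d1.intervalIntegrable _ _)
        (d2.intervalIntegrable _ _)]
      refine mul_le_mul_of_nonneg_left ?_ (by positivity : (0:ℝ) ≤ (2 * π)⁻¹)
      rw [← intervalIntegral.integral_const_mul]
      refine intervalIntegral.integral_mono (by positivity : (0:ℝ) ≤ 2 * π)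
        ((d1.sub d2).intervalIntegrable _ _)
        ((continuous_const.mul (continuous_const.sub (c3.norm.pow 2))).intervalIntegrable _ _) fun t => ?_
      have hz := mem_circ hr.1 hr.2 t
      simp only
      rw [hab hz]
      simp only [norm_mul]
      have e1 := hφ.le_one _ hz
      have e2 := hM _ hz
      have e3 := norm_nonneg (φ (r * Complex.exp (t * Complex.I)))
      have e4 := norm_nonneg (fn a (r * Complex.exp (t * Complex.I)))
      have e5 : 0 ≤ 1 - ‖φ (r * Complex.exp (t * Complex.I))‖ ^ 2 := by nlinarith
      have e6 : ‖fn a (r * Complex.exp (t * Complex.I))‖ ^ 2 ≤ M ^ 2 := pow_le_pow_left₀ e4 e2 2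
      nlinarith [mul_le_mul_of_nonneg_right e6 e5]
  have h4 := tendsto_nhds_unique h1 h2
  have h5 := norm_nonneg a
  have h6 := norm_nonneg b
  nlinarith

lemma IsInner.pow {φ : ℂ → ℂ} (hφ : IsInner φ) {n : ℕ} (hn : n ≠ 0) : IsInner (fun z => φ z ^ n) := by
  refine ⟨hφ.1.pow n, fun z hz => ?_, ?_⟩
  · have := mem_ball_zero_iff.mp (hφ.2.1 hz)
    simp only [mem_ball_zero_iff, norm_pow]
    exact pow_lt_one₀ (norm_nonneg _) this hn
  · filter_upwards [hφ.2.2] with ω h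
    simpa using h.pow n

/-- An inner function does not change the sup norm. -/
lemma IsInner.hinf {φ : ℂ → ℂ} (hφ : IsInner φ) {h : ℂ → ℂ} (hd : DifferentiableOn ℂ h (ball 0 1))
    {M C : ℝ} (hM : ∀ z ∈ ball (0:ℂ) 1, ‖h z‖ ≤ M) (hC : ∀ z ∈ ball (0:ℂ) 1, ‖φ z * h z‖ ≤ C) :
    ∀ z ∈ ball (0:ℂ) 1, ‖h z‖ ≤ C := by
  have hC0 : 0 ≤ C := (norm_nonneg _).trans (hC 0 (by simp))
  intro z hz
  have hz' : ‖z‖ < 1 := by simpa using hz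
  set D := (1 - ‖z‖ ^ 2)⁻¹ with hD
  have hD0 : 0 < D := inv_pos.mpr (by nlinarith [norm_nonneg z])
  have key : ∀ n : ℕ, n ≠ 0 → (‖h z‖ ^ 2) ^ n ≤ (C ^ 2) ^ n * D := by
    intro n hn
    obtain ⟨a, ha, -⟩ := exists_L2_bdd (hd.pow n) (M := M ^ n) (fun z hz => by
      simpa using pow_le_pow_left₀ (norm_nonneg _) (hM z hz) n)
    obtain ⟨b, hb, hbn⟩ := exists_L2_bdd ((hφ.1.mul hd).pow n) (M := C ^ n) (fun z hz => by
      have := pow_le_pow_left₀ (norm_nonneg _) (hC z hz) n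
      simpa using this)
    have hiso := (hφ.pow hn).isometry (a := a) (b := b) (fun z hz => by
      rw [← hb hz]; beta_reduce; rw [← ha hz]; simp [mul_pow]) (M := M ^ n) (fun z hz => by
      rw [← ha hz]
      simpa using pow_le_pow_left₀ (norm_nonneg _) (hM z hz) n)
    have h2 := a.point_bound hz'
    rw [← ha hz, ← hiso] at h2
    calc (‖h z‖ ^ 2) ^ n = ‖(h ^ n) z‖ ^ 2 := by simp; ring
      _ ≤ ‖b‖ ^ 2 * D := h2
      _ ≤ (C ^ n) ^ 2 * D := by gcongr
      _ = _ := by ring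
  by_contra! hlt
  have hh : 0 < ‖h z‖ := lt_of_le_of_lt hC0 hlt
  set q := C ^ 2 / ‖h z‖ ^ 2 with hq
  have hq1 : q < 1 := by
    rw [hq, div_lt_one (by positivity)]; nlinarith
  have hlim := tendsto_pow_atTop_nhds_zero_of_lt_one (r := q) (by positivity) hq1
  have hlim2 := hlim.mul_const D
  rw [zero_mul] at hlim2
  have : (1:ℝ) ≤ 0 := ge_of_tendsto hlim2 (by
    filter_upwards [eventually_ne_atTop 0] with n hn
    have := key n hn
    rw [hq, div_pow, div_mul_eq_mul_div, le_div_iff₀ (by positivity)]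
    linarith)
  linarith


lemma weak_sep {X : Type*} [NormedAddCommGroup X] [NormedSpace ℂ X] (A : Set (WeakDual ℂ X))
    (hA : IsClosed A) (hc : Convex ℝ A) (l : WeakDual ℂ X) (hl : l ∉ A) : ∃ (x : X) (u : ℝ),
    (∀ m ∈ A, (m x).re < u) ∧ u < (l x).re := by
  have hst : IsScalarTower ℝ ℂ (WeakDual ℂ X) := ⟨fun a b f => by
    refine DFunLike.ext _ _ fun x => ?_
    change (a • b) • f x = a • (b • f x)
    rw [smul_assoc]⟩
  have this : LocallyConvexSpace ℝ (WeakDual ℂ X) :=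
    WeakBilin.locallyConvexSpace (B := topDualPairing ℂ X)
  obtain ⟨f, u, h1, h2⟩ := @RCLike.geometric_hahn_banach_closed_point ℂ (WeakDual ℂ X) _ _ _ A l _ _ _ _ _ this hc hA hl
  obtain ⟨x, rfl⟩ := LinearMap.dualEmbedding_surjective (topDualPairing ℂ X) f
  exact ⟨x, u, h1, h2⟩

/-- Convergence of coefficients with locally uniform bounds gives pointwise convergence. -/
lemma fn_tendsto {ι : Type*} {U : Filter ι} {a : ι → ℕ → ℂ} {b : ℕ → ℂ} {B : ℝ → ℝ}
    (hB : ∀ᶠ i in U, ∀ r, 0 ≤ r → r < 1 → ∀ k, ‖a i k‖ * r ^ k ≤ B r)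
    (hab : ∀ k, Tendsto (fun i => a i k) U (𝓝 (b k))) {z : ℂ} (hz : z ∈ ball (0:ℂ) 1) :
    Tendsto (fun i => fn (a i) z) U (𝓝 (fn b z)) := by
  have hz' : ‖z‖ < 1 := by simpa using hz
  obtain ⟨r, hr1, hr2⟩ := exists_between hz'
  have hr0 : 0 < r := (norm_nonneg z).trans_lt hr1
  refine tendsto_tsum_of_dominated_convergence (bound := fun k => B r * (‖z‖ / r) ^ k)
    ((summable_geometric_of_lt_one (by positivity) ((div_lt_one hr0).mpr hr1)).mul_left _)
    (fun k => (hab k).mul_const _) ?_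
  filter_upwards [hB] with i hi k
  rw [norm_mul, norm_pow, div_pow, mul_div_assoc', le_div_iff₀ (by positivity)]
  have := mul_le_mul_of_nonneg_right (hi r hr0.le hr2 k) (pow_nonneg (norm_nonneg z) k)
  linarith

/-- Normal families along an ultrafilter. -/
lemma montel {ι : Type*} (U : Ultrafilter ι) {f : ι → ℂ → ℂ} {B : ℝ → ℝ}
    (hf : ∀ᶠ i in (U : Filter ι), DifferentiableOn ℂ (f i) (ball 0 1) ∧
      ∀ z ∈ ball (0:ℂ) 1, ‖f i z‖ ≤ B ‖z‖) :
    ∃ F : ℂ → ℂ, DifferentiableOn ℂ F (ball 0 1) ∧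
      ∀ z ∈ ball (0:ℂ) 1, Tendsto (fun i => f i z) U (𝓝 (F z)) := by
  classical
  have h1 : ∀ i, ∃ a : ℕ → ℂ, (DifferentiableOn ℂ (f i) (ball 0 1) ∧
      ∀ z ∈ ball (0:ℂ) 1, ‖f i z‖ ≤ B ‖z‖) → EqOn (f i) (fn a) (ball 0 1) ∧
      ∀ r, 0 ≤ r → r < 1 → ∀ k, ‖a k‖ * r ^ k ≤ B r := by
    intro i
    by_cases h : (DifferentiableOn ℂ (f i) (ball 0 1) ∧ ∀ z ∈ ball (0:ℂ) 1, ‖f i z‖ ≤ B ‖z‖)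
    · obtain ⟨a, ha, hfa⟩ := exists_coef h.1
      refine ⟨a, fun _ => ⟨hfa, fun r h0 h1 k => coef_bound ha h0 h1 (fun z hz => ?_) k⟩⟩
      have hzb : z ∈ ball (0:ℂ) 1 := by simpa [hz] using h1
      rw [← hfa hzb, ← hz]
      exact h.2 z hzb
    · exact ⟨0, fun h' => absurd h' h⟩
  choose a ha using h1
  have h2 : ∀ᶠ i in (U : Filter ι), EqOn (f i) (fn (a i)) (ball 0 1) ∧
      ∀ r, 0 ≤ r → r < 1 → ∀ k, ‖a i k‖ * r ^ k ≤ B r := hf.mono fun i hi => ha i hi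
  have h3 : ∀ k, ∃ b : ℂ, Tendsto (fun i => a i k) U (𝓝 b) := by
    intro k
    have hc := isCompact_closedBall (0:ℂ) (B (1/2) * 2 ^ k)
    obtain ⟨b, -, hb⟩ := hc.ultrafilter_le_nhds (U.map (fun i => a i k)) (by
      rw [le_principal_iff]
      change ∀ᶠ i in (U : Filter ι), a i k ∈ closedBall (0:ℂ) (B (1/2) * 2 ^ k)
      filter_upwards [h2] with i hi
      have := hi.2 (1/2) (by norm_num) (by norm_num) k
      rw [mem_closedBall_zero_iff]
      calc ‖a i k‖ = ‖a i k‖ * (1/2) ^ k * 2 ^ k := by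
            rw [mul_assoc, ← mul_pow]; norm_num
        _ ≤ _ := by gcongr)
    exact ⟨b, hb⟩
  choose b hb using h3
  have hbd : ∀ r, 0 ≤ r → r < 1 → ∀ k, ‖b k‖ * r ^ k ≤ B r := by
    intro r h0 h1 k
    refine le_of_tendsto ((hb k).norm.mul_const (r ^ k)) ?_
    filter_upwards [h2] with i hi
    exact hi.2 r h0 h1 k
  have hgd : Gd b := by
    intro r h0 h1
    obtain ⟨s, hs1, hs2⟩ := exists_between h1
    have hs0 : 0 < s := h0.trans_lt hs1
    refine Summable.of_nonneg_of_le (fun k => by positivity) (fun k => ?_)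
      ((summable_geometric_of_lt_one (by positivity) ((div_lt_one hs0).mpr hs1)).mul_left (B s))
    rw [div_pow, mul_div_assoc', le_div_iff₀ (by positivity)]
    have := mul_le_mul_of_nonneg_right (hbd s hs0.le hs2 k) (pow_nonneg h0 k)
    linarith
  refine ⟨fn b, hgd.diff, fun z hz => ?_⟩
  refine (fn_tendsto (h2.mono fun i hi => hi.2) hb hz).congr' ?_
  filter_upwards [h2] with i hi
  exact (hi.1 hz).symm

/-- Extension by zero. -/
noncomputable def ev (x : C(closedBall (0:ℂ) 1, ℂ)) (z : ℂ) : ℂ :=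
  open Classical in if h : z ∈ closedBall (0:ℂ) 1 then x ⟨z, h⟩ else 0

lemma ev_of {x : C(closedBall (0:ℂ) 1, ℂ)} {z : ℂ} (h : z ∈ closedBall (0:ℂ) 1) : ev x z = x ⟨z, h⟩ := by
  simp only [ev, dif_pos h]

lemma ev_norm_le (x : C(closedBall (0:ℂ) 1, ℂ)) (z : ℂ) : ‖ev x z‖ ≤ ‖x‖ := by
  unfold ev
  split_ifs with h
  · exact x.norm_coe_le_norm _
  · simp

lemma ev_add (x y : C(closedBall (0:ℂ) 1, ℂ)) (z : ℂ) : ev (x + y) z = ev x z + ev y z := by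
  unfold ev; split_ifs <;> simp

lemma ev_smul (s : ℂ) (x : C(closedBall (0:ℂ) 1, ℂ)) (z : ℂ) : ev (s • x) z = s * ev x z := by
  unfold ev; split_ifs <;> simp

lemma ev_cont (x : C(closedBall (0:ℂ) 1, ℂ)) : ContinuousOn (ev x) (closedBall 0 1) := by
  rw [continuousOn_iff_continuous_domRestrict]
  have : (closedBall (0:ℂ) 1).domRestrict (ev x) = x := by
    ext z; exact ev_of z.2
  rw [this]; exact x.continuous

/-- The disc algebra. -/
noncomputable def DAs : Submodule ℂ C(closedBall (0:ℂ) 1, ℂ) where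
  carrier := {x | DifferentiableOn ℂ (ev x) (ball 0 1)}
  add_mem' := by
    intro x y hx hy
    exact (hx.add hy).congr fun z _ => ev_add x y z
  zero_mem' := by
    refine (differentiableOn_const (0:ℂ)).congr fun z _ => ?_
    unfold ev; split_ifs <;> simp
  smul_mem' := by
    intro s x hx
    exact (hx.const_mul s).congr fun z _ => ev_smul s x z

/-- The disc algebra as a type. -/
abbrev DA : Type := ↥DAs

lemma DAs_closed : IsClosed (DAs : Set C(closedBall (0:ℂ) 1, ℂ)) := by
  refine isClosed_of_closure_subset fun x hx => ?_
  obtain ⟨u, hu, hux⟩ := mem_closure_iff_seq_limit.mp hx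
  have h1 : TendstoUniformlyOn (fun n => ev (u n)) (ev x) atTop (ball 0 1) := by
    rw [Metric.tendstoUniformlyOn_iff]
    intro ε hε
    filter_upwards [(Metric.tendsto_nhds.mp hux) ε hε] with n hn z hz
    refine lt_of_le_of_lt ?_ hn
    rw [dist_comm, dist_eq_norm, dist_eq_norm]
    have : ev (u n) z - ev x z = ev (u n - x) z := by
      rw [sub_eq_add_neg, sub_eq_add_neg, ev_add, ← neg_one_smul ℂ x, ev_smul]; ring
    rw [this]
    exact ev_norm_le _ _
  exact h1.tendstoLocallyUniformlyOn.differentiableOn (Eventually.of_forall hu) isOpen_ball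

instance : CompleteSpace DA := DAs_closed.completeSpace_coe

/-- Build an element of the disc algebra. -/
lemma exists_DA {f : ℂ → ℂ} (hc : ContinuousOn f (closedBall 0 1))
    (hd : DifferentiableOn ℂ f (ball 0 1)) : ∃ x : DA, ∀ z ∈ closedBall (0:ℂ) 1, ev x z = f z := by
  let x : C(closedBall (0:ℂ) 1, ℂ) := ⟨(closedBall (0:ℂ) 1).domRestrict f, hc.domRestrict⟩
  have hx : ∀ z ∈ closedBall (0:ℂ) 1, ev x z = f z := fun z hz => by
    rw [ev_of hz]; rfl
  exact ⟨⟨x, hd.congr fun z hz => hx z (ball_subset_closedBall hz)⟩, hx⟩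

lemma DA.ext_ev {x y : DA} (h : ∀ z ∈ closedBall (0:ℂ) 1, ev x z = ev y z) : x = y := by
  refine Subtype.ext (ContinuousMap.ext fun z => ?_)
  have := h z z.2
  rwa [ev_of z.2, ev_of z.2] at this

lemma DA.norm_le_of {x : DA} {C : ℝ} (h0 : 0 ≤ C) (h : ∀ z ∈ closedBall (0:ℂ) 1, ‖ev x z‖ ≤ C) : ‖x‖ ≤ C := by
  change ‖(x : C(closedBall (0:ℂ) 1, ℂ))‖ ≤ C
  rw [ContinuousMap.norm_le _ h0]
  intro z
  have := h z z.2
  rwa [ev_of z.2] at this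

/-- Monomials. -/
noncomputable def mon (k : ℕ) : DA :=
  ⟨⟨fun z => (z : ℂ) ^ k, by fun_prop⟩, by
    refine (differentiableOn_pow k).congr fun z hz => ?_
    rw [ev_of (ball_subset_closedBall hz)]; rfl⟩

lemma ev_mon (k : ℕ) {z : ℂ} (hz : z ∈ closedBall (0:ℂ) 1) : ev (mon k) z = z ^ k := by
  rw [ev_of hz]; rfl

lemma norm_mon_le (k : ℕ) : ‖mon k‖ ≤ 1 := by
  refine DA.norm_le_of (by norm_num) fun z hz => ?_
  rw [ev_mon k hz, norm_pow]
  exact pow_le_one₀ (norm_nonneg _) (by simpa using hz)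

/-- Evaluation functional at a point of the closed disc. -/
noncomputable def del (z : closedBall (0:ℂ) 1) : StrongDual ℂ DA :=
  (ContinuousMap.evalCLM ℂ z).comp DAs.subtypeL

lemma del_apply (z : closedBall (0:ℂ) 1) (x : DA) : del z x = ev x z := by
  rw [ev_of z.2]; rfl

/-- Taylor coefficients of the function attached to a functional. -/
noncomputable def cf (l : StrongDual ℂ DA) (k : ℕ) : ℂ := conj (l (mon k))

lemma cf_bound (l : StrongDual ℂ DA) (k : ℕ) : ‖cf l k‖ ≤ ‖l‖ := by
  rw [cf, RCLike.norm_conj]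
  calc ‖l (mon k)‖ ≤ ‖l‖ * ‖mon k‖ := l.le_opNorm _
    _ ≤ ‖l‖ * 1 := by gcongr; exact norm_mon_le k
    _ = _ := mul_one _

lemma cf_gd (l : StrongDual ℂ DA) : Gd (cf l) := Gd.of_bound (cf_bound l)

lemma cf_add (l m : StrongDual ℂ DA) : cf (l + m) = cf l + cf m := by
  ext k; simp [cf]

lemma cf_smul (s : ℂ) (l : StrongDual ℂ DA) : cf (s • l) = conj s • cf l := by
  ext k; simp [cf]

lemma DA.exists_J (x : DA) : ∃ a : L2, EqOn (ev x) (fn a) (ball 0 1) ∧ ‖a‖ ≤ ‖x‖ :=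
  exists_L2_bdd x.2 (fun z _ => ev_norm_le _ z)

/-- The Taylor coefficient map as a bounded operator. -/
noncomputable def Jm : DA →L[ℂ] L2 :=
  LinearMap.mkContinuous
    { toFun := fun x => (DA.exists_J x).choose
      map_add' := by
        intro x y
        refine L2.fn_inj fun z hz => ?_
        rw [L2.fn_add _ _ hz, ← (DA.exists_J x).choose_spec.1 hz, ← (DA.exists_J y).choose_spec.1 hz,
          ← (DA.exists_J (x + y)).choose_spec.1 hz]
        exact ev_add _ _ _
      map_smul' := by
        intro s x
        refine L2.fn_inj fun z hz => ?_
        rw [RingHom.id_apply, L2.fn_smul, ← (DA.exists_J x).choose_spec.1 hz,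
          ← (DA.exists_J (s • x)).choose_spec.1 hz]
        exact ev_smul _ _ _ } 1 (fun x => by
          rw [one_mul]; exact (DA.exists_J x).choose_spec.2)

lemma Jm_spec (x : DA) : EqOn (ev x) (fn (Jm x)) (ball 0 1) := (DA.exists_J x).choose_spec.1

lemma Jm_mon (k j : ℕ) : Jm (mon k) j = if j = k then 1 else 0 := by
  have hg : Gd (fun j => if j = k then (1:ℂ) else 0) := Gd.of_bound (C := 1) (fun j => by
    split_ifs <;> simp)
  refine congrFun (coef_eq (Jm (mon k)).gd hg fun z hz => ?_) j
  rw [← Jm_spec _ hz, ev_mon k (ball_subset_closedBall hz), fn]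
  simp

/-- The functional `x ↦ ⟨b, J x⟩`. -/
noncomputable def lb (b : L2) : StrongDual ℂ DA := (innerSL ℂ b).comp Jm

lemma lb_apply (b : L2) (x : DA) : lb b x = inner ℂ b (Jm x) := rfl

lemma cf_lb (b : L2) : cf (lb b) = b := by
  ext k
  rw [cf, lb_apply, ← (b.inner_hasSum _).tsum_eq]
  simp [Jm_mon]


/-- Herglotz type class. -/
structure Hz (F : ℂ → ℂ) : Prop where
  diff : DifferentiableOn ℂ F (ball 0 1)
  re : ∀ z ∈ ball (0:ℂ) 1, 0 ≤ (F z).re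
  bd : ∀ z ∈ ball (0:ℂ) 1, ‖F z‖ ≤ (1 - ‖z‖)⁻¹

/-- Function attached to a weak-star functional. -/
noncomputable def Fw (l : WeakDual ℂ DA) : ℂ → ℂ := fn (cf (WeakDual.toStrongDual l))

/-- Functionals with a decomposition. -/
def Adec : Set (WeakDual ℂ DA) := {l | ∃ F1 F2 F3 F4 : ℂ → ℂ, Hz F1 ∧ Hz F2 ∧ Hz F3 ∧ Hz F4 ∧
  ∀ z ∈ ball (0:ℂ) 1, Fw l z = F1 z - F2 z + I * (F3 z - F4 z)}

lemma Hz.combo {F G : ℂ → ℂ} (hF : Hz F) (hG : Hz G) {a b : ℝ} (ha : 0 ≤ a) (hb : 0 ≤ b) (hab : a + b = 1) :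
    Hz (fun z => a * F z + b * G z) := by
  refine ⟨(hF.diff.const_mul _).add (hG.diff.const_mul _), fun z hz => ?_, fun z hz => ?_⟩
  · simp
    have := hF.re z hz
    have := hG.re z hz
    positivity
  · refine (norm_add_le _ _).trans ?_
    rw [norm_mul, norm_mul, Complex.norm_real, Complex.norm_real, Real.norm_of_nonneg ha, Real.norm_of_nonneg hb]
    calc a * ‖F z‖ + b * ‖G z‖ ≤ a * (1 - ‖z‖)⁻¹ + b * (1 - ‖z‖)⁻¹ := by
          gcongr
          · exact hF.bd z hz
          · exact hG.bd z hz
      _ = _ := by rw [← add_mul, hab, one_mul]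

lemma Adec_convex : Convex ℝ Adec := by
  intro l hl m hm a b ha hb hab
  obtain ⟨F1, F2, F3, F4, h1, h2, h3, h4, hF⟩ := hl
  obtain ⟨G1, G2, G3, G4, k1, k2, k3, k4, hG⟩ := hm
  refine ⟨_, _, _, _, h1.combo k1 ha hb hab, h2.combo k2 ha hb hab, h3.combo k3 ha hb hab,
    h4.combo k4 ha hb hab, fun z hz => ?_⟩
  have e : cf (WeakDual.toStrongDual (a • l + b • m)) =
      (a:ℂ) • cf (WeakDual.toStrongDual l) + (b:ℂ) • cf (WeakDual.toStrongDual m) := by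
    ext k
    have : (WeakDual.toStrongDual (a • l + b • m)) (mon k) = (a:ℂ) * (WeakDual.toStrongDual l) (mon k)
      + (b:ℂ) * (WeakDual.toStrongDual m) (mon k) := rfl
    simp only [cf, Pi.add_apply, Pi.smul_apply, smul_eq_mul]
    rw [this]
    simp
  have g1 : Gd ((a:ℂ) • cf (WeakDual.toStrongDual l)) := by
    refine Gd.of_bound (C := a * ‖WeakDual.toStrongDual l‖) fun k => ?_
    rw [Pi.smul_apply, norm_smul, Complex.norm_real, Real.norm_of_nonneg ha]
    gcongr; exact cf_bound _ _
  have g2 : Gd ((b:ℂ) • cf (WeakDual.toStrongDual m)) := by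
    refine Gd.of_bound (C := b * ‖WeakDual.toStrongDual m‖) fun k => ?_
    rw [Pi.smul_apply, norm_smul, Complex.norm_real, Real.norm_of_nonneg hb]
    gcongr; exact cf_bound _ _
  have hF' := hF z hz
  have hG' := hG z hz
  unfold Fw at *
  rw [e, Gd.fn_add g1 g2 hz, fn_smul, fn_smul, hF', hG']
  ring

lemma Hz.lim {ι : Type*} (U : Ultrafilter ι) {f : ι → ℂ → ℂ} (hf : ∀ᶠ i in (U : Filter ι), Hz (f i)) :
    ∃ F, Hz F ∧ ∀ z ∈ ball (0:ℂ) 1, Tendsto (fun i => f i z) U (𝓝 (F z)) := by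
  obtain ⟨F, hF, hlim⟩ := montel U (f := f) (B := fun r => (1 - r)⁻¹) (hf.mono fun i hi => ⟨hi.diff, hi.bd⟩)
  refine ⟨F, ⟨hF, fun z hz => ?_, fun z hz => ?_⟩, hlim⟩
  · exact ge_of_tendsto ((Complex.continuous_re.tendsto _).comp (hlim z hz)) (hf.mono fun i hi => hi.re z hz)
  · exact le_of_tendsto (hlim z hz).norm (hf.mono fun i hi => hi.bd z hz)

lemma cf_tendsto {U : Filter (WeakDual ℂ DA)} {x : WeakDual ℂ DA} (h : U ≤ 𝓝 x) (k : ℕ) :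
    Tendsto (fun l : WeakDual ℂ DA => cf (WeakDual.toStrongDual l) k) U (𝓝 (cf (WeakDual.toStrongDual x) k)) := by
  have h1 : Continuous (fun l : WeakDual ℂ DA => l (mon k)) := WeakDual.eval_continuous (mon k)
  exact (Complex.continuous_conj.comp h1).continuousAt.tendsto.mono_left h

lemma Adec_closed : IsClosed Adec := by
  classical
  rw [isClosed_iff_ultrafilter]
  intro x U hU hA
  have hch : ∀ l : WeakDual ℂ DA, ∃ F1 F2 F3 F4 : ℂ → ℂ, l ∈ Adec → Hz F1 ∧ Hz F2 ∧ Hz F3 ∧ Hz F4 ∧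
    ∀ z ∈ ball (0:ℂ) 1, Fw l z = F1 z - F2 z + I * (F3 z - F4 z) := by
    intro l
    by_cases h : l ∈ Adec
    · obtain ⟨F1, F2, F3, F4, h⟩ := h
      exact ⟨F1, F2, F3, F4, fun _ => h⟩
    · exact ⟨0, 0, 0, 0, fun h' => absurd h' h⟩
  choose F1 F2 F3 F4 hF using hch
  have hev : ∀ᶠ l in (U : Filter (WeakDual ℂ DA)), l ∈ Adec := hA
  obtain ⟨G1, k1, t1⟩ := Hz.lim U (f := F1) (hev.mono fun l hl => (hF l hl).1)
  obtain ⟨G2, k2, t2⟩ := Hz.lim U (f := F2) (hev.mono fun l hl => (hF l hl).2.1)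
  obtain ⟨G3, k3, t3⟩ := Hz.lim U (f := F3) (hev.mono fun l hl => (hF l hl).2.2.1)
  obtain ⟨G4, k4, t4⟩ := Hz.lim U (f := F4) (hev.mono fun l hl => (hF l hl).2.2.2.1)
  refine ⟨G1, G2, G3, G4, k1, k2, k3, k4, fun z hz => ?_⟩
  have hl : Tendsto (fun l => Fw l z) U (𝓝 (Fw x z)) := by
    refine fn_tendsto (B := fun r => 4 * (1 - r)⁻¹) ?_ (cf_tendsto hU) hz
    filter_upwards [hev] with l hl r h0 h1 k
    refine coef_bound (cf_gd _) h0 h1 (fun w hw => ?_) k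
    have hwb : w ∈ ball (0:ℂ) 1 := by simpa [hw] using h1
    obtain ⟨e1, e2, e3, e4, e5⟩ := hF l hl
    have := e5 w hwb
    unfold Fw at this
    rw [this]
    have q1 := e1.bd w hwb
    have q2 := e2.bd w hwb
    have q3 := e3.bd w hwb
    have q4 := e4.bd w hwb
    rw [hw] at q1 q2 q3 q4
    have n1 := norm_add_le (F1 l w - F2 l w) (I * (F3 l w - F4 l w))
    have n2 := norm_sub_le (F1 l w) (F2 l w)
    have n3 := norm_sub_le (F3 l w) (F4 l w)
    rw [norm_mul, Complex.norm_I, one_mul] at n1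
    linarith
  refine tendsto_nhds_unique hl ?_
  refine (((t1 z hz).sub (t2 z hz)).add (((t3 z hz).sub (t4 z hz)).const_mul I)).congr' ?_
  filter_upwards [hev] with l hl
  exact ((hF l hl).2.2.2.2 z hz).symm

lemma Hz_kernel {p : ℝ} (h0 : 0 ≤ p) (h1 : p ≤ 1) {ζ : ℂ} (hζ : ‖ζ‖ ≤ 1) :
    Hz (fun z => p * (1 - ζ * z)⁻¹) := by
  have hw : ∀ z ∈ ball (0:ℂ) 1, ‖ζ * z‖ ≤ ‖z‖ ∧ ‖z‖ < 1 := fun z hz => by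
    have : ‖z‖ < 1 := by simpa using hz
    rw [norm_mul]
    exact ⟨mul_le_of_le_one_left (norm_nonneg _) hζ, this⟩
  have hre : ∀ z ∈ ball (0:ℂ) 1, 1 - ‖z‖ ≤ (1 - ζ * z).re := fun z hz => by
    have := (Complex.re_le_norm (ζ * z)).trans (hw z hz).1
    simp only [Complex.sub_re, Complex.one_re]; linarith
  have hne : ∀ z ∈ ball (0:ℂ) 1, (1 - ζ * z) ≠ 0 := fun z hz h => by
    have := hre z hz
    rw [h] at this
    simp at this
    linarith [(hw z hz).2]
  refine ⟨?_, fun z hz => ?_, fun z hz => ?_⟩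
  · refine DifferentiableOn.const_mul ?_ _
    exact DifferentiableOn.inv (by fun_prop) hne
  · rw [Complex.re_ofReal_mul, Complex.inv_re]
    have := hre z hz
    have := (hw z hz).2
    have : 0 ≤ (1 - ζ * z).re := by linarith
    exact mul_nonneg h0 (div_nonneg this (Complex.normSq_nonneg _))
  · rw [norm_mul, norm_inv, Complex.norm_real, Real.norm_of_nonneg h0]
    have h2 := (hre z hz).trans (Complex.re_le_norm _)
    have h3 := (hw z hz).2
    calc p * ‖1 - ζ * z‖⁻¹ ≤ 1 * (1 - ‖z‖)⁻¹ := by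
          gcongr
      _ = _ := one_mul _

lemma Fw_to (l : StrongDual ℂ DA) (z : ℂ) : Fw (StrongDual.toWeakDual l) z = fn (cf l) z := rfl

lemma fn_geom (s : ℂ) {w z : ℂ} (hw : ‖w‖ ≤ 1) (hz : z ∈ ball (0:ℂ) 1) :
    fn (fun k => s * w ^ k) z = s * (1 - w * z)⁻¹ := by
  have hz' : ‖z‖ < 1 := by simpa using hz
  have h1 : ‖w * z‖ < 1 := by
    rw [norm_mul]
    nlinarith [norm_nonneg z, norm_nonneg w]
  have hs : HasSum (fun k => s * (w * z) ^ k) (s * (1 - w * z)⁻¹) :=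
    (hasSum_geometric_of_norm_lt_one h1).mul_left s
  refine HasSum.tsum_eq (hasSum_cg (fun k => ?_) hs)
  rw [mul_pow, mul_assoc]

lemma fn_del (s : ℂ) (ζ : closedBall (0:ℂ) 1) {z : ℂ} (hz : z ∈ ball (0:ℂ) 1) :
    fn (cf (s • del ζ)) z = conj s * (1 - conj (ζ:ℂ) * z)⁻¹ := by
  have hz' : ‖z‖ < 1 := by simpa using hz
  have hζ : ‖conj (ζ:ℂ)‖ ≤ 1 := by rw [RCLike.norm_conj]; exact mem_closedBall_zero_iff.mp ζ.2
  have hc : cf (s • del ζ) = fun k => conj s * conj (ζ:ℂ) ^ k := by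
    rw [cf_smul]
    ext k
    rw [Pi.smul_apply, smul_eq_mul, cf, del_apply, ev_mon k ζ.2, map_pow]
  rw [hc]
  exact fn_geom _ hζ hz

lemma del_mem (s : ℂ) (hs : ‖s‖ ≤ 1) (ζ : closedBall (0:ℂ) 1) :
    StrongDual.toWeakDual (s • del ζ) ∈ Adec := by
  have hζ : ‖conj (ζ:ℂ)‖ ≤ 1 := by rw [RCLike.norm_conj]; exact mem_closedBall_zero_iff.mp ζ.2
  have hs' : ‖conj s‖ ≤ 1 := by rw [RCLike.norm_conj]; exact hs
  have b1 : |(conj s).re| ≤ 1 := (Complex.abs_re_le_norm _).trans hs'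
  have b2 : |(conj s).im| ≤ 1 := (Complex.abs_im_le_norm _).trans hs'
  rw [abs_le] at b1 b2
  have K1 := Hz_kernel (p := max (conj s).re 0) (le_max_right _ _) (max_le b1.2 zero_le_one) hζ
  have K2 := Hz_kernel (p := max (-(conj s).re) 0) (le_max_right _ _) (max_le (by linarith [b1.1]) zero_le_one) hζ
  have K3 := Hz_kernel (p := max (conj s).im 0) (le_max_right _ _) (max_le b2.2 zero_le_one) hζ
  have K4 := Hz_kernel (p := max (-(conj s).im) 0) (le_max_right _ _) (max_le (by linarith [b2.1]) zero_le_one) hζ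
  refine ⟨_, _, _, _, K1, K2, K3, K4, fun z hz => ?_⟩
  rw [Fw_to, fn_del s ζ hz]
  have key : ∀ x : ℝ, (x:ℂ) = ((max x 0 : ℝ) : ℂ) - ((max (-x) 0 : ℝ) : ℂ) := by
    intro x
    rw [← Complex.ofReal_sub]
    congr 1
    rcases le_total x 0 with h | h
    · rw [max_eq_right h, max_eq_left (by linarith)]; ring
    · rw [max_eq_left h, max_eq_right (by linarith)]; ring
  have k3 : conj s = (((max (conj s).re 0 : ℝ) : ℂ) - ((max (-(conj s).re) 0 : ℝ) : ℂ)) +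
      (((max (conj s).im 0 : ℝ) : ℂ) - ((max (-(conj s).im) 0 : ℝ) : ℂ)) * I := by
    rw [← key, ← key, Complex.re_add_im]
  generalize ((max (conj s).re 0 : ℝ) : ℂ) = A at *
  generalize ((max (-(conj s).re) 0 : ℝ) : ℂ) = B at *
  generalize ((max (conj s).im 0 : ℝ) : ℂ) = C at *
  generalize ((max (-(conj s).im) 0 : ℝ) : ℂ) = D at *
  rw [k3]
  ring

lemma Adec_ball (l : StrongDual ℂ DA) (hl : ‖l‖ ≤ 1) : StrongDual.toWeakDual l ∈ Adec := by
  by_contra h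
  obtain ⟨x, u, h1, h2⟩ := weak_sep _ Adec_closed Adec_convex _ h
  have h3 : ∀ s : ℂ, ‖s‖ ≤ 1 → ∀ z ∈ closedBall (0:ℂ) 1, (s * ev x z).re < u := by
    intro s hs z hz
    have := h1 _ (del_mem s hs ⟨z, hz⟩)
    have e : (StrongDual.toWeakDual (s • del ⟨z, hz⟩)) x = s * del ⟨z, hz⟩ x := rfl
    rwa [e, del_apply] at this
  have hu : 0 < u := by simpa using h3 0 (by simp) 0 (by simp)
  have hx : ‖x‖ ≤ u := by
    refine DA.norm_le_of hu.le fun z hz => ?_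
    by_cases h0 : ev x z = 0
    · simp [h0, hu.le]
    have hn : (‖ev x z‖ : ℂ) ≠ 0 := by simpa using h0
    have := h3 (conj (ev x z) / ‖ev x z‖) (by simp [h0]) z hz
    rw [div_mul_eq_mul_div, mul_comm, Complex.mul_conj, Complex.normSq_eq_norm_sq] at this
    rw [Complex.ofReal_pow, pow_two, mul_div_assoc, div_self hn, mul_one, Complex.ofReal_re] at this
    exact this.le
  have e : (StrongDual.toWeakDual l) x = l x := rfl
  rw [e] at h2
  have := (Complex.re_le_norm (l x)).trans (l.le_opNorm x)
  nlinarith [norm_nonneg x]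

/-- Sector class. -/
structure QC (Q : ℂ → ℂ) : Prop where
  diff : DifferentiableOn ℂ Q (ball 0 1)
  re : ∀ z ∈ ball (0:ℂ) 1, 1 ≤ (Q z).re
  im : ∀ z ∈ ball (0:ℂ) 1, |(Q z).im| ≤ (Q z).re

lemma QC.norm_le {Q : ℂ → ℂ} (h : QC Q) {z : ℂ} (hz : z ∈ ball (0:ℂ) 1) : ‖Q z‖ ≤ 2 * (Q z).re := by
  have h1 := h.im z hz
  have h2 := Complex.norm_le_abs_re_add_abs_im (Q z)
  rw [abs_of_nonneg (by linarith [h.re z hz] : 0 ≤ (Q z).re)] at h2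
  linarith

lemma QC.add {P Q : ℂ → ℂ} (hP : QC P) (hQ : QC Q) : QC (fun z => P z + Q z) := by
  refine ⟨hP.diff.add hQ.diff, fun z hz => ?_, fun z hz => ?_⟩
  · have := hP.re z hz
    have := hQ.re z hz
    simp; linarith
  · have := hP.im z hz
    have := hQ.im z hz
    simp only [Complex.add_im, Complex.add_re]
    linarith [abs_add_le (P z).im (Q z).im]

lemma QC.le_add {P Q : ℂ → ℂ} (hP : QC P) (hQ : QC Q) {z : ℂ} (hz : z ∈ ball (0:ℂ) 1) :
    ‖P z‖ ≤ 2 * ‖P z + Q z‖ := by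
  have h1 := hP.norm_le hz
  have h2 := hQ.re z hz
  have h3 := Complex.re_le_norm (P z + Q z)
  simp only [Complex.add_re] at h3
  linarith

lemma QC.one_le {Q : ℂ → ℂ} (h : QC Q) {z : ℂ} (hz : z ∈ ball (0:ℂ) 1) : 1 ≤ ‖Q z‖ :=
  (h.re z hz).trans (Complex.re_le_norm _)

lemma Hz.sqrt {F : ℂ → ℂ} (hF : Hz F) : ∃ w, QC w ∧ ∀ z ∈ ball (0:ℂ) 1, w z ^ 2 = 1 + F z := by
  have hre : ∀ z ∈ ball (0:ℂ) 1, 1 ≤ (1 + F z).re := fun z hz => by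
    have := hF.re z hz
    simp; linarith
  have hne : ∀ z ∈ ball (0:ℂ) 1, 1 + F z ≠ 0 := fun z hz h => by
    have := hre z hz
    rw [h] at this; simp at this; linarith
  have hsq : ∀ z ∈ ball (0:ℂ) 1, Complex.exp (Complex.log (1 + F z) / 2) ^ 2 = 1 + F z := fun z hz => by
    rw [← Complex.exp_nat_mul]
    push_cast
    rw [mul_div_cancel₀ _ (by norm_num), Complex.exp_log (hne z hz)]
  have hpos : ∀ z ∈ ball (0:ℂ) 1, 0 < (Complex.exp (Complex.log (1 + F z) / 2)).re := fun z hz => by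
    rw [Complex.exp_re]
    refine mul_pos (Real.exp_pos _) (Real.cos_pos_of_mem_Ioo ?_)
    have e : (Complex.log (1 + F z) / 2).im = Complex.arg (1 + F z) / 2 := by
      have : Complex.log (1 + F z) / 2 = Complex.log (1 + F z) / ((2:ℝ):ℂ) := by push_cast; ring
      rw [this, Complex.div_ofReal_im, Complex.log_im]
    rw [e]
    have h1 := Complex.arg_le_pi (1 + F z)
    have h2 := Complex.neg_pi_lt_arg (1 + F z)
    have h3 : Complex.arg (1 + F z) < π := by
      refine lt_of_le_of_ne h1 fun h => ?_
      rw [Complex.arg_eq_pi_iff] at h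
      linarith [hre z hz, h.1]
    constructor <;> linarith
  have hab : ∀ z ∈ ball (0:ℂ) 1, 1 ≤ (Complex.exp (Complex.log (1 + F z) / 2)).re ^ 2 -
      (Complex.exp (Complex.log (1 + F z) / 2)).im ^ 2 := fun z hz => by
    have h1 := hre z hz
    rw [← hsq z hz, pow_two, Complex.mul_re] at h1
    nlinarith
  refine ⟨fun z => Complex.exp (Complex.log (1 + F z) / 2), ⟨?_, fun z hz => ?_, fun z hz => ?_⟩, hsq⟩
  · refine DifferentiableOn.cexp (DifferentiableOn.div_const (DifferentiableOn.clog
      ((differentiableOn_const _).add hF.diff) fun z hz => ?_) _)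
    exact Or.inl (lt_of_lt_of_le one_pos (hre z hz))
  · nlinarith [hab z hz, hpos z hz, sq_nonneg (Complex.exp (Complex.log (1 + F z) / 2)).im]
  · exact abs_le_of_sq_le_sq (by linarith [hab z hz]) (hpos z hz).le

lemma norm_split {X : Type*} [NormedAddCommGroup X] [NormedSpace ℂ X] (l : StrongDual ℂ X) {R : ℝ} (hl : ‖l‖ ≤ R) :
    ∃ m : StrongDual ℂ X, ‖m‖ ≤ 1 ∧ l = (R:ℂ) • m := by
  have hR : 0 ≤ R := (norm_nonneg l).trans hl
  rcases hR.eq_or_lt with h | h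
  · refine ⟨0, by simp, ?_⟩
    rw [← h] at hl
    rw [norm_le_zero_iff.mp hl]
    ext x
    simp
  · have hRc : (R:ℂ) ≠ 0 := by exact_mod_cast h.ne'
    refine ⟨(R:ℂ)⁻¹ • l, ?_, by rw [smul_smul, mul_inv_cancel₀ hRc, one_smul]⟩
    rw [norm_smul, norm_inv, Complex.norm_real, Real.norm_of_nonneg hR, inv_mul_le_iff₀ h]
    linarith

lemma kolmogorov (l : StrongDual ℂ DA) {R : ℝ} (hl : ‖l‖ ≤ R) : ∃ Q, QC Q ∧
    (∀ z ∈ ball (0:ℂ) 1, ‖Q z‖ ≤ 8 * (1 - ‖z‖)⁻¹) ∧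
    ∀ z ∈ ball (0:ℂ) 1, ‖fn (cf l) z‖ ≤ 32 * R * ‖Q z‖ ^ 2 := by
  have hR : 0 ≤ R := (norm_nonneg l).trans hl
  obtain ⟨m, hm1, hm2⟩ : ∃ m : StrongDual ℂ DA, ‖m‖ ≤ 1 ∧ l = (R:ℂ) • m := by
    exact norm_split l hl
  obtain ⟨F1, F2, F3, F4, h1, h2, h3, h4, hF⟩ := Adec_ball m hm1
  obtain ⟨w1, q1, s1⟩ := h1.sqrt
  obtain ⟨w2, q2, s2⟩ := h2.sqrt
  obtain ⟨w3, q3, s3⟩ := h3.sqrt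
  obtain ⟨w4, q4, s4⟩ := h4.sqrt
  have q12 := q1.add q2
  have q34 := q3.add q4
  refine ⟨_, q12.add q34, fun z hz => ?_, fun z hz => ?_⟩
  · have hz' : ‖z‖ < 1 := by simpa using hz
    have hi : 1 ≤ (1 - ‖z‖)⁻¹ := by
      rw [one_le_inv₀ (by linarith)]; linarith [norm_nonneg z]
    have key : ∀ {w F : ℂ → ℂ}, QC w → Hz F → w z ^ 2 = 1 + F z → ‖w z‖ ≤ 2 * (1 - ‖z‖)⁻¹ := by
      intro w F hw hF h
      have a1 := hw.one_le hz
      have a2 := hF.bd z hz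
      have a3 : ‖w z‖ ^ 2 ≤ 1 + ‖F z‖ := by
        rw [← norm_pow, h]
        exact (norm_add_le _ _).trans (by simp)
      nlinarith
    have n1 := norm_add_le (w1 z + w2 z) (w3 z + w4 z)
    have n2 := norm_add_le (w1 z) (w2 z)
    have n3 := norm_add_le (w3 z) (w4 z)
    linarith [key q1 h1 (s1 z hz), key q2 h2 (s2 z hz), key q3 h3 (s3 z hz), key q4 h4 (s4 z hz)]
  · set Q := (w1 z + w2 z) + (w3 z + w4 z) with hQ
    have key : ∀ {w F : ℂ → ℂ}, QC w → ‖w z‖ ≤ 2 * Q.re → w z ^ 2 = 1 + F z → ‖F z‖ ≤ 8 * ‖Q‖ ^ 2 := by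
      intro w F hw hwQ h
      have a1 := hw.one_le hz
      have a2 := Complex.re_le_norm Q
      have a3 : ‖F z‖ ≤ ‖w z‖ ^ 2 + 1 := by
        rw [← norm_pow]
        have : F z = w z ^ 2 - 1 := by rw [h]; ring
        rw [this]
        exact (norm_sub_le _ _).trans (by simp)
      nlinarith
    have hre : Q.re = (w1 z).re + (w2 z).re + ((w3 z).re + (w4 z).re) := by simp [hQ]
    have r1 := q1.re z hz
    have r2 := q2.re z hz
    have r3 := q3.re z hz
    have r4 := q4.re z hz
    have b1 := key q1 (F := F1) (by linarith [q1.norm_le hz]) (s1 z hz)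
    have b2 := key q2 (F := F2) (by linarith [q2.norm_le hz]) (s2 z hz)
    have b3 := key q3 (F := F3) (by linarith [q3.norm_le hz]) (s3 z hz)
    have b4 := key q4 (F := F4) (by linarith [q4.norm_le hz]) (s4 z hz)
    have hm : fn (cf m) z = F1 z - F2 z + I * (F3 z - F4 z) := hF z hz
    have hl' : fn (cf l) z = R * fn (cf m) z := by
      rw [hm2, cf_smul, fn_smul, Complex.conj_ofReal]
    rw [hl', norm_mul, Complex.norm_real, Real.norm_of_nonneg hR]
    have hb : ‖fn (cf m) z‖ ≤ 32 * ‖Q‖ ^ 2 := by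
      rw [hm]
      have n1 := norm_add_le (F1 z - F2 z) (I * (F3 z - F4 z))
      have n2 := norm_sub_le (F1 z) (F2 z)
      have n3 := norm_sub_le (F3 z) (F4 z)
      rw [norm_mul, Complex.norm_I, one_mul] at n1
      linarith
    calc R * ‖fn (cf m) z‖ ≤ R * (32 * ‖Q‖ ^ 2) := by gcongr
      _ = _ := by ring


/-- Functions dominated by a square of a sectorial function. -/
def Nc (k : ℂ → ℂ) : Prop := DifferentiableOn ℂ k (ball 0 1) ∧ ∃ Q : ℂ → ℂ, ∃ C : ℝ, 0 ≤ C ∧ QC Q ∧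
  ∀ z ∈ ball (0:ℂ) 1, ‖k z‖ ≤ C * ‖Q z‖ ^ 2

lemma QC.one : QC (fun _ => 1) := ⟨differentiableOn_const _, by simp, by simp⟩

lemma QC.damp_ge {Q : ℂ → ℂ} (h : QC Q) {e : ℝ} (he : 0 < e) {z : ℂ} (hz : z ∈ ball (0:ℂ) 1) :
    1 ≤ ‖1 + e * Q z‖ ∧ ‖Q z‖ ≤ 2 / e * ‖1 + e * Q z‖ := by
  have h1 := h.re z hz
  have h2 := Complex.re_le_norm (1 + e * Q z)
  rw [Complex.add_re, Complex.one_re, Complex.re_ofReal_mul] at h2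
  have h3 := h.norm_le hz
  refine ⟨by nlinarith, ?_⟩
  rw [div_mul_eq_mul_div, le_div_iff₀ he]
  nlinarith

lemma QC.damp_diff {Q k : ℂ → ℂ} (h : QC Q) (hk : DifferentiableOn ℂ k (ball 0 1)) {e : ℝ} (he : 0 < e) :
    DifferentiableOn ℂ (fun z => k z / (1 + e * Q z) ^ 2) (ball 0 1) := by
  refine hk.div ((((differentiableOn_const (1:ℂ)).add (h.diff.const_mul (e:ℂ)))).pow 2) fun z hz h0 => ?_
  have := (h.damp_ge he hz).1
  have h1 : 1 + e * Q z = 0 := by simpa using h0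
  rw [h1] at this
  simp at this
  linarith

lemma QC.damp_bd {Q k : ℂ → ℂ} (h : QC Q) {C : ℝ} (hC : 0 ≤ C)
    (hk : ∀ z ∈ ball (0:ℂ) 1, ‖k z‖ ≤ C * ‖Q z‖ ^ 2) {e : ℝ} (he : 0 < e) {z : ℂ} (hz : z ∈ ball (0:ℂ) 1) :
    ‖k z / (1 + e * Q z) ^ 2‖ ≤ C * (2 / e) ^ 2 := by
  obtain ⟨h1, h2⟩ := h.damp_ge he hz
  rw [norm_div, norm_pow, div_le_iff₀ (by positivity)]
  calc ‖k z‖ ≤ C * ‖Q z‖ ^ 2 := hk z hz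
    _ ≤ C * (2 / e * ‖1 + e * Q z‖) ^ 2 := by gcongr
    _ = _ := by ring

lemma QC.damp_le {Q : ℂ → ℂ} (h : QC Q) (w : ℂ) {e : ℝ} (he : 0 < e) {z : ℂ} (hz : z ∈ ball (0:ℂ) 1) :
    ‖w / (1 + e * Q z) ^ 2‖ ≤ ‖w‖ := by
  rw [norm_div, norm_pow]
  exact div_le_self (norm_nonneg _) (one_le_pow₀ (h.damp_ge he hz).1)

lemma IsInner.nc_max {φ k : ℂ → ℂ} (hφ : IsInner φ) (hk : Nc k) {Q0 : ℂ → ℂ} {C0 : ℝ} (hQ0 : QC Q0)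
    (hb : ∀ z ∈ ball (0:ℂ) 1, ‖φ z * k z‖ ≤ C0 * ‖Q0 z‖ ^ 2) :
    ∀ z ∈ ball (0:ℂ) 1, ‖k z‖ ≤ C0 * ‖Q0 z‖ ^ 2 := by
  obtain ⟨hd, Q, C, hC, hQ, hkQ⟩ := hk
  intro z hz
  have hn0 : ∀ z ∈ ball (0:ℂ) 1, Q0 z ^ 2 ≠ 0 := fun z hz h0 => by
    have h1 : Q0 z = 0 := by simpa using h0
    have := hQ0.one_le hz
    rw [h1] at this; simp at this; linarith
  have key : ∀ e : ℝ, 0 < e → ‖k z‖ ≤ C0 * ‖Q0 z‖ ^ 2 * ‖1 + e * Q z‖ ^ 2 := by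
    intro e he
    have hh := hφ.hinf (h := fun z => k z / (1 + e * Q z) ^ 2 / Q0 z ^ 2)
      ((hQ.damp_diff hd he).div (hQ0.diff.pow 2) hn0) (M := C * (2 / e) ^ 2) (C := C0) (fun z hz => ?_)
      (fun z hz => ?_) z hz
    · have h1 := (hQ.damp_ge he hz).1
      have h2 := hQ0.one_le hz
      rw [norm_div, norm_div, norm_pow, norm_pow, div_div, div_le_iff₀ (by positivity)] at hh
      linarith
    · rw [norm_div]
      refine (div_le_self (norm_nonneg _) ?_).trans (hQ.damp_bd hC hkQ he hz)
      rw [norm_pow]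
      exact one_le_pow₀ (hQ0.one_le hz)
    · have h2 := hQ0.one_le hz
      have e1 : φ z * (k z / (1 + e * Q z) ^ 2 / Q0 z ^ 2) = (φ z * k z) / (1 + e * Q z) ^ 2 / Q0 z ^ 2 := by ring
      rw [e1, norm_div, norm_pow _ 2, div_le_iff₀ (by positivity)]
      exact (hQ.damp_le _ he hz).trans (hb z hz)
  have hl : Tendsto (fun e : ℝ => C0 * ‖Q0 z‖ ^ 2 * ‖1 + e * Q z‖ ^ 2) (𝓝[>] 0) (𝓝 (C0 * ‖Q0 z‖ ^ 2)) := by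
    have hc : Continuous (fun e : ℝ => C0 * ‖Q0 z‖ ^ 2 * ‖1 + e * Q z‖ ^ 2) := by fun_prop
    have := hc.tendsto 0
    simp at this
    exact this.mono_left nhdsWithin_le_nhds
  exact ge_of_tendsto hl (eventually_nhdsWithin_of_forall fun e he => key e he)

lemma Nc.zero : Nc (fun _ => 0) := ⟨differentiableOn_const _, _, 0, le_rfl, QC.one, by simp⟩

lemma Nc.add {k j : ℂ → ℂ} (hk : Nc k) (hj : Nc j) : Nc (fun z => k z + j z) := by
  obtain ⟨hd, Q, C, hC, hQ, hkQ⟩ := hk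
  obtain ⟨hd', P, D, hD, hP, hjP⟩ := hj
  refine ⟨hd.add hd', _, 4 * (C + D), by positivity, hQ.add hP, fun z hz => ?_⟩
  have a1 := hQ.le_add hP hz
  have a2 := hP.le_add hQ hz
  rw [add_comm (P z)] at a2
  calc ‖k z + j z‖ ≤ C * ‖Q z‖ ^ 2 + D * ‖P z‖ ^ 2 := (norm_add_le _ _).trans (add_le_add (hkQ z hz) (hjP z hz))
    _ ≤ C * (2 * ‖Q z + P z‖) ^ 2 + D * (2 * ‖Q z + P z‖) ^ 2 := by gcongr
    _ = _ := by ring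

lemma Nc.smul {k : ℂ → ℂ} (hk : Nc k) (s : ℂ) : Nc (fun z => s * k z) := by
  obtain ⟨hd, Q, C, hC, hQ, hkQ⟩ := hk
  refine ⟨hd.const_mul s, _, ‖s‖ * C, by positivity, hQ, fun z hz => ?_⟩
  rw [norm_mul, mul_assoc]
  gcongr
  exact hkQ z hz

lemma Nc.bdd {k : ℂ → ℂ} (hd : DifferentiableOn ℂ k (ball 0 1)) {C : ℝ} (h : ∀ z ∈ ball (0:ℂ) 1, ‖k z‖ ≤ C) : Nc k := by
  refine ⟨hd, _, C, (norm_nonneg _).trans (h 0 (by simp)), QC.one, fun z hz => ?_⟩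
  simpa using h z hz

/-- Functionals whose Cauchy transform is divisible by `φ`. -/
def Ediv (φ : ℂ → ℂ) : Submodule ℂ (StrongDual ℂ DA) where
  carrier := {l | ∃ k, Nc k ∧ ∀ z ∈ ball (0:ℂ) 1, fn (cf l) z = φ z * k z}
  zero_mem' := by
    refine ⟨_, Nc.zero, fun z hz => ?_⟩
    have : cf (0 : StrongDual ℂ DA) = 0 := by ext k; simp [cf]
    rw [this]
    simp [fn]
  add_mem' := by
    rintro l m ⟨k, hk, h1⟩ ⟨j, hj, h2⟩
    refine ⟨_, hk.add hj, fun z hz => ?_⟩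
    rw [cf_add, Gd.fn_add (cf_gd _) (cf_gd _) hz, h1 z hz, h2 z hz]
    ring
  smul_mem' := by
    rintro s l ⟨k, hk, h1⟩
    refine ⟨_, hk.smul (conj s), fun z hz => ?_⟩
    rw [cf_smul, fn_smul, h1 z hz]
    ring

lemma norm_closed {X : Type*} [NormedAddCommGroup X] [NormedSpace ℂ X] (R : ℝ) :
    IsClosed {l : WeakDual ℂ X | ‖WeakDual.toStrongDual l‖ ≤ R} := by
  have := WeakDual.isClosed_closedBall (𝕜 := ℂ) (E := X) 0 R
  convert this using 1
  ext l
  simp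

lemma Ediv_closed {φ : ℂ → ℂ} (hφ : IsInner φ) (R : ℝ) :
    IsClosed {l : WeakDual ℂ DA | WeakDual.toStrongDual l ∈ Ediv φ ∧ ‖WeakDual.toStrongDual l‖ ≤ R} := by
  classical
  rw [isClosed_iff_ultrafilter]
  intro x U hU hA
  have hev : ∀ᶠ l in (U : Filter (WeakDual ℂ DA)), l ∈ {l : WeakDual ℂ DA | WeakDual.toStrongDual l ∈ Ediv φ ∧
    ‖WeakDual.toStrongDual l‖ ≤ R} := hA
  have hxR : ‖WeakDual.toStrongDual x‖ ≤ R := by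
    have := isClosed_iff_ultrafilter.mp (norm_closed (X := DA) R) (x := x) U hU
    exact this (hev.mono fun l hl => hl.2)
  have hR : 0 ≤ R := (ContinuousLinearMap.opNorm_nonneg _).trans hxR
  refine ⟨?_, hxR⟩
  have hch : ∀ l : WeakDual ℂ DA, ∃ k Q : ℂ → ℂ, l ∈ {l : WeakDual ℂ DA | WeakDual.toStrongDual l ∈ Ediv φ ∧
    ‖WeakDual.toStrongDual l‖ ≤ R} → DifferentiableOn ℂ k (ball 0 1) ∧ QC Q ∧
      (∀ z ∈ ball (0:ℂ) 1, fn (cf (WeakDual.toStrongDual l)) z = φ z * k z) ∧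
      (∀ z ∈ ball (0:ℂ) 1, ‖Q z‖ ≤ 8 * (1 - ‖z‖)⁻¹) ∧ (∀ z ∈ ball (0:ℂ) 1, ‖k z‖ ≤ 32 * R * ‖Q z‖ ^ 2) := by
    intro l
    by_cases h : l ∈ {l : WeakDual ℂ DA | WeakDual.toStrongDual l ∈ Ediv φ ∧ ‖WeakDual.toStrongDual l‖ ≤ R}
    · obtain ⟨⟨k, hk, h1⟩, h2⟩ := h
      obtain ⟨Q, q1, q2, q3⟩ := kolmogorov _ h2
      exact ⟨k, Q, fun _ => ⟨hk.1, q1, h1, q2, hφ.nc_max hk q1 fun z hz => by rw [← h1 z hz]; exact q3 z hz⟩⟩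
    · exact ⟨0, 0, fun h' => absurd h' h⟩
  choose k Q hkQ using hch
  obtain ⟨Q', d2, t2⟩ := montel U (f := Q) (B := fun r => 8 * (1 - r)⁻¹)
    (hev.mono fun l hl => ⟨(hkQ l hl).2.1.diff, (hkQ l hl).2.2.2.1⟩)
  obtain ⟨k', d1, t1⟩ := montel U (f := k) (B := fun r => 32 * R * (8 * (1 - r)⁻¹) ^ 2)
    (hev.mono fun l hl => ⟨(hkQ l hl).1, fun z hz => by
      refine ((hkQ l hl).2.2.2.2 z hz).trans ?_
      have := (hkQ l hl).2.2.2.1 z hz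
      gcongr⟩)
  refine ⟨k', ⟨d1, Q', 32 * R, by positivity, ⟨d2, fun z hz => ?_, fun z hz => ?_⟩, fun z hz => ?_⟩, fun z hz => ?_⟩
  · exact ge_of_tendsto ((Complex.continuous_re.tendsto _).comp (t2 z hz)) (hev.mono fun l hl => (hkQ l hl).2.1.re z hz)
  · exact le_of_tendsto_of_tendsto ((Complex.continuous_im.tendsto _).comp (t2 z hz)).abs
      ((Complex.continuous_re.tendsto _).comp (t2 z hz)) (hev.mono fun l hl => (hkQ l hl).2.1.im z hz)
  · exact le_of_tendsto_of_tendsto (t1 z hz).norm (((t2 z hz).norm.pow 2).const_mul (32 * R))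
      (hev.mono fun l hl => (hkQ l hl).2.2.2.2 z hz)
  · have hl : Tendsto (fun l : WeakDual ℂ DA => fn (cf (WeakDual.toStrongDual l)) z) U
        (𝓝 (fn (cf (WeakDual.toStrongDual x)) z)) := by
      refine fn_tendsto (B := fun _ => R) ?_ (cf_tendsto hU) hz
      filter_upwards [hev] with l hl r h0 h1 j
      have a1 := (cf_bound (WeakDual.toStrongDual l) j).trans hl.2
      have a2 : r ^ j ≤ 1 := pow_le_one₀ h0 h1.le
      have a3 : 0 ≤ r ^ j := pow_nonneg h0 j
      nlinarith [norm_nonneg (cf (WeakDual.toStrongDual l) j)]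
    refine tendsto_nhds_unique hl (((t1 z hz).const_mul (φ z)).congr' ?_)
    filter_upwards [hev] with l hl
    exact ((hkQ l hl).2.2.1 z hz).symm

lemma lb_div {φ : ℂ → ℂ} (hφ : IsInner φ) {a : L2} {k : ℂ → ℂ} (hk : Nc k)
    (h : ∀ z ∈ ball (0:ℂ) 1, fn a z = φ z * k z) : ∃ b, IsMul φ b a := by
  obtain ⟨hd, Q, C, hC, hQ, hkQ⟩ := hk
  have key : ∀ e : ℝ, 0 < e → ∀ r ∈ Ico (0:ℝ) 1,
      (pairR (fun z => k z / (1 + e * Q z) ^ 2) (fun z => k z / (1 + e * Q z) ^ 2) r).re ≤ ‖a‖ ^ 2 := by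
    intro e he r hr
    obtain ⟨b, hb, -⟩ := exists_L2_bdd (hQ.damp_diff hd he) (fun z hz => hQ.damp_bd hC hkQ he hz)
    obtain ⟨c, hc, hc2⟩ := exists_L2_of_le (f := fun z => φ z * (k z / (1 + e * Q z) ^ 2))
      (hφ.1.mul (hQ.damp_diff hd he)) a (fun z hz => by
        rw [h z hz]
        have e1 : φ z * (k z / (1 + e * Q z) ^ 2) = (φ z * k z) / (1 + e * Q z) ^ 2 := by ring
        rw [e1]
        exact hQ.damp_le _ he hz)
    have hm : IsMul φ b c := fun z hz => by
      rw [← hc hz]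
      beta_reduce
      rw [← hb hz]
    have := hφ.isometry hm (M := C * (2 / e) ^ 2) (fun z hz => by
      rw [← hb hz]; exact hQ.damp_bd hC hkQ he hz)
    rw [pairR_congr hb hb hr.1 hr.2]
    refine (pairR_self_le b hr.1 hr.2).trans ?_
    rw [← this]
    gcongr
  suffices hs : ∀ r ∈ Ico (0:ℝ) 1, (pairR k k r).re ≤ ‖a‖ ^ 2 by
    obtain ⟨b, hb, -⟩ := exists_L2 hd hs
    refine ⟨b, fun z hz => ?_⟩
    rw [h z hz, hb hz]
  intro r hr
  have hl : Tendsto (fun e : ℝ => ∫ t in (0:ℝ)..(2 * π), ‖k (r * Complex.exp (t * Complex.I)) /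
      (1 + e * Q (r * Complex.exp (t * Complex.I))) ^ 2‖ ^ 2) (𝓝[>] 0)
      (𝓝 (∫ t in (0:ℝ)..(2 * π), ‖k (r * Complex.exp (t * Complex.I))‖ ^ 2)) := by
    have c1 := cont_circ hd.continuousOn hr.1 hr.2
    have d1 : Continuous (fun t : ℝ => ‖k (r * Complex.exp (t * Complex.I))‖ ^ 2) := c1.norm.pow 2
    refine intervalIntegral.tendsto_integral_filter_of_dominated_convergence
      (fun t => ‖k (r * Complex.exp (t * Complex.I))‖ ^ 2) ?_ ?_ (d1.intervalIntegrable _ _) ?_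
    · refine eventually_nhdsWithin_of_forall fun e he => ?_
      have c2 := cont_circ (hQ.damp_diff hd he).continuousOn hr.1 hr.2
      have d2 : Continuous (fun t : ℝ => ‖k (r * Complex.exp (t * Complex.I)) /
        (1 + e * Q (r * Complex.exp (t * Complex.I))) ^ 2‖ ^ 2) := c2.norm.pow 2
      exact d2.aestronglyMeasurable
    · refine eventually_nhdsWithin_of_forall fun e he => Eventually.of_forall fun t _ => ?_
      rw [Real.norm_of_nonneg (by positivity)]
      exact pow_le_pow_left₀ (norm_nonneg _) (hQ.damp_le _ he (mem_circ hr.1 hr.2 t)) 2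
    · refine Eventually.of_forall fun t _ => ?_
      have hc : ContinuousAt (fun e : ℝ => ‖k (r * Complex.exp (t * Complex.I)) /
        (1 + e * Q (r * Complex.exp (t * Complex.I))) ^ 2‖ ^ 2) 0 := by
        refine ContinuousAt.pow (ContinuousAt.norm (ContinuousAt.div continuousAt_const (by fun_prop) (by simp))) 2
      have := hc.tendsto
      simp only [Complex.ofReal_zero, zero_mul, add_zero, one_pow, div_one] at this
      exact this.mono_left nhdsWithin_le_nhds
  rw [pairR_self, Complex.ofReal_re]
  refine le_of_tendsto (hl.const_mul (2 * π)⁻¹) (eventually_nhdsWithin_of_forall fun e he => ?_)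
  have := key e he r hr
  rwa [pairR_self, Complex.ofReal_re] at this

lemma exists_Tmul {φ : ℂ → ℂ} (hφ : IsInner φ) : ∃ T : L2 →L[ℂ] L2, ∀ b, IsMul φ b (T b) := by
  have hex : ∀ b : L2, ∃ c : L2, IsMul φ b c ∧ ‖c‖ ≤ ‖b‖ := fun b => by
    obtain ⟨c, hc, h2⟩ := exists_L2_of_le (hφ.1.mul b.gd.diff) b (fun z hz => by
      simp only [Pi.mul_apply, norm_mul]
      exact mul_le_of_le_one_left (norm_nonneg _) (hφ.le_one z hz))
    exact ⟨c, fun z hz => (hc hz).symm, h2⟩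
  choose T hT hn using hex
  refine ⟨LinearMap.mkContinuous { toFun := T, map_add' := fun x y => ?_, map_smul' := fun s x => ?_ } 1
    (fun x => by rw [one_mul]; exact hn x), hT⟩
  · refine L2.fn_inj fun z hz => ?_
    rw [L2.fn_add _ _ hz, hT x hz, hT y hz, hT (x + y) hz]
    beta_reduce
    rw [L2.fn_add _ _ hz]; ring
  · refine L2.fn_inj fun z hz => ?_
    rw [RingHom.id_apply, L2.fn_smul, hT x hz, hT (s • x) hz]
    beta_reduce
    rw [L2.fn_smul]; ring

lemma mem_Kmod_of {φ : ℂ → ℂ} (hφ : IsInner φ) {a : L2}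
    (h : ∀ k c, IsMul φ (Jm (mon k)) c → inner ℂ c a = 0) : a ∈ Kmod φ := by
  obtain ⟨T, hT⟩ := exists_Tmul hφ
  have h1 : T.adjoint a = 0 := by
    refine Subtype.ext (funext fun k => ?_)
    have h2 := h k _ (hT _)
    rw [← ContinuousLinearMap.adjoint_inner_right, ← (L2.inner_hasSum _ _).tsum_eq] at h2
    simpa [Jm_mon] using h2
  intro b c hbc
  have : c = T b := L2.fn_inj fun z hz => by rw [hbc hz, hT b hz]
  rw [this, ← ContinuousLinearMap.adjoint_inner_right, h1, inner_zero_right]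

theorem model_dense {φ : ℂ → ℂ} (hφ : IsInner φ) {a : L2} (ha : a ∈ Kmod φ)
    (h : ∀ x : DA, Jm x ∈ Kmod φ → inner ℂ a (Jm x) = 0) : a = 0 := by
  by_contra hne
  have hn : lb a ∉ Ediv φ := by
    rintro ⟨k, hk, h1⟩
    rw [cf_lb] at h1
    obtain ⟨b, hb⟩ := lb_div hφ hk h1
    exact hne (inner_self_eq_zero.mp (ha b a hb))
  obtain ⟨x, hx1, hx2⟩ := krein_smulian (Ediv φ) (Ediv_closed hφ) (lb a) hn
  refine hx2 ?_
  rw [lb_apply]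
  refine h x (mem_Kmod_of hφ fun k c hc => ?_)
  rw [← lb_apply]
  refine hx1 _ ⟨fn (Jm (mon k)), Nc.bdd (Jm (mon k)).gd.diff (C := ‖mon k‖) (fun z hz => ?_), fun z hz => ?_⟩
  · rw [← Jm_spec _ hz]; exact ev_norm_le _ _
  · rw [cf_lb]; exact hc hz

theorem model_approx {φ : ℂ → ℂ} (hφ : IsInner φ) {a : L2} (ha : a ∈ Kmod φ) {e : ℝ} (he : 0 < e) :
    ∃ x : DA, Jm x ∈ Kmod φ ∧ ‖a - Jm x‖ < e := by
  let V : Submodule ℂ L2 := Kmod φ ⊓ LinearMap.range (Jm : DA →ₗ[ℂ] L2)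
  have hmem : a ∈ V.topologicalClosure := by
    obtain ⟨v, hv, w, hw, e1⟩ := V.topologicalClosure.exists_add_mem_mem_orthogonal a
    have hvK : v ∈ Kmod φ := V.topologicalClosure_minimal inf_le_left (Kmod_closed φ) hv
    have hwK : w ∈ Kmod φ := by
      have : w = a - v := by rw [e1]; abel
      rw [this]; exact (Kmod φ).sub_mem ha hvK
    have hw0 : w = 0 := model_dense hφ hwK fun x hx => by
      have hx' : Jm x ∈ V.topologicalClosure := V.le_topologicalClosure ⟨hx, x, rfl⟩
      exact Submodule.inner_left_of_mem_orthogonal hx' hw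
    rw [e1, hw0, add_zero]; exact hv
  rw [← SetLike.mem_coe, Submodule.topologicalClosure_coe, Metric.mem_closure_iff] at hmem
  obtain ⟨y, ⟨hyK, x, hx⟩, hd⟩ := hmem e he
  refine ⟨x, ?_, ?_⟩
  · have hx' : Jm x = y := hx
    rw [hx']; exact hyK
  · have hx' : Jm x = y := hx
    rw [hx', ← dist_eq_norm]; exact hd


lemma exists_back (a : L2) (n : ℕ) : ∃ b : L2, (∀ k, b k = a (k + n)) ∧ ‖b‖ ≤ ‖a‖ := by
  have hs : Summable fun k => ‖a (k + n)‖ ^ 2 := (summable_nat_add_iff n).mpr a.hasSum_sq.summable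
  obtain ⟨b, hb⟩ := L2.exists_of_summable hs
  refine ⟨b, hb, ?_⟩
  have h1 : HasSum (fun k => ‖a (k + n)‖ ^ 2) (‖b‖ ^ 2) := by
    have := b.hasSum_sq
    simpa only [hb] using this
  have h2 := (hasSum_nat_add_iff (f := fun k => ‖a k‖ ^ 2) n).mp h1
  have h3 : ‖b‖ ^ 2 + ∑ i ∈ Finset.range n, ‖a i‖ ^ 2 = ‖a‖ ^ 2 := h2.unique a.hasSum_sq
  have h4 : 0 ≤ ∑ i ∈ Finset.range n, ‖a i‖ ^ 2 := Finset.sum_nonneg fun i _ => by positivity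
  have h5 : ‖b‖ ^ 2 ≤ ‖a‖ ^ 2 := by linarith
  exact (pow_le_pow_iff_left₀ (norm_nonneg b) (norm_nonneg a) two_ne_zero).mp h5

lemma exists_fwd (c : L2) (n : ℕ) : ∃ e : L2, (∀ k < n, e k = 0) ∧ (∀ k, e (k + n) = c k) ∧
    ∀ z ∈ ball (0:ℂ) 1, fn e z = z ^ n * fn c z := by
  have hs : Summable fun k => ‖if k < n then (0:ℂ) else c (k - n)‖ ^ 2 := by
    rw [← summable_nat_add_iff n]
    simpa using c.hasSum_sq.summable
  obtain ⟨e, he⟩ := L2.exists_of_summable hs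
  have h0 : ∀ k < n, e k = 0 := fun k hk => by rw [he, if_pos hk]
  have h1 : ∀ k, e (k + n) = c k := fun k => by rw [he, if_neg (by omega), Nat.add_sub_cancel]
  refine ⟨e, h0, h1, fun z hz => ?_⟩
  have h2 := (c.gd.hasSum hz).mul_left (z ^ n)
  have h3 : HasSum (fun k => e (k + n) * z ^ (k + n)) (z ^ n * fn c z) :=
    hasSum_cg (fun k => by rw [h1]; ring) h2
  have h4 := (hasSum_nat_add_iff (f := fun k => e k * z ^ k) n).mp h3
  rw [Finset.sum_eq_zero (fun i hi => by rw [h0 i (Finset.mem_range.mp hi), zero_mul]), add_zero] at h4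
  exact h4.tsum_eq

lemma Kmod_back {φ : ℂ → ℂ} {a b : L2} (ha : a ∈ Kmod φ) {n : ℕ} (hb : ∀ k, b k = a (k + n)) : b ∈ Kmod φ := by
  intro d c hdc
  obtain ⟨c', h1, h2, h3⟩ := exists_fwd c n
  obtain ⟨d', -, -, k3⟩ := exists_fwd d n
  have hm : IsMul φ d' c' := fun z hz => by
    beta_reduce
    rw [h3 z hz, k3 z hz, hdc hz]; ring
  have h4 := ha _ _ hm
  have h5 := c'.inner_hasSum a
  rw [h4] at h5
  have h6 : HasSum (fun k => a (k + n) * conj (c' (k + n))) (inner ℂ c b) :=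
    hasSum_cg (fun k => by rw [h2, hb]) (c.inner_hasSum b)
  have h7 := (hasSum_nat_add_iff (f := fun k => a k * conj (c' k)) n).mp h6
  rw [Finset.sum_eq_zero (fun i hi => by rw [h1 i (Finset.mem_range.mp hi), map_zero, mul_zero]), add_zero] at h7
  exact h7.unique h5

lemma exists_quot (x : DA) {l : ℂ} (hl : ‖l‖ < 1) : ∃ y : DA, ∀ z ∈ closedBall (0:ℂ) 1,
    (z - l) * ev y z = ev x z - ev x l := by
  have hlb : l ∈ ball (0:ℂ) 1 := by simpa using hl
  have hda : DifferentiableOn ℂ (ev x) (ball 0 1) := x.2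
  obtain ⟨y, hy⟩ := exists_DA (f := dslope (ev x) l)
    ((continuousOn_dslope (closedBall_mem_nhds_of_mem hlb)).mpr
      ⟨ev_cont _, hda.differentiableAt (isOpen_ball.mem_nhds hlb)⟩)
    ((Complex.differentiableOn_dslope (isOpen_ball.mem_nhds hlb)).mpr hda)
  refine ⟨y, fun z hz => ?_⟩
  rw [hy z hz, ← smul_eq_mul, sub_smul_dslope]

lemma quot_Kmod {φ : ℂ → ℂ} {x y : DA} (hx : Jm x ∈ Kmod φ) {l : ℂ} (hl : ‖l‖ < 1)
    (hy : ∀ z ∈ closedBall (0:ℂ) 1, (z - l) * ev y z = ev x z - ev x l) : Jm y ∈ Kmod φ := by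
  obtain ⟨s', h1, h2, h3⟩ := exists_fwd (Jm y) 1
  have hp : s' - l • Jm y + (ev x l) • Jm (mon 0) = Jm x := by
    refine L2.fn_inj fun z hz => ?_
    have hz' := ball_subset_closedBall hz
    rw [L2.fn_add _ _ hz, L2.fn_sub _ _ hz, L2.fn_smul, L2.fn_smul, h3 z hz, ← Jm_spec _ hz, ← Jm_spec _ hz,
      ← Jm_spec _ hz, ev_mon 0 hz']
    have := hy z hz'
    linear_combination this
  have hrec : ∀ j, Jm x (j + 1) = Jm y j - l * Jm y (j + 1) := by
    intro j
    rw [← hp, ← h2 j]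
    change s' (j + 1) - l * Jm y (j + 1) + ev x l * Jm (mon 0) (j + 1) = _
    rw [Jm_mon]; simp
  choose B hB hBn using fun n => exists_back (Jm x) n
  choose D hD hDn using fun n => exists_back (Jm y) n
  have hsum : ∀ m : ℕ, Jm y = ∑ n ∈ Finset.range m, l ^ n • B (n + 1) + l ^ m • D m := by
    intro m
    induction m with
    | zero =>
      refine Subtype.ext (funext fun j => ?_)
      simp [hD]
    | succ m ih =>
      rw [Finset.sum_range_succ, add_assoc]
      have : l ^ m • B (m + 1) + l ^ (m + 1) • D (m + 1) = l ^ m • D m := by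
        refine Subtype.ext (funext fun j => ?_)
        have := hrec (j + m)
        simp only [lp.coeFn_add, lp.coeFn_smul, Pi.add_apply, Pi.smul_apply, smul_eq_mul, hB, hD]
        rw [← add_assoc, this]; ring
      rw [this]; exact ih
  have hlim : Tendsto (fun m : ℕ => ∑ n ∈ Finset.range m, l ^ n • B (n + 1)) atTop (𝓝 (Jm y)) := by
    rw [tendsto_iff_norm_sub_tendsto_zero]
    have h0 : Tendsto (fun m : ℕ => ‖l‖ ^ m * ‖Jm y‖) atTop (𝓝 0) := by
      simpa using (tendsto_pow_atTop_nhds_zero_of_lt_one (norm_nonneg l) hl).mul_const ‖Jm y‖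
    refine squeeze_zero (fun _ => norm_nonneg _) (fun m => ?_) h0
    have e : ∑ n ∈ Finset.range m, l ^ n • B (n + 1) - Jm y = -(l ^ m • D m) := by
      nth_rewrite 1 [hsum m]; abel
    rw [e, norm_neg, norm_smul, norm_pow]
    gcongr
    exact hDn m
  refine (Kmod_closed φ).mem_of_tendsto hlim (Eventually.of_forall fun m => ?_)
  exact (Kmod φ).sum_mem fun n _ => (Kmod φ).smul_mem _ (Kmod_back hx (hB _))

lemma ev_sub (x y : C(closedBall (0:ℂ) 1, ℂ)) (z : ℂ) : ev (x - y) z = ev x z - ev y z := by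
  unfold ev; split_ifs <;> simp

lemma circ_one (t : ℝ) : ‖Complex.exp (t * Complex.I)‖ = 1 := Complex.norm_exp_ofReal_mul_I t

lemma circ_mem (t : ℝ) : Complex.exp (t * Complex.I) ∈ closedBall (0:ℂ) 1 := by
  simp [Complex.norm_exp_ofReal_mul_I]

lemma ev_circ_cont (x : DA) : Continuous (fun t : ℝ => ev x (Complex.exp (t * Complex.I))) :=
  (ev_cont _).comp_continuous (by fun_prop) circ_mem

lemma norm_Jm (x : DA) : ‖Jm x‖ ^ 2 = (2 * π)⁻¹ * ∫ t in (0:ℝ)..(2 * π), ‖ev x (Complex.exp (t * Complex.I))‖ ^ 2 := by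
  have h1 := tendsto_pairR_self (Jm x)
  have h2 : Tendsto (fun r : ℝ => (2 * π)⁻¹ * ∫ t in (0:ℝ)..(2 * π), ‖ev x (r * Complex.exp (t * Complex.I))‖ ^ 2) (𝓝[<] 1)
      (𝓝 ((2 * π)⁻¹ * ∫ t in (0:ℝ)..(2 * π), ‖ev x (Complex.exp (t * Complex.I))‖ ^ 2)) := by
    refine Tendsto.const_mul _ ?_
    refine intervalIntegral.tendsto_integral_filter_of_dominated_convergence
      (fun t => ‖(x : C(closedBall (0:ℂ) 1, ℂ))‖ ^ 2) ?_ ?_ (by simp) ?_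
    · filter_upwards [eventually_Ico] with r hr
      have hd : DifferentiableOn ℂ (ev x) (ball 0 1) := x.2
      have c2 := cont_circ hd.continuousOn hr.1 hr.2
      have d2 : Continuous (fun t : ℝ => ‖ev x (r * Complex.exp (t * Complex.I))‖ ^ 2) := c2.norm.pow 2
      exact d2.aestronglyMeasurable
    · refine Eventually.of_forall fun r => Eventually.of_forall fun t _ => ?_
      rw [Real.norm_of_nonneg (by positivity)]
      exact pow_le_pow_left₀ (norm_nonneg _) (ev_norm_le _ _) 2
    · refine Eventually.of_forall fun t _ => Tendsto.pow (Tendsto.norm ?_) 2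
      have h3 : Tendsto (fun r : ℝ => (r:ℂ) * Complex.exp (t * Complex.I)) (𝓝[<] 1)
          (𝓝[closedBall 0 1] (Complex.exp (t * Complex.I))) := by
        refine tendsto_nhdsWithin_iff.mpr ⟨?_, ?_⟩
        · have hc : Continuous (fun r : ℝ => (r:ℂ) * Complex.exp (t * Complex.I)) := by fun_prop
          have := hc.tendsto 1
          simp only [Complex.ofReal_one, one_mul] at this
          exact this.mono_left nhdsWithin_le_nhds
        · filter_upwards [eventually_Ico] with r hr
          exact ball_subset_closedBall (mem_circ hr.1 hr.2 t)
      exact ((ev_cont x) _ (circ_mem t)).tendsto.comp h3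
  refine tendsto_nhds_unique h1 (h2.congr' ?_)
  filter_upwards [eventually_Ico] with r hr
  rw [← pairR_congr (Jm_spec x) (Jm_spec x) hr.1 hr.2, pairR_self, Complex.ofReal_re]

lemma one_sub_conj_ne {l z : ℂ} (hl : ‖l‖ < 1) (hz : z ∈ closedBall (0:ℂ) 1) : 1 - conj l * z ≠ 0 := by
  have hz' : ‖z‖ ≤ 1 := by simpa using hz
  intro h
  have h1 : ‖conj l * z‖ = 1 := by rw [← sub_eq_zero.mp h, norm_one]
  rw [norm_mul, RCLike.norm_conj] at h1
  nlinarith [norm_nonneg l, norm_nonneg z]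

lemma norm_one_sub_conj (l : ℂ) {z : ℂ} (hz : ‖z‖ = 1) : ‖1 - conj l * z‖ = ‖z - l‖ := by
  have h1 : 1 - conj l * z = z * conj (z - l) := by
    rw [map_sub, mul_sub, Complex.mul_conj, Complex.normSq_eq_norm_sq, hz]
    push_cast; ring
  rw [h1, norm_mul, hz, one_mul, RCLike.norm_conj]

/-- Weighted integral. -/
noncomputable def Wt (x : DA) (l : ℂ) : ℝ := (2 * π)⁻¹ * ∫ t in (0:ℝ)..(2 * π),
  ‖ev x (Complex.exp (t * Complex.I))‖ ^ 2 / ‖Complex.exp (t * Complex.I) - l‖ ^ 2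

lemma quot_norm {x y : DA} {l : ℂ} (hl : ‖l‖ < 1)
    (hy : ∀ z ∈ closedBall (0:ℂ) 1, (z - l) * ev y z = ev x z - ev x l) : ‖Jm y‖ ^ 2 ≤ Wt x l := by
  have hlb : l ∈ ball (0:ℂ) 1 := by simpa using hl
  have hda : DifferentiableOn ℂ (ev x) (ball 0 1) := x.2
  have hne := fun z (hz : z ∈ closedBall (0:ℂ) 1) => one_sub_conj_ne hl hz
  obtain ⟨F, hF⟩ := exists_DA (f := fun z => ev x z / (1 - conj l * z))
    ((ev_cont _).div (by fun_prop) hne) (hda.div (by fun_prop) fun z hz => hne z (ball_subset_closedBall hz))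
  obtain ⟨P, hP⟩ := exists_DA (f := fun z => 1 / (1 - conj l * z))
    (ContinuousOn.div (by fun_prop) (by fun_prop) hne)
    (DifferentiableOn.div (by fun_prop) (by fun_prop) fun z hz => hne z (ball_subset_closedBall hz))
  obtain ⟨k, k1, k2, k3⟩ := exists_kernel hl
  have hk : Jm P = k := by
    refine L2.fn_inj fun z hz => ?_
    have hz' := ball_subset_closedBall hz
    rw [← Jm_spec _ hz, hP z hz']
    have : (k : ℕ → ℂ) = fun j => 1 * conj l ^ j := by ext j; rw [k1, one_mul]
    rw [this, fn_geom 1 (by rw [RCLike.norm_conj]; exact hl.le) hz]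
    ring
  have hl2 : 0 < 1 - ‖l‖ ^ 2 := by nlinarith [norm_nonneg l]
  have hWF : ‖Jm F‖ ^ 2 = Wt x l := by
    rw [norm_Jm, Wt]
    congr 2
    ext t
    rw [hF _ (circ_mem t), norm_div, norm_one_sub_conj l (circ_one t), div_pow]
  have hy2 : ‖Jm y‖ ^ 2 = ‖Jm (F - ev x l • P)‖ ^ 2 := by
    rw [norm_Jm, norm_Jm]
    congr 2
    ext t
    have e1 : ev (F - ev x l • P : DA) (Complex.exp (t * Complex.I)) =
        ev F (Complex.exp (t * Complex.I)) - ev x l * ev P (Complex.exp (t * Complex.I)) := by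
      refine (ev_sub F (ev x l • P : DA) (Complex.exp (t * Complex.I))).trans ?_
      congr 1
      exact ev_smul (ev x l) P (Complex.exp (t * Complex.I))
    have hm := circ_mem t
    rw [e1, hF _ hm, hP _ hm]
    have e2 : ev x (Complex.exp (t * Complex.I)) / (1 - conj l * Complex.exp (t * Complex.I)) -
        ev x l * (1 / (1 - conj l * Complex.exp (t * Complex.I))) =
        ((Complex.exp (t * Complex.I)) - l) * ev y (Complex.exp (t * Complex.I)) /
          (1 - conj l * Complex.exp (t * Complex.I)) := by
      rw [hy _ hm]; ring
    have e3 : ‖Complex.exp (t * Complex.I) - l‖ ≠ 0 := by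
      rw [← norm_one_sub_conj l (circ_one t)]
      exact norm_ne_zero_iff.mpr (hne _ hm)
    rw [e2, norm_div, norm_mul, norm_one_sub_conj l (circ_one t), mul_div_assoc, mul_div_cancel₀ _ e3]
  rw [hy2, ← hWF, map_sub, map_smul, hk]
  have hin : inner ℂ k (Jm F) = ev x l * ((1 - ‖l‖ ^ 2 : ℝ) : ℂ)⁻¹ := by
    rw [k3, ← Jm_spec _ hlb, hF _ (ball_subset_closedBall hlb)]
    beta_reduce
    rw [mul_comm (conj l), Complex.mul_conj, Complex.normSq_eq_norm_sq]
    push_cast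
    rfl
  have hns := norm_sub_sq (𝕜 := ℂ) (Jm F) (ev x l • k)
  have hin2 : inner ℂ (Jm F) (ev x l • k) = ((‖ev x l‖ ^ 2 * (1 - ‖l‖ ^ 2)⁻¹ : ℝ) : ℂ) := by
    rw [inner_smul_right, ← inner_conj_symm, hin, map_mul, ← Complex.ofReal_inv, Complex.conj_ofReal,
      ← mul_assoc, Complex.mul_conj, Complex.normSq_eq_norm_sq]
    push_cast; ring
  rw [hin2, norm_smul, mul_pow, k2] at hns
  rw [hns]
  have : RCLike.re (((‖ev x l‖ ^ 2 * (1 - ‖l‖ ^ 2)⁻¹ : ℝ) : ℂ)) = ‖ev x l‖ ^ 2 * (1 - ‖l‖ ^ 2)⁻¹ := Complex.ofReal_re _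
  rw [this]
  have h5 : 0 ≤ ‖ev x l‖ ^ 2 * (1 - ‖l‖ ^ 2)⁻¹ := by positivity
  linarith


lemma geom_roots {N : ℕ} (hN : 0 < N) {ζ : ℂ} (hζ : IsPrimitiveRoot ζ N) {w : ℂ} (hw : ‖w‖ < 1) :
    ∑ j ∈ Finset.range N, (1 - w * ζ ^ j)⁻¹ = N * (1 - w ^ N)⁻¹ := by
  have hwN : 1 - w ^ N ≠ 0 := by
    intro h
    have h1 : w ^ N = 1 := (sub_eq_zero.1 h).symm
    have h2 : ‖w‖ ^ N = 1 := by rw [← norm_pow, h1, norm_one]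
    have := pow_lt_one₀ (norm_nonneg w) hw hN.ne'
    linarith
  have h1 : ∀ j ∈ Finset.range N, (1 - w * ζ ^ j)⁻¹ = (∑ k ∈ Finset.range N, w ^ k * (ζ ^ k) ^ j) * (1 - w ^ N)⁻¹ := by
    intro j _
    have e : (w * ζ ^ j) ^ N = w ^ N := by
      rw [mul_pow, ← pow_mul, mul_comm j N, pow_mul, hζ.pow_eq_one, one_pow, mul_one]
    have e2 := mul_neg_geom_sum (w * ζ ^ j) N
    rw [e] at e2
    have e3 : ∑ k ∈ Finset.range N, w ^ k * (ζ ^ k) ^ j = ∑ k ∈ Finset.range N, (w * ζ ^ j) ^ k := by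
      refine Finset.sum_congr rfl fun k _ => ?_
      rw [mul_pow, ← pow_mul, ← pow_mul, mul_comm k j]
    rw [e3]
    have hne : 1 - w * ζ ^ j ≠ 0 := by
      intro h; rw [h, zero_mul] at e2; exact hwN e2.symm
    rw [← e2, mul_inv]
    have : ∑ k ∈ Finset.range N, (w * ζ ^ j) ^ k ≠ 0 := by
      intro h; rw [h, mul_zero] at e2; exact hwN e2.symm
    field_simp
  rw [Finset.sum_congr rfl h1, ← Finset.sum_mul, Finset.sum_comm]
  congr 1
  rw [Finset.sum_eq_single_of_mem 0 (Finset.mem_range.2 hN)]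
  · simp
  · intro k hk hk0
    rw [← Finset.mul_sum]
    have h2 := mul_neg_geom_sum (ζ ^ k) N
    have h3 : (ζ ^ k) ^ N = 1 := by rw [← pow_mul, mul_comm, pow_mul, hζ.pow_eq_one, one_pow]
    rw [h3, sub_self] at h2
    have h4 := hζ.pow_ne_one_of_pos_of_lt hk0 (Finset.mem_range.1 hk)
    rcases mul_eq_zero.1 h2 with h | h
    · exact absurd (sub_eq_zero.1 h).symm h4
    · rw [h, mul_zero]

lemma inv_normSq_eq {u : ℂ} (hu : ‖u‖ < 1) : (1 - ‖u‖ ^ 2) / ‖1 - u‖ ^ 2 = 2 * ((1 - u)⁻¹).re - 1 := by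
  have hne : 1 - u ≠ 0 := by
    intro h
    have : u = 1 := (sub_eq_zero.1 h).symm
    rw [this, norm_one] at hu; exact lt_irrefl _ hu
  have h0 : Complex.normSq (1 - u) ≠ 0 := by simpa using hne
  rw [Complex.inv_re, ← Complex.normSq_eq_norm_sq, ← Complex.normSq_eq_norm_sq]
  field_simp
  simp [Complex.normSq_apply]
  ring

lemma roots_sum {N : ℕ} (hN : 0 < N) {ζ : ℂ} (hζ : IsPrimitiveRoot ζ N) (hζ1 : ‖ζ‖ = 1) {ξ : ℂ} (hξ : ‖ξ‖ = 1) :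
    ∑ j ∈ Finset.range N, 1 / ‖ξ - ((1 - 1 / (N:ℝ) : ℝ) : ℂ) * ζ ^ j‖ ^ 2 ≤ 3 * (N:ℝ) ^ 2 := by
  have hN1 : (1:ℝ) ≤ N := by exact_mod_cast hN
  have hN0 : (0:ℝ) < N := by linarith
  set r : ℝ := 1 - 1 / (N:ℝ) with hr
  have hr0 : 0 ≤ r := by rw [hr, sub_nonneg, div_le_one hN0]; exact hN1
  have hr1 : r < 1 := by rw [hr]; have : 0 < 1 / (N:ℝ) := by positivity
                         linarith
  set w : ℂ := r * conj ξ with hw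
  have hwn : ‖w‖ = r := by rw [hw, norm_mul, RCLike.norm_conj, hξ, mul_one, Complex.norm_real, Real.norm_of_nonneg hr0]
  have hw1 : ‖w‖ < 1 := by rw [hwn]; exact hr1
  have hun : ∀ j, ‖w * ζ ^ j‖ = r := fun j => by rw [norm_mul, norm_pow, hζ1, one_pow, mul_one, hwn]
  have e1 : ∀ j ∈ Finset.range N, 1 / ‖ξ - (r : ℂ) * ζ ^ j‖ ^ 2 = (1 - r ^ 2)⁻¹ * (2 * ((1 - w * ζ ^ j)⁻¹).re - 1) := by
    intro j _
    have hx : ‖ξ - (r : ℂ) * ζ ^ j‖ = ‖1 - w * ζ ^ j‖ := by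
      have : ξ - (r : ℂ) * ζ ^ j = ξ * (1 - w * ζ ^ j) := by
        have : ξ * conj ξ = 1 := by rw [Complex.mul_conj, Complex.normSq_eq_norm_sq, hξ]; simp
        rw [hw]
        linear_combination (r * ζ ^ j) * this
      rw [this, norm_mul, hξ, one_mul]
    have h2 := inv_normSq_eq (u := w * ζ ^ j) (by rw [hun]; exact hr1)
    rw [hun] at h2
    rw [← h2, hx]
    have : 1 - r ^ 2 ≠ 0 := by nlinarith
    field_simp
  rw [Finset.sum_congr rfl e1, ← Finset.mul_sum, Finset.sum_sub_distrib, ← Finset.mul_sum, ← Complex.re_sum, geom_roots hN hζ hw1]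
  have hrN : r ^ N ≤ 1 / 2 := by
    have h1 := Real.one_sub_div_pow_le_exp_neg (n := N) (t := 1) hN1
    have h2 := Real.exp_neg_one_lt_half
    rw [hr]; linarith
  have hb : ((N:ℂ) * (1 - w ^ N)⁻¹).re ≤ N * 2 := by
    have h3 : ‖(1 - w ^ N)⁻¹‖ ≤ 2 := by
      rw [norm_inv]
      have : 1 / 2 ≤ ‖1 - w ^ N‖ := by
        have h4 := norm_sub_norm_le (1:ℂ) (w ^ N)
        rw [norm_one, norm_pow, hwn] at h4
        linarith
      calc ‖1 - w ^ N‖⁻¹ ≤ (1 / 2)⁻¹ := inv_anti₀ (by norm_num) this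
        _ = 2 := by norm_num
    calc _ ≤ ‖(N:ℂ) * (1 - w ^ N)⁻¹‖ := Complex.re_le_norm _
      _ = N * ‖(1 - w ^ N)⁻¹‖ := by rw [norm_mul, Complex.norm_natCast]
      _ ≤ _ := by gcongr
  have hi : (1 - r ^ 2)⁻¹ ≤ (N:ℝ) := by
    have : 1 / (N:ℝ) ≤ 1 - r ^ 2 := by nlinarith
    calc (1 - r ^ 2)⁻¹ ≤ (1 / (N:ℝ))⁻¹ := inv_anti₀ (by positivity) this
      _ = N := by simp
  have hi0 : 0 ≤ (1 - r ^ 2)⁻¹ := inv_nonneg.2 (by nlinarith)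
  simp only [Finset.sum_const, Finset.card_range, nsmul_eq_mul, mul_one]
  calc _ ≤ (1 - r ^ 2)⁻¹ * (3 * (N:ℝ)) := by
        apply mul_le_mul_of_nonneg_left _ hi0
        linarith
    _ ≤ (N:ℝ) * (3 * N) := by gcongr
    _ = _ := by ring

lemma roots_cover {N : ℕ} (hN : 0 < N) {ω : ℂ} (hω : ‖ω‖ = 1) :
    ∃ j ∈ Finset.range N, ‖ω - Complex.exp (2 * π * Complex.I / N) ^ j‖ ≤ 7 / N := by
  have hN0 : (0:ℝ) < N := by exact_mod_cast hN
  have hpi := Real.pi_pos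
  obtain ⟨θ, h0, h1, he⟩ : ∃ θ : ℝ, 0 ≤ θ ∧ θ < 2 * π ∧ ω = Complex.exp (θ * Complex.I) := by
    have e : ω = Complex.exp (Complex.arg ω * Complex.I) := by
      have := Complex.norm_mul_exp_arg_mul_I ω
      rw [hω] at this; simpa using this.symm
    have ha := Complex.arg_mem_Ioc ω
    rcases le_or_gt 0 (Complex.arg ω) with h | h
    · exact ⟨_, h, by linarith [ha.2], e⟩
    · refine ⟨Complex.arg ω + 2 * π, by linarith [ha.1], by linarith, ?_⟩
      rw [e]; push_cast
      rw [← e, add_mul, Complex.exp_add, Complex.exp_two_pi_mul_I, mul_one, ← e]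
  set s : ℝ := N * θ / (2 * π) with hs
  have hs0 : 0 ≤ s := by positivity
  refine ⟨⌊s⌋₊, ?_, ?_⟩
  · rw [Finset.mem_range, Nat.floor_lt hs0, hs, div_lt_iff₀ (by positivity)]
    exact mul_lt_mul_of_pos_left h1 hN0
  · set j := ⌊s⌋₊
    have hj1 : (j:ℝ) ≤ s := Nat.floor_le hs0
    have hj2 : s < j + 1 := Nat.lt_floor_add_one s
    have hθ : θ = s * (2 * π) / N := by rw [hs]; field_simp
    have e : ω - Complex.exp (2 * π * Complex.I / N) ^ j =
        Complex.exp (2 * π * Complex.I / N) ^ j * (Complex.exp (Complex.I * (((s - j) * (2 * π) / N : ℝ) : ℂ)) - 1) := by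
      rw [← Complex.exp_nat_mul, mul_sub, ← Complex.exp_add, he, mul_one, hθ]
      congr 2
      push_cast
      ring
    have e2 : ‖Complex.exp (2 * π * Complex.I / N) ^ j‖ = 1 := by
      have : (2 * π * Complex.I / N : ℂ) = ((2 * π / N : ℝ) : ℂ) * Complex.I := by push_cast; ring
      rw [norm_pow, this, Complex.norm_exp_ofReal_mul_I, one_pow]
    rw [e, norm_mul, e2, one_mul]
    refine (Real.norm_exp_I_mul_ofReal_sub_one_le).trans ?_
    rw [Real.norm_of_nonneg (by have : 0 ≤ s - j := by linarith
                                positivity)]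
    gcongr
    nlinarith [Real.pi_lt_d2]


lemma ev_meas (x : DA) : Measurable (ev x) := by
  classical
  have h : ev x = (closedBall (0:ℂ) 1).piecewise (ev x) (fun _ => 0) := by
    funext z
    by_cases hz : z ∈ closedBall (0:ℂ) 1
    · rw [Set.piecewise_eq_of_mem _ _ _ hz]
    · rw [Set.piecewise_eq_of_notMem _ _ _ hz]; simp only [ev]; rw [dif_neg hz]
  rw [h]
  exact ContinuousOn.measurable_piecewise (ev_cont x) continuousOn_const isClosed_closedBall.measurableSet

lemma ev_sq_int (μ : Measure ℂ) [IsFiniteMeasure μ] (x : DA) {m : ℂ → ℂ} (hm : Measurable m) :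
    Integrable (fun z => ‖ev x (m z)‖ ^ 2) μ := by
  refine Integrable.of_bound (((ev_meas x).comp hm).norm.pow_const 2).aestronglyMeasurable (‖(x : C(closedBall (0:ℂ) 1, ℂ))‖ ^ 2) (ae_of_all _ fun z => ?_)
  rw [Real.norm_of_nonneg (by positivity)]
  exact pow_le_pow_left₀ (norm_nonneg _) (ev_norm_le _ _) 2

lemma Wt_cont (x : DA) {l : ℂ} (hl : ‖l‖ < 1) : Continuous (fun t : ℝ => ‖ev x (Complex.exp (t * Complex.I))‖ ^ 2 / ‖Complex.exp (t * Complex.I) - l‖ ^ 2) := by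
  have c1 := ev_circ_cont x
  have d1 : Continuous (fun t : ℝ => ‖ev x (Complex.exp (t * Complex.I))‖ ^ 2) := c1.norm.pow 2
  have d2 : Continuous (fun t : ℝ => ‖Complex.exp (t * Complex.I) - l‖ ^ 2) := by fun_prop
  refine d1.div d2 fun t h => ?_
  have h1 : Complex.exp (t * Complex.I) = l := by simpa [sub_eq_zero] using h
  have := circ_one t
  rw [h1] at this; linarith

lemma Wt_le (x : DA) {l p : ℂ} (hl : ‖l‖ < 1) (hp : ‖p‖ < 1) (h : ∀ ξ : ℂ, ‖ξ‖ = 1 → ‖ξ - p‖ ≤ 8 * ‖ξ - l‖) :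
    Wt x l ≤ 64 * Wt x p := by
  unfold Wt
  have hpi := Real.pi_pos
  rw [mul_left_comm]
  refine mul_le_mul_of_nonneg_left ?_ (by positivity)
  rw [← intervalIntegral.integral_const_mul]
  refine intervalIntegral.integral_mono_on (by positivity) ((Wt_cont x hl).intervalIntegrable _ _) (((Wt_cont x hp).intervalIntegrable _ _).const_mul _) fun t _ => ?_
  have h1 := h _ (circ_one t)
  have hp0 : 0 < ‖Complex.exp (t * Complex.I) - p‖ := by
    have := norm_sub_norm_le (Complex.exp (t * Complex.I)) p
    rw [circ_one] at this; linarith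
  have hl0 : 0 < ‖Complex.exp (t * Complex.I) - l‖ := by
    have := norm_sub_norm_le (Complex.exp (t * Complex.I)) l
    rw [circ_one] at this; linarith
  rw [← mul_div_assoc, div_le_div_iff₀ (by positivity) (by positivity)]
  have : ‖Complex.exp (t * Complex.I) - p‖ ^ 2 ≤ 64 * ‖Complex.exp (t * Complex.I) - l‖ ^ 2 := by nlinarith
  have h0 : 0 ≤ ‖ev x (Complex.exp (t * Complex.I))‖ ^ 2 := by positivity
  nlinarith

lemma key_local {φ : ℂ → ℂ} (μ : Measure ℂ) [IsFiniteMeasure μ] (hsupp : μ (sphere (0:ℂ) 1)ᶜ = 0)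
    (hI : ∀ y : DA, Jm y ∈ Kmod φ → ∫ ζ, ‖ev y ζ‖ ^ 2 ∂μ = ‖Jm y‖ ^ 2) {x : DA} (hx : Jm x ∈ Kmod φ)
    {d : ℝ} (hd0 : 0 < d) (hd1 : d ≤ 1) {p ω : ℂ} (hp : ‖p‖ = 1) (hω : ‖ω‖ = 1) (hpω : ω ∈ closedBall p (7 * d)) :
    μ.real (closedBall p (7 * d)) * ‖ev x (((1 - d : ℝ) : ℂ) * ω)‖ ^ 2 ≤
      28800 * d ^ 2 * Wt x (((1 - d : ℝ) : ℂ) * p) + 2 * ∫ ζ in closedBall p (7 * d), ‖ev x ζ‖ ^ 2 ∂μ := by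
  set r : ℝ := 1 - d with hr
  have hr0 : 0 ≤ r := by linarith
  have hr1 : r < 1 := by linarith
  have hrn : ‖(r:ℂ)‖ = r := by rw [Complex.norm_real, Real.norm_of_nonneg hr0]
  have hl : ‖(r:ℂ) * ω‖ < 1 := by rw [norm_mul, hrn, hω, mul_one]; exact hr1
  have hpl : ‖(r:ℂ) * p‖ < 1 := by rw [norm_mul, hrn, hp, mul_one]; exact hr1
  obtain ⟨y, hy⟩ := exists_quot x hl
  have hyK := quot_Kmod hx hl hy
  have hq := quot_norm hl hy
  have hω' : ‖ω - p‖ ≤ 7 * d := by rwa [mem_closedBall, dist_eq_norm] at hpω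
  have hW : Wt x ((r:ℂ) * ω) ≤ 64 * Wt x ((r:ℂ) * p) := by
    refine Wt_le x hl hpl fun ξ hξ => ?_
    have h1 : d ≤ ‖ξ - r * ω‖ := by
      have := norm_sub_norm_le ξ (r * ω)
      rw [norm_mul, hrn, hω, hξ] at this; linarith
    have h2 : ‖ξ - r * p‖ ≤ ‖ξ - r * ω‖ + ‖(r:ℂ) * (ω - p)‖ := by
      refine le_trans (le_of_eq ?_) (norm_add_le _ _)
      congr 1; ring
    rw [norm_mul, hrn] at h2
    nlinarith [norm_nonneg (ω - p)]
  have hIy := hI y hyK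
  have hae : ∀ᵐ ζ ∂μ, ‖ζ‖ = 1 := by
    have : ∀ᵐ ζ ∂μ, ζ ∈ sphere (0:ℂ) 1 := hsupp
    filter_upwards [this] with ζ h
    simpa using h
  have i1 : Integrable (fun z => ‖ev x z‖ ^ 2) μ := ev_sq_int μ x measurable_id
  have i2 : Integrable (fun z => ‖ev y z‖ ^ 2) μ := ev_sq_int μ y measurable_id
  have key : ∫ ζ in closedBall p (7 * d), ‖ev x ((r:ℂ) * ω)‖ ^ 2 ∂μ ≤
      ∫ ζ in closedBall p (7 * d), (2 * ‖ev x ζ‖ ^ 2 + 450 * d ^ 2 * ‖ev y ζ‖ ^ 2) ∂μ := by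
    refine setIntegral_mono_on_ae (integrable_const _).integrableOn ((i1.const_mul _).add (i2.const_mul _)).integrableOn isClosed_closedBall.measurableSet ?_
    filter_upwards [hae] with ζ hζ hm
    rw [mem_closedBall, dist_eq_norm] at hm
    have hz := hy ζ (by simp [hζ])
    have e : ev x ((r:ℂ) * ω) = ev x ζ - (ζ - r * ω) * ev y ζ := by rw [hz]; ring
    have h15 : ‖ζ - r * ω‖ ≤ 15 * d := by
      have : ζ - r * ω = (ζ - p) - (ω - p) + (d:ℂ) * ω := by rw [hr]; push_cast; ring
      rw [this]
      calc _ ≤ ‖ζ - p‖ + ‖ω - p‖ + ‖(d:ℂ) * ω‖ := (norm_add_le _ _).trans (by gcongr; exact norm_sub_le _ _)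
        _ = ‖ζ - p‖ + ‖ω - p‖ + d := by rw [norm_mul, hω, Complex.norm_real, Real.norm_of_nonneg hd0.le, mul_one]
        _ ≤ _ := by linarith
    have h3 : ‖ev x ((r:ℂ) * ω)‖ ≤ ‖ev x ζ‖ + 15 * d * ‖ev y ζ‖ := by
      rw [e]
      refine (norm_sub_le _ _).trans ?_
      rw [norm_mul]; gcongr
    calc ‖ev x ((r:ℂ) * ω)‖ ^ 2 ≤ (‖ev x ζ‖ + 15 * d * ‖ev y ζ‖) ^ 2 := pow_le_pow_left₀ (norm_nonneg _) h3 2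
      _ ≤ _ := by nlinarith [sq_nonneg (‖ev x ζ‖ - 15 * d * ‖ev y ζ‖)]
  rw [setIntegral_const, smul_eq_mul, integral_add (i1.const_mul _).integrableOn (i2.const_mul _).integrableOn, integral_const_mul, integral_const_mul] at key
  have h5 : ∫ ζ in closedBall p (7 * d), ‖ev y ζ‖ ^ 2 ∂μ ≤ ∫ ζ, ‖ev y ζ‖ ^ 2 ∂μ :=
    setIntegral_le_integral i2 (ae_of_all _ fun z => by positivity)
  have h6 : 450 * d ^ 2 * ∫ ζ in closedBall p (7 * d), ‖ev y ζ‖ ^ 2 ∂μ ≤ 450 * d ^ 2 * (64 * Wt x ((r:ℂ) * p)) := by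
    refine mul_le_mul_of_nonneg_left ?_ (by positivity)
    linarith
  linarith

lemma key_local2 {φ : ℂ → ℂ} (μ : Measure ℂ) [IsFiniteMeasure μ] (hsupp : μ (sphere (0:ℂ) 1)ᶜ = 0)
    (hI : ∀ y : DA, Jm y ∈ Kmod φ → ∫ ζ, ‖ev y ζ‖ ^ 2 ∂μ = ‖Jm y‖ ^ 2) {x : DA} (hx : Jm x ∈ Kmod φ)
    {d : ℝ} (hd0 : 0 < d) (hd1 : d ≤ 1) {p : ℂ} (hp : ‖p‖ = 1) :
    ∫ ω in closedBall p (7 * d), ‖ev x (((1 - d : ℝ) : ℂ) * ω)‖ ^ 2 ∂μ ≤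
      28800 * d ^ 2 * Wt x (((1 - d : ℝ) : ℂ) * p) + 2 * ∫ ζ in closedBall p (7 * d), ‖ev x ζ‖ ^ 2 ∂μ := by
  set K := 28800 * d ^ 2 * Wt x (((1 - d : ℝ) : ℂ) * p) + 2 * ∫ ζ in closedBall p (7 * d), ‖ev x ζ‖ ^ 2 ∂μ with hK
  have hpi := Real.pi_pos
  have hK0 : 0 ≤ K := by
    have h1 : 0 ≤ Wt x (((1 - d : ℝ) : ℂ) * p) := by
      unfold Wt
      refine mul_nonneg (by positivity) (intervalIntegral.integral_nonneg (by positivity) fun t _ => by positivity)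
    have h2 : 0 ≤ ∫ ζ in closedBall p (7 * d), ‖ev x ζ‖ ^ 2 ∂μ := integral_nonneg fun z => by positivity
    positivity
  by_cases h0 : μ.real (closedBall p (7 * d)) = 0
  · have : μ (closedBall p (7 * d)) = 0 := by
      rcases (ENNReal.toReal_eq_zero_iff _).1 h0 with h | h
      · exact h
      · exact absurd h (measure_ne_top _ _)
    rw [setIntegral_measure_zero _ this]; exact hK0
  have hm : 0 < μ.real (closedBall p (7 * d)) := lt_of_le_of_ne measureReal_nonneg (Ne.symm h0)
  have hae : ∀ᵐ ζ ∂μ, ‖ζ‖ = 1 := by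
    have : ∀ᵐ ζ ∂μ, ζ ∈ sphere (0:ℂ) 1 := hsupp
    filter_upwards [this] with ζ h
    simpa using h
  have hm' : Measurable (fun ω : ℂ => ((1 - d : ℝ) : ℂ) * ω) := by fun_prop
  calc _ ≤ ∫ ω in closedBall p (7 * d), (K / μ.real (closedBall p (7 * d))) ∂μ := by
        refine setIntegral_mono_on_ae (ev_sq_int μ x hm').integrableOn (integrable_const _).integrableOn isClosed_closedBall.measurableSet ?_
        filter_upwards [hae] with ω hω hω2
        rw [le_div_iff₀ hm, mul_comm]
        exact key_local μ hsupp hI hx hd0 hd1 hp hω hω2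
    _ = K := by rw [setIntegral_const, smul_eq_mul]; field_simp


lemma Wt_sum (x : DA) {N : ℕ} (hN : 0 < N) {ζ : ℂ} (hζ : IsPrimitiveRoot ζ N) (hζ1 : ‖ζ‖ = 1) :
    ∑ j ∈ Finset.range N, Wt x (((1 - 1 / (N:ℝ) : ℝ) : ℂ) * ζ ^ j) ≤ 3 * (N:ℝ) ^ 2 * ‖Jm x‖ ^ 2 := by
  have hpi := Real.pi_pos
  have hN1 : (1:ℝ) ≤ N := by exact_mod_cast hN
  have hN0 : (0:ℝ) < N := by linarith
  have hr0 : 0 ≤ 1 - 1 / (N:ℝ) := by rw [sub_nonneg, div_le_one hN0]; exact hN1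
  have hr1 : 1 - 1 / (N:ℝ) < 1 := by
    have : 0 < 1 / (N:ℝ) := by positivity
    linarith
  have hl : ∀ j, ‖((1 - 1 / (N:ℝ) : ℝ) : ℂ) * ζ ^ j‖ < 1 := fun j => by
    rw [norm_mul, norm_pow, hζ1, one_pow, mul_one, Complex.norm_real, Real.norm_of_nonneg hr0]; exact hr1
  unfold Wt
  rw [← Finset.mul_sum, ← intervalIntegral.integral_finsetSum (fun j _ => (Wt_cont x (hl j)).intervalIntegrable _ _), norm_Jm, mul_left_comm]
  refine mul_le_mul_of_nonneg_left ?_ (by positivity)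
  have d1 : Continuous (fun t : ℝ => ‖ev x (Complex.exp (t * Complex.I))‖ ^ 2) := (ev_circ_cont x).norm.pow 2
  rw [← intervalIntegral.integral_const_mul]
  refine intervalIntegral.integral_mono_on (by positivity) ?_ ((d1.intervalIntegrable _ _).const_mul _) fun t _ => ?_
  · exact (continuous_finsetSum _ fun j _ => Wt_cont x (hl j)).intervalIntegrable _ _
  · have h1 := roots_sum hN hζ hζ1 (circ_one t)
    calc _ = (∑ j ∈ Finset.range N, 1 / ‖Complex.exp (t * Complex.I) - ((1 - 1 / (N:ℝ) : ℝ) : ℂ) * ζ ^ j‖ ^ 2) * ‖ev x (Complex.exp (t * Complex.I))‖ ^ 2 := by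
          rw [Finset.sum_mul]
          refine Finset.sum_congr rfl fun j _ => ?_
          ring
      _ ≤ _ := by gcongr

theorem unif_bound {φ : ℂ → ℂ} (μ : Measure ℂ) [IsFiniteMeasure μ] (hsupp : μ (sphere (0:ℂ) 1)ᶜ = 0)
    (hI : ∀ y : DA, Jm y ∈ Kmod φ → ∫ ζ, ‖ev y ζ‖ ^ 2 ∂μ = ‖Jm y‖ ^ 2) {x : DA} (hx : Jm x ∈ Kmod φ)
    {N : ℕ} (hN : 0 < N) :
    ∫ ω, ‖ev x (((1 - 1 / (N:ℝ) : ℝ) : ℂ) * ω)‖ ^ 2 ∂μ ≤ 86784 * ‖Jm x‖ ^ 2 := by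
  have hN1 : (1:ℝ) ≤ N := by exact_mod_cast hN
  have hN0 : (0:ℝ) < N := by linarith
  set ζ := Complex.exp (2 * π * Complex.I / N) with hζd
  have hζ : IsPrimitiveRoot ζ N := Complex.isPrimitiveRoot_exp N hN.ne'
  have hζ1 : ‖ζ‖ = 1 := hζ.norm'_eq_one hN.ne'
  set d : ℝ := 1 / (N:ℝ) with hd
  have hd0 : 0 < d := by positivity
  have hd1 : d ≤ 1 := by rw [hd, div_le_one hN0]; exact hN1
  have hp : ∀ j, ‖ζ ^ j‖ = 1 := fun j => by rw [norm_pow, hζ1, one_pow]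
  have hae : ∀ᵐ ζ ∂μ, ‖ζ‖ = 1 := by
    have : ∀ᵐ ζ ∂μ, ζ ∈ sphere (0:ℂ) 1 := hsupp
    filter_upwards [this] with ζ h
    simpa using h
  have hm' : Measurable (fun ω : ℂ => ((1 - d : ℝ) : ℂ) * ω) := by fun_prop
  have i0 := ev_sq_int μ x hm'
  have i1 : Integrable (fun z => ‖ev x z‖ ^ 2) μ := ev_sq_int μ x measurable_id
  have hms : ∀ j, MeasurableSet (closedBall (ζ ^ j) (7 * d)) := fun j => isClosed_closedBall.measurableSet
  have s1 : ∫ ω, ‖ev x (((1 - d : ℝ) : ℂ) * ω)‖ ^ 2 ∂μ ≤ ∑ j ∈ Finset.range N, ∫ ω in closedBall (ζ ^ j) (7 * d), ‖ev x (((1 - d : ℝ) : ℂ) * ω)‖ ^ 2 ∂μ := by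
    have e : ∀ j ∈ Finset.range N, ∫ ω in closedBall (ζ ^ j) (7 * d), ‖ev x (((1 - d : ℝ) : ℂ) * ω)‖ ^ 2 ∂μ = ∫ ω, (closedBall (ζ ^ j) (7 * d)).indicator (fun ω => ‖ev x (((1 - d : ℝ) : ℂ) * ω)‖ ^ 2) ω ∂μ :=
      fun j _ => (integral_indicator (hms j)).symm
    rw [Finset.sum_congr rfl e, ← integral_finsetSum _ (fun j _ => i0.indicator (hms j))]
    refine integral_mono_ae i0 (integrable_finsetSum _ (fun j _ => i0.indicator (hms j))) ?_
    filter_upwards [hae] with ω hω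
    obtain ⟨j, hj, hj2⟩ := roots_cover hN hω
    have hmem : ω ∈ closedBall (ζ ^ j) (7 * d) := by
      rw [mem_closedBall, dist_eq_norm, hd, mul_one_div]; exact hj2
    have h1 := Finset.single_le_sum (f := fun j => (closedBall (ζ ^ j) (7 * d)).indicator (fun ω => ‖ev x (((1 - d : ℝ) : ℂ) * ω)‖ ^ 2) ω)
      (fun i _ => Set.indicator_nonneg (fun z _ => by positivity) ω) hj
    simp only [Set.indicator_of_mem hmem] at h1
    exact h1
  have s2 : ∑ j ∈ Finset.range N, ∫ ω in closedBall (ζ ^ j) (7 * d), ‖ev x ω‖ ^ 2 ∂μ ≤ 192 * ∫ ω, ‖ev x ω‖ ^ 2 ∂μ := by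
    have e : ∀ j ∈ Finset.range N, ∫ ω in closedBall (ζ ^ j) (7 * d), ‖ev x ω‖ ^ 2 ∂μ = ∫ ω, (closedBall (ζ ^ j) (7 * d)).indicator (fun ω => ‖ev x ω‖ ^ 2) ω ∂μ :=
      fun j _ => (integral_indicator (hms j)).symm
    rw [Finset.sum_congr rfl e, ← integral_finsetSum _ (fun j _ => i1.indicator (hms j)), ← integral_const_mul]
    refine integral_mono_ae (integrable_finsetSum _ (fun j _ => i1.indicator (hms j))) (i1.const_mul _) ?_
    filter_upwards [hae] with ω hω
    have h1 : ∀ j ∈ Finset.range N, (closedBall (ζ ^ j) (7 * d)).indicator (fun ω => ‖ev x ω‖ ^ 2) ω ≤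
        (1 / ‖ω - ((1 - d : ℝ) : ℂ) * ζ ^ j‖ ^ 2) * (64 * d ^ 2 * ‖ev x ω‖ ^ 2) := by
      intro j _
      by_cases hm : ω ∈ closedBall (ζ ^ j) (7 * d)
      · rw [Set.indicator_of_mem hm]
        rw [mem_closedBall, dist_eq_norm] at hm
        have h8 : ‖ω - ((1 - d : ℝ) : ℂ) * ζ ^ j‖ ≤ 8 * d := by
          have : ω - ((1 - d : ℝ) : ℂ) * ζ ^ j = (ω - ζ ^ j) + (d:ℂ) * ζ ^ j := by push_cast; ring
          rw [this]
          refine (norm_add_le _ _).trans ?_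
          rw [norm_mul, hp, Complex.norm_real, Real.norm_of_nonneg hd0.le, mul_one]; linarith
        have h9 : 0 < ‖ω - ((1 - d : ℝ) : ℂ) * ζ ^ j‖ := by
          have := norm_sub_norm_le ω (((1 - d : ℝ) : ℂ) * ζ ^ j)
          rw [norm_mul, hp, Complex.norm_real, Real.norm_of_nonneg (by linarith), mul_one, hω] at this; linarith
        rw [one_div_mul_eq_div, le_div_iff₀ (by positivity), mul_comm]
        gcongr
        nlinarith
      · rw [Set.indicator_of_notMem hm]; positivity
    refine (Finset.sum_le_sum h1).trans ?_
    rw [← Finset.sum_mul]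
    have h2 := roots_sum hN hζ hζ1 hω
    calc _ ≤ (3 * (N:ℝ) ^ 2) * (64 * d ^ 2 * ‖ev x ω‖ ^ 2) := by gcongr
      _ = _ := by rw [hd]; field_simp; ring
  have s3 := Wt_sum x hN hζ hζ1
  rw [hI x hx] at s2
  refine s1.trans ((Finset.sum_le_sum fun j _ => key_local2 μ hsupp hI hx hd0 hd1 (hp j)).trans ?_)
  rw [Finset.sum_add_distrib, ← Finset.mul_sum, ← Finset.mul_sum]
  have h3 : 28800 * d ^ 2 * ∑ j ∈ Finset.range N, Wt x (((1 - d : ℝ) : ℂ) * ζ ^ j) ≤ 28800 * d ^ 2 * (3 * (N:ℝ) ^ 2 * ‖Jm x‖ ^ 2) := by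
    gcongr
  have h4 : 28800 * d ^ 2 * (3 * (N:ℝ) ^ 2 * ‖Jm x‖ ^ 2) = 86400 * ‖Jm x‖ ^ 2 := by rw [hd]; field_simp; ring
  linarith


lemma eLp_two {μ : Measure ℂ} {f : ℂ → ℂ} (hf : MemLp f 2 μ) :
    eLpNorm f 2 μ = ENNReal.ofReal (Real.sqrt (∫ z, ‖f z‖ ^ 2 ∂μ)) := by
  rw [hf.eLpNorm_eq_integral_rpow_norm two_ne_zero ENNReal.ofNat_ne_top, Real.sqrt_eq_rpow]
  simp

lemma fatou_two {μ : Measure ℂ} {f : ℕ → ℂ → ℂ} {F : ℂ → ℂ} (hf : ∀ n, AEStronglyMeasurable (f n) μ)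
    (hF : ∀ᵐ z ∂μ, Tendsto (fun n => f n z) atTop (𝓝 (F z))) {u : ℕ → ℝ} {c : ℝ}
    (hu : Tendsto u atTop (𝓝 c)) (hfu : ∀ n, eLpNorm (f n) 2 μ ≤ ENNReal.ofReal (u n)) :
    eLpNorm F 2 μ ≤ ENNReal.ofReal c := by
  refine (Lp.eLpNorm_lim_le_liminf_eLpNorm hf F hF).trans ?_
  have h1 : Tendsto (fun n => ENNReal.ofReal (u n)) atTop (𝓝 (ENNReal.ofReal c)) :=
    (ENNReal.continuous_ofReal.tendsto _).comp hu
  rw [← h1.liminf_eq]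
  exact liminf_le_liminf (Eventually.of_forall hfu)

lemma ev_memLp (μ : Measure ℂ) [IsFiniteMeasure μ] (x : DA) {m : ℂ → ℂ} (hm : Measurable m) :
    MemLp (fun z => ev x (m z)) 2 μ :=
  MemLp.of_bound ((ev_meas x).comp hm).aestronglyMeasurable ‖(x : C(closedBall (0:ℂ) 1, ℂ))‖
    (ae_of_all _ fun z => ev_norm_le _ _)

lemma fn_tendsto_L2 {x : ℕ → L2} {b : L2} (h : Tendsto x atTop (𝓝 b)) {z : ℂ} (hz : ‖z‖ < 1) :
    Tendsto (fun l => fn (x l) z) atTop (𝓝 (fn b z)) := by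
  rw [tendsto_iff_norm_sub_tendsto_zero] at h ⊢
  have hb : z ∈ ball (0:ℂ) 1 := by simpa using hz
  have h1 : ∀ l, ‖fn (x l) z - fn b z‖ ≤ ‖x l - b‖ * Real.sqrt ((1 - ‖z‖ ^ 2)⁻¹) := fun l => by
    rw [← L2.fn_sub _ _ hb]
    have hp := L2.point_bound (x l - b) hz
    have h0 : 0 ≤ (1 - ‖z‖ ^ 2)⁻¹ := inv_nonneg.2 (by nlinarith [norm_nonneg z])
    refine (pow_le_pow_iff_left₀ (norm_nonneg _) (by positivity) two_ne_zero).1 ?_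
    rw [mul_pow, Real.sq_sqrt h0]
    exact hp
  refine squeeze_zero (fun l => norm_nonneg _) h1 ?_
  simpa using h.mul_const (Real.sqrt ((1 - ‖z‖ ^ 2)⁻¹))

lemma unif_eLp {φ : ℂ → ℂ} (μ : Measure ℂ) [IsFiniteMeasure μ] (hsupp : μ (sphere (0:ℂ) 1)ᶜ = 0)
    (hI : ∀ y : DA, Jm y ∈ Kmod φ → ∫ ζ, ‖ev y ζ‖ ^ 2 ∂μ = ‖Jm y‖ ^ 2) {x y : DA} (hx : Jm x ∈ Kmod φ)
    (hy : Jm y ∈ Kmod φ) (N : ℕ) :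
    eLpNorm (fun ω => ev x (((1 - 1 / ((N + 1 : ℕ):ℝ) : ℝ) : ℂ) * ω) - ev y (((1 - 1 / ((N + 1 : ℕ):ℝ) : ℝ) : ℂ) * ω)) 2 μ
      ≤ ENNReal.ofReal (300 * ‖Jm x - Jm y‖) := by
  have hxy : Jm (x - y) ∈ Kmod φ := by rw [map_sub]; exact (Kmod φ).sub_mem hx hy
  have h1 := unif_bound μ hsupp hI hxy (N := N + 1) (Nat.succ_pos N)
  have hm : Measurable (fun ω : ℂ => ((1 - 1 / ((N + 1 : ℕ):ℝ) : ℝ) : ℂ) * ω) := by fun_prop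
  have e : (fun ω => ev x (((1 - 1 / ((N + 1 : ℕ):ℝ) : ℝ) : ℂ) * ω) - ev y (((1 - 1 / ((N + 1 : ℕ):ℝ) : ℝ) : ℂ) * ω)) =
      fun ω => ev (x - y : DA) (((1 - 1 / ((N + 1 : ℕ):ℝ) : ℝ) : ℂ) * ω) := by
    funext ω; exact (ev_sub _ _ _).symm
  rw [e, eLp_two (ev_memLp μ (x - y) hm)]
  refine ENNReal.ofReal_le_ofReal (Real.sqrt_le_iff.2 ⟨mul_nonneg (by norm_num) (norm_nonneg _), h1.trans ?_⟩)
  rw [map_sub, mul_pow]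
  exact mul_le_mul_of_nonneg_right (by norm_num) (sq_nonneg _)

theorem embed {φ : ℂ → ℂ} (hφ : IsInner φ) (μ : Measure ℂ) [IsFiniteMeasure μ] (hsupp : μ (sphere (0:ℂ) 1)ᶜ = 0)
    (hI : ∀ y : DA, Jm y ∈ Kmod φ → ∫ ζ, ‖ev y ζ‖ ^ 2 ∂μ = ‖Jm y‖ ^ 2) {b : L2} (hb : b ∈ Kmod φ) {F : ℂ → ℂ}
    (hF : ∀ᵐ ω ∂μ, Tendsto (fun N : ℕ => fn b (((1 - 1 / ((N + 1 : ℕ):ℝ) : ℝ) : ℂ) * ω)) atTop (𝓝 (F ω))) :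
    ∫ ω, ‖F ω‖ ^ 2 ∂μ = ‖b‖ ^ 2 := by
  have hae : ∀ᵐ ζ ∂μ, ‖ζ‖ = 1 := by
    have : ∀ᵐ ζ ∂μ, ζ ∈ sphere (0:ℂ) 1 := hsupp
    filter_upwards [this] with ζ h
    simpa using h
  have hex : ∀ m : ℕ, ∃ x : DA, Jm x ∈ Kmod φ ∧ ‖b - Jm x‖ < 1 / ((m:ℝ) + 1) := fun m =>
    model_approx hφ hb (by positivity)
  choose x hxK hxb using hex
  have hlim0 : Tendsto (fun m => ‖Jm (x m) - b‖) atTop (𝓝 0) := by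
    refine squeeze_zero (fun m => norm_nonneg _) (fun m => ?_) tendsto_one_div_add_atTop_nhds_zero_nat
    rw [norm_sub_rev]; exact (hxb m).le
  have hlim : Tendsto (fun m => Jm (x m)) atTop (𝓝 b) := tendsto_iff_norm_sub_tendsto_zero.2 hlim0
  set R : ℕ → ℂ := fun N => ((1 - 1 / ((N + 1 : ℕ):ℝ) : ℝ) : ℂ) with hR
  have hRn : ∀ N, ‖R N‖ < 1 := fun N => by
    have h1 : 0 < 1 / ((N + 1 : ℕ):ℝ) := by positivity
    have h2 : 1 / ((N + 1 : ℕ):ℝ) ≤ 1 := by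
      rw [div_le_one (by positivity)]; push_cast; linarith [Nat.cast_nonneg (α := ℝ) N]
    simp only [hR]
    rw [Complex.norm_real, Real.norm_of_nonneg (by linarith)]
    linarith
  have hRl : Tendsto R atTop (𝓝 1) := by
    have h1 : Tendsto (fun N : ℕ => (1:ℝ) - 1 / ((N + 1 : ℕ):ℝ)) atTop (𝓝 (1 - 0)) := by
      refine tendsto_const_nhds.sub ?_
      simpa using tendsto_one_div_add_atTop_nhds_zero_nat (𝕜 := ℝ)
    have h2 := (Complex.continuous_ofReal.tendsto _).comp h1
    simpa [hR, Function.comp_def] using h2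
  have hm : ∀ N, Measurable (fun ω : ℂ => R N * ω) := fun N => by fun_prop
  have hpt : ∀ N, ∀ᵐ ω ∂μ, Tendsto (fun l => ev (x l) (R N * ω)) atTop (𝓝 (fn b (R N * ω))) := fun N => by
    filter_upwards [hae] with ω hω
    have hz : ‖R N * ω‖ < 1 := by rw [norm_mul, hω, mul_one]; exact hRn N
    have h := fn_tendsto_L2 hlim hz
    refine h.congr fun l => ?_
    exact (Jm_spec (x l) (by simpa using hz)).symm
  have hsm : ∀ N, AEStronglyMeasurable (fun ω => fn b (R N * ω)) μ := fun N =>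
    aestronglyMeasurable_of_tendsto_ae atTop (fun l => (ev_memLp μ (x l) (hm N)).1) (hpt N)
  have hFm : AEStronglyMeasurable F μ := aestronglyMeasurable_of_tendsto_ae atTop hsm hF
  have st1 : ∀ m N, eLpNorm (fun ω => fn b (R N * ω) - ev (x m) (R N * ω)) 2 μ ≤ ENNReal.ofReal (300 * ‖b - Jm (x m)‖) := by
    intro m N
    refine fatou_two (f := fun l ω => ev (x l) (R N * ω) - ev (x m) (R N * ω)) (u := fun l => 300 * ‖Jm (x l) - Jm (x m)‖)
      (fun l => ((ev_memLp μ (x l) (hm N)).sub (ev_memLp μ (x m) (hm N))).1) ?_ ?_ ?_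
    · filter_upwards [hpt N] with ω h
      exact h.sub_const _
    · exact ((hlim.sub_const _).norm).const_mul _
    · intro l
      exact unif_eLp μ hsupp hI (hxK l) (hxK m) N
  have mx : ∀ m, MemLp (fun ω => ev (x m) ω) 2 μ := fun m => ev_memLp μ (x m) measurable_id
  have st2 : ∀ m, eLpNorm (fun ω => F ω - ev (x m) ω) 2 μ ≤ ENNReal.ofReal (300 * ‖b - Jm (x m)‖) := by
    intro m
    refine fatou_two (f := fun N ω => fn b (R N * ω) - ev (x m) (R N * ω)) (u := fun N => 300 * ‖b - Jm (x m)‖)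
      (fun N => (hsm N).sub (ev_memLp μ (x m) (hm N)).1) ?_ tendsto_const_nhds (st1 m)
    filter_upwards [hF, hae] with ω h hω
    refine h.sub ?_
    have hc := ev_cont (x m) ω (by simp [hω])
    refine hc.tendsto.comp (tendsto_nhdsWithin_iff.2 ⟨?_, Eventually.of_forall fun N => ?_⟩)
    · simpa using hRl.mul_const ω
    · rw [mem_closedBall, dist_zero_right, norm_mul, hω, mul_one]; exact (hRn N).le
  have en : ∀ m, eLpNorm (fun ω => ev (x m) ω) 2 μ = ENNReal.ofReal ‖Jm (x m)‖ := fun m => by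
    rw [eLp_two (mx m), hI _ (hxK m), Real.sqrt_sq (norm_nonneg _)]
  have t1 : Tendsto (fun m => ENNReal.ofReal (300 * ‖b - Jm (x m)‖)) atTop (𝓝 0) := by
    have : Tendsto (fun m => 300 * ‖b - Jm (x m)‖) atTop (𝓝 0) := by
      have := hlim0.const_mul 300
      simp only [mul_zero] at this
      refine this.congr fun m => ?_
      rw [norm_sub_rev]
    have := (ENNReal.continuous_ofReal.tendsto _).comp this
    rwa [ENNReal.ofReal_zero] at this
  have t2 : Tendsto (fun m => ENNReal.ofReal ‖Jm (x m)‖) atTop (𝓝 (ENNReal.ofReal ‖b‖)) :=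
    (ENNReal.continuous_ofReal.tendsto _).comp hlim.norm
  have u1 : eLpNorm F 2 μ ≤ ENNReal.ofReal ‖b‖ := by
    have t4 := t1.add t2
    rw [zero_add] at t4
    refine ge_of_tendsto' t4 fun m => ?_
    calc eLpNorm F 2 μ = eLpNorm ((fun ω => F ω - ev (x m) ω) + fun ω => ev (x m) ω) 2 μ := by
          congr 1; funext ω; simp
      _ ≤ _ := eLpNorm_add_le (hFm.sub (mx m).1) (mx m).1 (by norm_num)
      _ ≤ _ := by rw [en]; gcongr; exact st2 m
  have hFL : MemLp F 2 μ := ⟨hFm, u1.trans_lt ENNReal.ofReal_lt_top⟩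
  have u2 : ENNReal.ofReal ‖b‖ ≤ eLpNorm F 2 μ := by
    have t3 : Tendsto (fun m => eLpNorm F 2 μ + ENNReal.ofReal (300 * ‖b - Jm (x m)‖)) atTop (𝓝 (eLpNorm F 2 μ)) := by
      simpa using tendsto_const_nhds.add t1
    refine le_of_tendsto_of_tendsto' t2 t3 fun m => ?_
    rw [← en]
    calc eLpNorm (fun ω => ev (x m) ω) 2 μ = eLpNorm (F - (fun ω => F ω - ev (x m) ω)) 2 μ := by
          congr 1; funext ω; simp
      _ ≤ _ := eLpNorm_sub_le hFm (hFm.sub (mx m).1) (by norm_num)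
      _ ≤ _ := by gcongr; exact st2 m
  have h := le_antisymm u1 u2
  rw [eLp_two hFL, ENNReal.ofReal_eq_ofReal_iff (Real.sqrt_nonneg _) (norm_nonneg _)] at h
  rw [← h, Real.sq_sqrt (integral_nonneg fun z => by positivity)]

/-- let `μ ∈ Iso(φ)` (every continuous-up-to-the-boundary member
`h` of `H(φ)` satisfies `∫|h|² dμ = ‖h‖²_{H²}`), let `g ∈ H(φ)` have Taylor
coefficients `c`, let `G n` be the `n`-th iterated backward shift of `g`
(`G n (z) = Σ_k c_{k+n} z^k`), and let `Gs n` be the `μ`-a.e. (radial) boundary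
values of `G n`, so that `Φ(g) = Gs 0` and `Φ((S*)^{n+1} g) = Gs (n+1)`.  Then
for `μ`-a.e. `ω` the Taylor partial sum satisfies
`g_n(ω) = Φ(g)(ω) - ω^{n+1} Φ((S*)^{n+1}g)(ω)`, and consequently
`‖Φ(g) - g_n‖²_{L²(μ)} = ‖(S*)^{n+1}g‖²_{H²} = Σ_{k>n} |c_k|² → 0`. -/
theorem partial_sums_converge_in_L2mu
    (φ : ℂ → ℂ) (hφ : IsInner φ)
    (μ : Measure ℂ) [IsFiniteMeasure μ] (hsupp : μ (sphere (0:ℂ) 1)ᶜ = 0)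
    (hIso : ∀ h : ℂ → ℂ, ContinuousOn h (closedBall (0:ℂ) 1) → MemModel φ h →
      ∀ N : ℝ, Tendsto (fun r => (pairR h h r).re) (𝓝[<] (1:ℝ)) (𝓝 N) →
        (∫ ζ, ‖h ζ‖ ^ 2 ∂μ) = N)
    (g : ℂ → ℂ) (hg : MemModel φ g)
    (c : ℕ → ℂ) (hc : ∀ z ∈ ball (0:ℂ) 1, HasSum (fun k : ℕ => c k * z ^ k) (g z))
    (G : ℕ → ℂ → ℂ)
    (hG : ∀ n : ℕ, ∀ z ∈ ball (0:ℂ) 1,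
      HasSum (fun k : ℕ => c (k + n) * z ^ k) (G n z))
    (Gs : ℕ → ℂ → ℂ)
    (hGs : ∀ n : ℕ, ∀ᵐ ω ∂μ,
      Tendsto (fun r : ℝ => G n (r • ω)) (𝓝[<] (1:ℝ)) (𝓝 (Gs n ω))) :
    (∀ n : ℕ, ∀ᵐ ω ∂μ,
      (∑ k ∈ Finset.range (n + 1), c k * ω ^ k) =
        Gs 0 ω - ω ^ (n + 1) * Gs (n + 1) ω) ∧
    (∀ n : ℕ,
      (∫ ω, ‖Gs 0 ω - ∑ k ∈ Finset.range (n + 1), c k * ω ^ k‖ ^ 2 ∂μ) =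
        ∑' k : ℕ, ‖c (k + n + 1)‖ ^ 2) ∧
    Tendsto
      (fun n : ℕ =>
        ∫ ω, ‖Gs 0 ω - ∑ k ∈ Finset.range (n + 1), c k * ω ^ k‖ ^ 2 ∂μ)
      atTop (𝓝 0) := by
  have hφd := hφ.1
  have hφ1 := hφ.le_one
  have hae : ∀ᵐ ζ ∂μ, ‖ζ‖ = 1 := by
    have : ∀ᵐ ζ ∂μ, ζ ∈ sphere (0:ℂ) 1 := hsupp
    filter_upwards [this] with ζ h
    simpa using h
  have hI : ∀ y : DA, Jm y ∈ Kmod φ → ∫ ζ, ‖ev y ζ‖ ^ 2 ∂μ = ‖Jm y‖ ^ 2 := by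
    intro y hy
    refine hIso (ev y) (ev_cont y) ((memModel_iff hφd hφ1 (Jm_spec y)).2 hy) _ ?_
    refine (tendsto_pairR_self (Jm y)).congr' ?_
    have hev : ∀ᶠ r : ℝ in 𝓝[<] (1:ℝ), r ∈ Ico (0:ℝ) 1 := by
      filter_upwards [Ico_mem_nhdsLT (show (0:ℝ) < 1 by norm_num)] with r hr using hr
    filter_upwards [hev] with r hr
    have hc : ∀ t : ℝ, (r:ℂ) * Complex.exp (t * Complex.I) ∈ ball (0:ℂ) 1 := fun t => by
      rw [mem_ball, dist_zero_right, norm_mul, circ_one, mul_one, Complex.norm_real, Real.norm_of_nonneg hr.1]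
      exact hr.2
    unfold pairR
    simp only [fun t : ℝ => Jm_spec y (hc t)]
  obtain ⟨a, hga⟩ := MemH2.exists hg.1
  have haK : a ∈ Kmod φ := (memModel_iff hφd hφ1 hga).1 hg
  have hcg := gd_of_hasSum hc
  have hca : (a : ℕ → ℂ) = c := coef_eq a.gd hcg.1 fun z hz => by rw [← hga hz, hcg.2 hz]
  have hsumc : Summable (fun k => ‖c k‖ ^ 2) := by
    have := a.hasSum_sq.summable
    rwa [hca] at this
  have part1 : ∀ n : ℕ, ∀ᵐ ω ∂μ, (∑ k ∈ Finset.range (n + 1), c k * ω ^ k) = Gs 0 ω - ω ^ (n + 1) * Gs (n + 1) ω := by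
    intro n
    filter_upwards [hae, hGs 0, hGs (n + 1)] with ω hω h0 h1
    have hid : ∀ z ∈ ball (0:ℂ) 1, (∑ k ∈ Finset.range (n + 1), c k * z ^ k) = G 0 z - z ^ (n + 1) * G (n + 1) z := by
      intro z hz
      have k1 : HasSum (fun k => c k * z ^ k) (G 0 z) := by simpa using hG 0 z hz
      have k2 := (hG (n + 1) z hz).mul_left (z ^ (n + 1))
      have k3 := (hasSum_nat_add_iff' (n + 1)).2 k1
      have k4 : HasSum (fun k => c (k + (n + 1)) * z ^ (k + (n + 1))) (z ^ (n + 1) * G (n + 1) z) := by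
        refine hasSum_cg (fun k => ?_) k2
        ring
      have := k3.unique k4
      rw [← this]; ring
    have hr1 : Tendsto (fun r : ℝ => r • ω) (𝓝[<] (1:ℝ)) (𝓝 ω) := by
      have h2 : Continuous (fun r : ℝ => r • ω) := by fun_prop
      have := (h2.tendsto 1).mono_left (nhdsWithin_le_nhds (s := Iio 1))
      simpa using this
    have l1 : Tendsto (fun r : ℝ => ∑ k ∈ Finset.range (n + 1), c k * (r • ω) ^ k) (𝓝[<] (1:ℝ)) (𝓝 (∑ k ∈ Finset.range (n + 1), c k * ω ^ k)) :=
      tendsto_finsetSum _ fun k _ => (hr1.pow k).const_mul _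
    have l2 := h0.sub ((hr1.pow (n + 1)).mul h1)
    refine tendsto_nhds_unique_of_eventuallyEq l1 l2 ?_
    filter_upwards [Ico_mem_nhdsLT (show (0:ℝ) < 1 by norm_num)] with r hr
    refine hid _ ?_
    rw [mem_ball, dist_zero_right, norm_smul, hω, mul_one, Real.norm_of_nonneg hr.1]
    exact hr.2
  have part2 : ∀ n : ℕ, (∫ ω, ‖Gs 0 ω - ∑ k ∈ Finset.range (n + 1), c k * ω ^ k‖ ^ 2 ∂μ) = ∑' k : ℕ, ‖c (k + n + 1)‖ ^ 2 := by
    intro n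
    obtain ⟨b, hb, -⟩ := exists_back a (n + 1)
    have hbK := Kmod_back haK hb
    have hbG : ∀ z ∈ ball (0:ℂ) 1, fn b z = G (n + 1) z := by
      intro z hz
      have k1 := b.gd.hasSum hz
      have k2 := hG (n + 1) z hz
      refine k1.unique (hasSum_cg (fun k => ?_) k2)
      rw [hb k, hca]
    have hE := embed hφ μ hsupp hI hbK (F := Gs (n + 1)) (by
      filter_upwards [hae, hGs (n + 1)] with ω hω h1
      have hN1 : ∀ N : ℕ, 0 ≤ 1 - 1 / ((N + 1 : ℕ):ℝ) ∧ 1 - 1 / ((N + 1 : ℕ):ℝ) < 1 := fun N => by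
        have h1 : 0 < 1 / ((N + 1 : ℕ):ℝ) := by positivity
        have h2 : 1 / ((N + 1 : ℕ):ℝ) ≤ 1 := by
          rw [div_le_one (by positivity)]; push_cast; linarith [Nat.cast_nonneg (α := ℝ) N]
        constructor <;> linarith
      have hl : Tendsto (fun N : ℕ => (1:ℝ) - 1 / ((N + 1 : ℕ):ℝ)) atTop (𝓝[<] 1) := by
        refine tendsto_nhdsWithin_iff.2 ⟨?_, Eventually.of_forall fun N => (hN1 N).2⟩
        have h1 : Tendsto (fun N : ℕ => (1:ℝ) - 1 / ((N + 1 : ℕ):ℝ)) atTop (𝓝 (1 - 0)) := by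
          refine tendsto_const_nhds.sub ?_
          simpa using tendsto_one_div_add_atTop_nhds_zero_nat (𝕜 := ℝ)
        simpa using h1
      refine (h1.comp hl).congr fun N => ?_
      simp only [Function.comp_apply]
      rw [← Complex.real_smul, hbG]
      rw [mem_ball, dist_zero_right, norm_smul, hω, mul_one, Real.norm_of_nonneg (hN1 N).1]
      exact (hN1 N).2)
    have e1 : (∫ ω, ‖Gs 0 ω - ∑ k ∈ Finset.range (n + 1), c k * ω ^ k‖ ^ 2 ∂μ) = ∫ ω, ‖Gs (n + 1) ω‖ ^ 2 ∂μ := by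
      refine integral_congr_ae ?_
      filter_upwards [hae, part1 n] with ω hω h1
      rw [h1, sub_sub_cancel, norm_mul, norm_pow, hω, one_pow, one_mul]
    rw [e1, hE, ← b.hasSum_sq.tsum_eq]
    refine tsum_congr fun k => ?_
    rw [hb k, hca, add_assoc]
  refine ⟨part1, part2, ?_⟩
  simp only [part2]
  have h3 := (tendsto_sum_nat_add (fun k => ‖c k‖ ^ 2)).comp (tendsto_add_atTop_nat 1)
  exact h3
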